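/- arXiv:1506.08311 — 2 statements merged into one kernel-verified Lean document; each statement's English description precedes it below -/
import Mathlib

section
/- There exist a constant c > 0 and N ∈ ℕ such that for every multiple n of 4 with n ≥ N the following holds: every polyhedron Q ⊆ ℝ^{E(K_n)} satisfying TSP_n ⊆ Q and such that every (2,4)-uniform comb inequality x(δ(H)) + Σ_{i=1}^{k} x(δ(T_i)) ≥ 3k+1 is valid for all points of Q, has extension complexity xc(Q) ≥ 2^{c·n}. -/
section
open SimpleGraph Finset

attribute [local instance] Classical.propDecidable

/-- The edge set of the complete graph `K_n`: non-diagonal unordered pairs. -/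
abbrev KEdge (n : ℕ) := {e : Sym2 (Fin n) // ¬ e.IsDiag}

/-- An edge `e` crosses the vertex set `S` if it has an endpoint in `S`
and an endpoint outside `S`. -/
def crossing {V : Type*} (S : Finset V) (e : Sym2 V) : Prop :=
  (∃ a ∈ e, a ∈ S) ∧ (∃ a ∈ e, a ∉ S)

/-- `x(δ(S))`: the sum of the coordinates of `x` over the edges of `K_n`
crossing `S`. -/
noncomputable def cutSum {n : ℕ} (S : Finset (Fin n)) (x : KEdge n → ℝ) : ℝ :=
  ∑ e ∈ Finset.univ.filter (fun e : KEdge n => crossing S e.1), x e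

/-- A comb with handle `H` and teeth `T 0, …, T (k-1)`. -/
def IsComb {V : Type*} [Fintype V] [DecidableEq V]
    (H : Finset V) {k : ℕ} (T : Fin k → Finset V) : Prop :=
  3 ≤ k ∧ Odd k ∧
  (∀ i j, i ≠ j → Disjoint (T i) (T j)) ∧
  (∀ i, (H ∩ T i).Nonempty) ∧
  (H \ Finset.univ.biUnion T).Nonempty

/-- An `(h,t)`-uniform comb: every tooth has size `t` and meets the handle
in exactly `h` vertices. -/
def IsUniformComb {V : Type*} [Fintype V] [DecidableEq V] (h t : ℕ)
    (H : Finset V) {k : ℕ} (T : Fin k → Finset V) : Prop :=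
  IsComb H T ∧ ∀ i, (T i).card = t ∧ (H ∩ T i).card = h

/-- The extension complexity of `P ⊆ ℝ^ι`: the least number of facets
(inequalities) of a polyhedron `{x : Ax ≤ b}` projecting linearly onto `P`. -/
noncomputable def xc {ι : Type*} [Fintype ι] (P : Set (ι → ℝ)) : ℕ :=
  sInf {k | ∃ (m : ℕ) (A : Matrix (Fin k) (Fin m) ℝ) (b : Fin k → ℝ)
      (π : (Fin m → ℝ) →ₗ[ℝ] (ι → ℝ)),
      π '' {x | A.mulVec x ≤ b} = P}


/-- `P` is a polyhedron if it is the solution set of a finite system of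
linear inequalities. -/
def IsPolyhedron {ι : Type*} [Fintype ι] (P : Set (ι → ℝ)) : Prop :=
  ∃ (k : ℕ) (A : Fin k → ι → ℝ) (b : Fin k → ℝ),
    P = {x | ∀ i, ∑ j, A i j * x j ≤ b i}

/-- The TSP polytope: the convex hull of the characteristic vectors of the
edge sets of the Hamiltonian cycles (tours) of `K_n`. -/
noncomputable def tspPolytope (n : ℕ) : Set (KEdge n → ℝ) :=
  convexHull ℝ {x | ∃ (v : Fin n) (C : (⊤ : SimpleGraph (Fin n)).Walk v v),
    C.IsHamiltonianCycle ∧ x = fun e => if e.1 ∈ C.edges then (1 : ℝ) else 0}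

end

section
open Finset

theorem sum_update_bool {I : Type*} [Fintype I] [DecidableEq I] (f : (I → Bool) → ℝ) (a : I)
    (b : Bool) : ∑ x, f (Function.update x a b) = 2 * ∑ x, (if x a = b then f x else 0) := by
  have hinv : Function.Involutive (fun x : I → Bool => Function.update x a (!(x a))) := by
    intro x; simp
  have h1 : ∑ x, f (Function.update x a b) =
      ∑ x, (if x a = b then f x else 0) +
        ∑ x : I → Bool, (if x a = b then 0 else f (Function.update x a b)) := by
    rw [← Finset.sum_add_distrib]
    refine Finset.sum_congr rfl fun x _ => ?_
    by_cases h : x a = b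
    · subst h; simp
    · simp [h]
  have h2 : ∑ x : I → Bool, (if x a = b then 0 else f (Function.update x a b)) =
      ∑ x, (if x a = b then f x else 0) := by
    rw [← (Equiv.sum_comp (hinv.toPerm _) _)]
    refine Finset.sum_congr rfl fun x _ => ?_
    simp only [Function.Involutive.coe_toPerm, Function.update_self, Function.update_idem]
    by_cases h : x a = b
    · subst h; simp
    · have : (!x a) = b := by cases hx : x a <;> cases b <;> simp_all
      simp [h, this]
  rw [h1, h2]; ring

theorem exp_pair_le {w0 w1 : ℝ} (h0 : |w0| ≤ 2) (h1 : |w1| ≤ 2) (hs : w0 + w1 ≤ - (1 / 20)) :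
    Real.exp (w0 / 320) + Real.exp (w1 / 320) ≤ 2 * (1 - 1 / 25600) := by
  have key : ∀ w : ℝ, |w| ≤ 2 → Real.exp (w / 320) ≤ 1 + w / 320 + 4 / 102400 := by
    intro w hw
    have hw' : |w / 320| ≤ 1 := by
      rw [abs_div, abs_of_pos (by norm_num : (0:ℝ) < 320)]
      rw [div_le_one (by norm_num)]; linarith
    have h := (abs_le.1 (Real.abs_exp_sub_one_sub_id_le hw')).2
    have h2 : w ^ 2 ≤ 4 := by
      have := sq_abs w
      nlinarith [abs_nonneg w]
    have : (w / 320) ^ 2 ≤ 4 / 102400 := by rw [div_pow]; norm_num; linarith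
    linarith
  have := key w0 h0
  have := key w1 h1
  linarith

/-- Most coordinates of a dense Boolean function are unbiased. -/
theorem unbiased {I : Type*} [Fintype I] [DecidableEq I] (f : (I → Bool) → ℝ) (α : ℝ)
    (h0 : ∀ x, 0 ≤ f x) (h1 : ∀ x, f x ≤ α) :
    ∑ a : I, max (∑ x, f (Function.update x a false) - ∑ x, f (Function.update x a true)) 0 ≤
      (1 / 40) * ∑ a : I, ∑ x, f (Function.update x a false) +
        α * 320 * (2 * (1 - 1 / 25600)) ^ Fintype.card I := by
  classical
  set s : I → ℝ := fun a => if ∑ x, f (Function.update x a true) ≤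
    ∑ x, f (Function.update x a false) then 1 else 0 with hs
  set w : I → Bool → ℝ := fun a b =>
    s a * (if b = false then 2 else -2) - (1 / 40) * (if b = false then 2 else 0) with hw
  have e1 : ∀ a, max (∑ x, f (Function.update x a false) - ∑ x, f (Function.update x a true)) 0
      - (1 / 40) * ∑ x, f (Function.update x a false) = ∑ x, f x * w a (x a) := by
    intro a
    have : max (∑ x, f (Function.update x a false) - ∑ x, f (Function.update x a true)) 0
      = s a * (∑ x, f (Function.update x a false) - ∑ x, f (Function.update x a true)) := by
      simp only [hs]
      split_ifs with h
      · rw [max_eq_left (by linarith)]; ring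
      · rw [max_eq_right (by linarith)]; ring
    rw [this, sum_update_bool, sum_update_bool, ← mul_sub, ← Finset.sum_sub_distrib]
    simp only [Finset.mul_sum]
    rw [← Finset.sum_sub_distrib]
    refine Finset.sum_congr rfl fun x _ => ?_
    simp only [hw]
    cases x a <;> simp <;> ring
  have e2 : ∑ a : I, max (∑ x, f (Function.update x a false) - ∑ x, f (Function.update x a true)) 0
      - (1 / 40) * ∑ a : I, ∑ x, f (Function.update x a false) =
      ∑ x, f x * ∑ a, w a (x a) := by
    rw [Finset.mul_sum, ← Finset.sum_sub_distrib]
    rw [Finset.sum_congr rfl fun a _ => e1 a, Finset.sum_comm]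
    simp only [Finset.mul_sum]
  have e3 : ∀ x, f x * ∑ a, w a (x a) ≤ α * 320 * ∏ a, Real.exp (w a (x a) / 320) := by
    intro x
    rw [← Real.exp_sum]
    have hY : ∑ a, w a (x a) ≤ 320 * Real.exp (∑ a, w a (x a) / 320) := by
      rw [← Finset.sum_div]
      have := Real.add_one_le_exp ((∑ a, w a (x a)) / 320)
      linarith
    have hp := Real.exp_pos (∑ a, w a (x a) / 320)
    calc f x * ∑ a, w a (x a) ≤ f x * (320 * Real.exp (∑ a, w a (x a) / 320)) :=
          mul_le_mul_of_nonneg_left hY (h0 x)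
      _ ≤ α * (320 * Real.exp (∑ a, w a (x a) / 320)) :=
          mul_le_mul_of_nonneg_right (h1 x) (by positivity)
      _ = _ := by ring
  have e4 : ∑ x : I → Bool, ∏ a, Real.exp (w a (x a) / 320) ≤
      (2 * (1 - 1 / 25600)) ^ Fintype.card I := by
    have := (Finset.prod_univ_sum (fun _ : I => (Finset.univ : Finset Bool))
      (fun a b => Real.exp (w a b / 320)))
    rw [Fintype.piFinset_univ] at this
    rw [← this]
    rw [← Finset.card_univ, ← Finset.prod_const]
    refine Finset.prod_le_prod (fun a _ => Finset.sum_nonneg fun b _ => (Real.exp_pos _).le) ?_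
    intro a _
    rw [Fintype.sum_bool]
    have h01 : s a = 0 ∨ s a = 1 := by
      simp only [hs]; split_ifs
      · exact Or.inr rfl
      · exact Or.inl rfl
    have ht : w a true = - 2 * s a := by simp [hw]; ring
    have hf : w a false = 2 * s a - 1 / 20 := by
      simp only [hw, if_true]; ring
    rw [ht, hf]
    apply exp_pair_le
    · rcases h01 with h | h <;> rw [h] <;> norm_num
    · rcases h01 with h | h <;> rw [h, abs_le] <;> norm_num
    · rcases h01 with h | h <;> rw [h] <;> norm_num
  have hα : 0 ≤ α := (h0 (fun _ => false)).trans (h1 _)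
  have : ∑ x, f x * ∑ a, w a (x a) ≤ α * 320 * (2 * (1 - 1 / 25600)) ^ Fintype.card I := by
    refine (Finset.sum_le_sum fun x _ => e3 x).trans ?_
    rw [← Finset.mul_sum]
    exact mul_le_mul_of_nonneg_left e4 (by positivity)
  linarith

/-- The symmetrized form. -/
theorem sym_step {G I : Type*} [Group G] [Fintype G] [Fintype I] [DecidableEq I] (o : I)
    (F : G → (I → Bool) → ℝ) (α β : ℝ) (h0 : ∀ σ x, 0 ≤ F σ x) (h1 : ∀ σ x, F σ x ≤ α)
    (τ : I → G) (hF : ∀ σ a x, F (σ * τ a) x = F σ (x ∘ Equiv.swap o a))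
    (r : G → ℝ) (hr0 : ∀ σ, 0 ≤ r σ) (hr1 : ∀ σ, r σ ≤ β) (hr : ∀ σ a, r (σ * τ a) = r σ) :
    ∑ σ, r σ * max (∑ x, F σ (Function.update x o false) - ∑ x, F σ (Function.update x o true)) 0
      ≤ (1 / 40) * ∑ σ, r σ * ∑ x, F σ (Function.update x o false) +
        Fintype.card G * (β * (α * 320 * (2 * (1 - 1 / 25600)) ^ Fintype.card I)) := by
  have hsum : ∀ σ a b, ∑ x, F (σ * τ a) (Function.update x o b) =
      ∑ x, F σ (Function.update x a b) := by
    intro σ a b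
    simp only [hF]
    have : ∀ x : I → Bool, (Function.update x o b) ∘ (Equiv.swap o a) =
        Function.update (x ∘ Equiv.swap o a) a b := by
      intro x
      ext i
      simp only [Function.comp, Function.update_apply]
      by_cases h : i = a
      · subst h; simp
      · have : Equiv.swap o a i ≠ o := by
          intro h'
          apply h
          have := congrArg (Equiv.swap o a) h'
          simpa using this
        simp [h, this]
    simp only [this]
    exact Equiv.sum_comp (Equiv.arrowCongr (Equiv.swap o a) (Equiv.refl Bool))
      (fun x => F σ (Function.update x a b))
  set E := α * 320 * (2 * (1 - 1 / 25600)) ^ Fintype.card I with hE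
  have hα : 0 ≤ α := (h0 1 (fun _ => false)).trans (h1 _ _)
  have hE0 : 0 ≤ E := by rw [hE]; positivity
  have hβ : 0 ≤ β := (hr0 1).trans (hr1 1)
  have hL : ∀ a : I, ∑ σ, r σ * max (∑ x, F σ (Function.update x o false) - ∑ x, F σ (Function.update x o true)) 0
     = ∑ σ, r σ * max (∑ x, F σ (Function.update x a false) - ∑ x, F σ (Function.update x a true)) 0 := by
    intro a
    rw [← Equiv.sum_comp (Equiv.mulRight (τ a))]
    simp only [Equiv.coe_mulRight, hsum, hr]
  have hR : ∀ a : I, ∑ σ, r σ * ∑ x, F σ (Function.update x o false)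
     = ∑ σ, r σ * ∑ x, F σ (Function.update x a false) := by
    intro a
    rw [← Equiv.sum_comp (Equiv.mulRight (τ a))]
    simp only [Equiv.coe_mulRight, hsum, hr]
  set LL := ∑ σ, r σ * max (∑ x, F σ (Function.update x o false) - ∑ x, F σ (Function.update x o true)) 0
  set RR := ∑ σ, r σ * ∑ x, F σ (Function.update x o false)
  have hmain : (Fintype.card I : ℝ) * LL ≤ (1 / 40) * (Fintype.card I * RR) +
      Fintype.card G * (β * E) := by
    have e1 : (Fintype.card I : ℝ) * LL = ∑ σ, r σ * ∑ a, max (∑ x, F σ (Function.update x a false) - ∑ x, F σ (Function.update x a true)) 0 := by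
      rw [← nsmul_eq_mul, ← Finset.card_univ, ← Finset.sum_const, Finset.sum_congr rfl fun a _ => hL a]
      rw [Finset.sum_comm]; simp only [Finset.mul_sum]
    have e2 : (Fintype.card I : ℝ) * RR = ∑ σ, r σ * ∑ a, ∑ x, F σ (Function.update x a false) := by
      rw [← nsmul_eq_mul, ← Finset.card_univ, ← Finset.sum_const, Finset.sum_congr rfl fun a _ => hR a]
      rw [Finset.sum_comm]; simp only [Finset.mul_sum]
    rw [e1, e2, Finset.mul_sum]
    have : (Fintype.card G : ℝ) * (β * E) = ∑ _σ : G, β * E := by simp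
    rw [this, ← Finset.sum_add_distrib]
    refine Finset.sum_le_sum fun σ _ => ?_
    have := unbiased (F σ) α (h0 σ) (h1 σ)
    have h2 := mul_le_mul_of_nonneg_left this (hr0 σ)
    have h3 := mul_le_mul_of_nonneg_right (hr1 σ) hE0
    rw [← hE] at h2
    linarith
  have hI : (1 : ℝ) ≤ Fintype.card I := by
    have : 0 < Fintype.card I := Fintype.card_pos_iff.2 ⟨o⟩
    exact_mod_cast this
  have hX : 0 ≤ (Fintype.card G : ℝ) * (β * E) := by positivity
  by_contra hcon
  push Not at hcon
  nlinarith

/-- The pointwise inequality on a five-cycle. -/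
theorem five_cycle (p q : Fin 5 → ℝ) (P Q : ℝ) (hp : ∀ i, 0 ≤ p i) (hq : ∀ i, 0 ≤ q i)
    (hP : 0 ≤ P) (hQ : 0 ≤ Q) :
    ∑ i, p i * q i ≤ (2 + 1 / 8) * (P * Q) + 60 * ∑ i, (p i * q (i + 2) + p (i + 2) * q i) +
      ∑ i, (q i * max (p i - P) 0 + p i * max (q i - Q) 0) := by
  set a : Fin 5 → ℝ := fun i => min (p i) P * min (q i) Q with ha
  have h1 : ∀ i, p i * q i ≤ a i + (q i * max (p i - P) 0 + p i * max (q i - Q) 0) := by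
    intro i
    have e1 : max (p i - P) 0 = p i - min (p i) P := by
      rcases le_total (p i) P with h | h
      · rw [max_eq_right (by linarith), min_eq_left h]; ring
      · rw [max_eq_left (by linarith), min_eq_right h]
    have e2 : max (q i - Q) 0 = q i - min (q i) Q := by
      rcases le_total (q i) Q with h | h
      · rw [max_eq_right (by linarith), min_eq_left h]; ring
      · rw [max_eq_left (by linarith), min_eq_right h]
    simp only [ha]
    have h3 : min (q i) Q ≤ q i := min_le_left _ _
    have h4 : min (p i) P ≤ p i := min_le_left _ _
    rw [e1, e2]
    nlinarith [hp i, hq i]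
  have ha1 : ∀ i, a i ≤ P * Q := fun i =>
    mul_le_mul (min_le_right _ _) (min_le_right _ _) (le_min (hq i) hQ) hP
  have hpair : ∀ i j, (1 / 24) * (P * Q) < a i → (1 / 24) * (P * Q) < a j →
      (1 / 12) * (P * Q) ≤ p i * q j + p j * q i := by
    intro i j hi hj
    have hPQ : 0 ≤ P * Q := mul_nonneg hP hQ
    have hai : a i ≤ p i * q i := mul_le_mul (min_le_left _ _) (min_le_left _ _) (le_min (hq i) hQ) (hp i)
    have haj : a j ≤ p j * q j := mul_le_mul (min_le_left _ _) (min_le_left _ _) (le_min (hq j) hQ) (hp j)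
    have hx : 0 ≤ p i * q j := mul_nonneg (hp i) (hq j)
    have hy : 0 ≤ p j * q i := mul_nonneg (hp j) (hq i)
    have hxy : (p i * q j) * (p j * q i) = (p i * q i) * (p j * q j) := by ring
    have : ((1 / 24) * (P * Q)) ^ 2 ≤ (p i * q j) * (p j * q i) := by
      rw [hxy, sq]
      exact mul_le_mul (hi.le.trans hai) (hj.le.trans haj) (by positivity) (mul_nonneg (hp i) (hq i))
    by_contra hc
    push Not at hc
    nlinarith [sq_nonneg (p i * q j - p j * q i)]
  have hsum : ∑ i, a i ≤ (2 + 1 / 8) * (P * Q) + 60 * ∑ i, (p i * q (i + 2) + p (i + 2) * q i) := by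
    have hnn : ∀ i, 0 ≤ p i * q (i + 2) + p (i + 2) * q i := fun i =>
      add_nonneg (mul_nonneg (hp _) (hq _)) (mul_nonneg (hp _) (hq _))
    have hPQ : 0 ≤ P * Q := mul_nonneg hP hQ
    have hSnn : 0 ≤ ∑ i, (p i * q (i + 2) + p (i + 2) * q i) := Finset.sum_nonneg fun i _ => hnn i
    by_cases hex : ∃ i, (1 / 24) * (P * Q) < a i ∧ (1 / 24) * (P * Q) < a (i + 2)
    · obtain ⟨i, hi, hj⟩ := hex
      have h2 := hpair i (i + 2) hi hj
      have h3 := Finset.single_le_sum (fun i _ => hnn i) (Finset.mem_univ i)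
      have h4 : ∑ i, a i ≤ ∑ _i : Fin 5, P * Q := Finset.sum_le_sum fun i _ => ha1 i
      simp only [Finset.sum_const, Finset.card_univ, Fintype.card_fin, nsmul_eq_mul] at h4
      push_cast at h4
      linarith
    · push Not at hex
      have g0 := hex 0; have g1 := hex 1; have g2 := hex 2; have g3 := hex 3; have g4 := hex 4
      have b0 := ha1 0; have b1 := ha1 1; have b2 := ha1 2; have b3 := ha1 3; have b4 := ha1 4
      have e3 : (3 : Fin 5) + 2 = 0 := rfl
      have e4 : (4 : Fin 5) + 2 = 1 := rfl
      have e0 : (0 : Fin 5) + 2 = 2 := rfl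
      have e1 : (1 : Fin 5) + 2 = 3 := rfl
      have e2 : (2 : Fin 5) + 2 = 4 := rfl
      rw [e0] at g0; rw [e1] at g1; rw [e2] at g2; rw [e3] at g3; rw [e4] at g4
      have : ∑ i, a i ≤ (2 + 1 / 8) * (P * Q) := by
        rw [Fin.sum_univ_five]
        clear_value a
        generalize a 0 = a0 at *
        generalize a 1 = a1 at *
        generalize a 2 = a2 at *
        generalize a 3 = a3 at *
        generalize a 4 = a4 at *
        generalize P * Q = t at *
        clear hpair h1 ha1 hex hSnn hnn
        by_cases c0 : 1 / 24 * t < a0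
        · have := g0 c0
          by_cases c1 : 1 / 24 * t < a1
          · have := g1 c1
            by_cases c4 : 1 / 24 * t < a4
            · have := g4 c4; linarith
            · linarith
          · by_cases c3 : 1 / 24 * t < a3
            · have := g3 c3; linarith
            · linarith
        · by_cases c1 : 1 / 24 * t < a1
          · have := g1 c1
            by_cases c4 : 1 / 24 * t < a4
            · have := g4 c4; linarith
            · linarith
          · by_cases c2 : 1 / 24 * t < a2
            · have := g2 c2; linarith
            · linarith
      linarith
  calc ∑ i, p i * q i ≤ ∑ i, (a i + (q i * max (p i - P) 0 + p i * max (q i - Q) 0)) :=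
        Finset.sum_le_sum fun i _ => h1 i
    _ ≤ _ := by rw [Finset.sum_add_distrib]; linarith

end

section
open Finset

abbrev Pos (m : ℕ) := (Fin 5 × Bool) ⊕ ((Fin m × Bool) ⊕ (Fin m × Bool × Bool))

set_option synthInstance.maxSize 1000 in
instance permPosFintype (m : ℕ) : Fintype (Equiv.Perm (Pos m)) := inferInstance

def cutPos {m : ℕ} (i : Fin 5) (x : Option (Fin m) → Bool) : Pos m → Bool
  | .inl (j, d) => !d && (if j = i ∨ j = i + 1 then x none else true)
  | .inr (.inl (a, _)) => x (some a)
  | .inr (.inr _) => false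

def matchFun {m : ℕ} (i : Fin 5) (y : Option (Fin m) → Bool) : Pos m → Pos m
  | .inl (j, d) => if y none = true then .inl (j, !d) else if j = i then .inl (i + 1, d)
      else if j = i + 1 then .inl (i, d) else .inl (j, !d)
  | .inr (.inl (a, t)) => .inr (.inl (a, !t))
  | .inr (.inr (b, s, t)) => if y (some b) = true then .inr (.inr (b, !s, t))
      else .inr (.inr (b, s, !t))

theorem matchFun_inv {m : ℕ} (i : Fin 5) (y : Option (Fin m) → Bool) :
    Function.Involutive (matchFun i y) := by
  have hi : i + 1 ≠ i := by revert i; decide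
  rintro (⟨j, d⟩ | ⟨a, t⟩ | ⟨b, s, t⟩)
  · by_cases h0 : y none = true
    · simp [matchFun, h0]
    · by_cases h1 : j = i
      · subst h1; simp [matchFun, h0, hi]
      · by_cases h2 : j = i + 1
        · subst h2; simp [matchFun, h0, hi]
        · simp [matchFun, h0, h1, h2]
  · simp [matchFun]
  · by_cases h0 : y (some b) = true <;> simp [matchFun, h0]

def matchPerm {m : ℕ} (i : Fin 5) (y : Option (Fin m) → Bool) : Equiv.Perm (Pos m) :=
  (matchFun_inv i y).toPerm _

theorem matchPerm_apply {m : ℕ} (i : Fin 5) (y : Option (Fin m) → Bool) (v : Pos m) :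
    matchPerm i y v = matchFun i y v := rfl

theorem matchPerm_sq {m : ℕ} (i : Fin 5) (y : Option (Fin m) → Bool) :
    matchPerm i y * matchPerm i y = 1 := by
  ext1 v; exact matchFun_inv i y v

theorem matchPerm_ne {m : ℕ} (i : Fin 5) (y : Option (Fin m) → Bool) (v : Pos m) :
    matchPerm i y v ≠ v := by
  have hi : i + 1 ≠ i := by revert i; decide
  rw [matchPerm_apply]
  rcases v with (⟨j, d⟩ | ⟨a, t⟩ | ⟨b, s, t⟩)
  · by_cases h0 : y none = true
    · simp [matchFun, h0]
    · by_cases h1 : j = i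
      · subst h1; simp [matchFun, h0, hi]
      · by_cases h2 : j = i + 1
        · subst h2; simp [matchFun, h0, hi, hi.symm]
        · simp [matchFun, h0, h1, h2]
  · simp [matchFun]
  · by_cases h0 : y (some b) = true <;> simp [matchFun, h0]

/-- swap the pair `c_i, c_{i+1}` with the `a`-th pair. -/
def tauAFun {m : ℕ} (i : Fin 5) (a : Fin m) : Pos m → Pos m
  | .inl (j, d) => if d = false ∧ j = i then .inr (.inl (a, false)) else
      if d = false ∧ j = i + 1 then .inr (.inl (a, true)) else .inl (j, d)
  | .inr (.inl (a', t)) => if a' = a then (if t = true then .inl (i + 1, false) else .inl (i, false))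
      else .inr (.inl (a', t))
  | .inr (.inr z) => .inr (.inr z)

theorem tauAFun_inv {m : ℕ} (i : Fin 5) (a : Fin m) : Function.Involutive (tauAFun i a) := by
  have hi : i + 1 ≠ i := by revert i; decide
  rintro (⟨j, d⟩ | ⟨a', t⟩ | z)
  · by_cases h0 : d = false
    · subst h0
      by_cases h1 : j = i
      · subst h1; simp [tauAFun]
      · by_cases h2 : j = i + 1
        · subst h2; simp [tauAFun, hi]
        · simp [tauAFun, h1, h2]
    · simp [tauAFun, h0]
  · by_cases h0 : a' = a
    · subst h0; cases t <;> simp [tauAFun, hi]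
    · simp [tauAFun, h0]
  · simp [tauAFun]

def tauA {m : ℕ} (i : Fin 5) : Option (Fin m) → Equiv.Perm (Pos m)
  | none => 1
  | some a => (tauAFun_inv i a).toPerm _

def tauBFun {m : ℕ} (i : Fin 5) (b : Fin m) : Pos m → Pos m
  | .inl (j, d) => if j = i then .inr (.inr (b, d, false)) else
      if j = i + 1 then .inr (.inr (b, d, true)) else .inl (j, d)
  | .inr (.inl z) => .inr (.inl z)
  | .inr (.inr (b', s, t)) => if b' = b then (if t = true then .inl (i + 1, s) else .inl (i, s))
      else .inr (.inr (b', s, t))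

theorem tauBFun_inv {m : ℕ} (i : Fin 5) (b : Fin m) : Function.Involutive (tauBFun i b) := by
  have hi : i + 1 ≠ i := by revert i; decide
  rintro (⟨j, d⟩ | z | ⟨b', s, t⟩)
  · by_cases h1 : j = i
    · subst h1; simp [tauBFun]
    · by_cases h2 : j = i + 1
      · subst h2; simp [tauBFun, hi]
      · simp [tauBFun, h1, h2]
  · simp [tauBFun]
  · by_cases h0 : b' = b
    · subst h0; cases t <;> simp [tauBFun, hi]
    · simp [tauBFun, h0]

def tauB {m : ℕ} (i : Fin 5) : Option (Fin m) → Equiv.Perm (Pos m)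
  | none => 1
  | some b => (tauBFun_inv i b).toPerm _

theorem tauA_inv {m : ℕ} (i : Fin 5) (a : Option (Fin m)) : (tauA i a)⁻¹ = tauA i a := by
  cases a with
  | none => simp [tauA]
  | some a => ext1 v; rfl

theorem tauB_inv {m : ℕ} (i : Fin 5) (a : Option (Fin m)) : (tauB i a)⁻¹ = tauB i a := by
  cases a with
  | none => simp [tauB]
  | some a => ext1 v; rfl

theorem cutPos_tauA {m : ℕ} (i : Fin 5) (x : Option (Fin m) → Bool) (a : Option (Fin m))
    (v : Pos m) : cutPos i x (tauA i a v) = cutPos i (x ∘ Equiv.swap none a) v := by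
  cases a with
  | none => simp [tauA]
  | some a =>
    change cutPos i x (tauAFun i a v) = _
    have hi : i + 1 ≠ i := by revert i; decide
    rcases v with (⟨j, d⟩ | ⟨a', t⟩ | z)
    · by_cases h0 : d = false
      · subst h0
        by_cases h1 : j = i
        · subst h1; simp [tauAFun, cutPos]
        · by_cases h2 : j = i + 1
          · subst h2; simp [tauAFun, hi, cutPos]
          · simp [tauAFun, h1, h2, cutPos]
      · simp [tauAFun, h0, cutPos]
    · by_cases h0 : a' = a
      · subst h0; cases t <;> simp [tauAFun, hi, cutPos]
      · have : Equiv.swap none (some a) (some a') = some a' :=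
          Equiv.swap_apply_of_ne_of_ne (by simp) (by simpa using h0)
        simp [tauAFun, h0, cutPos, this]
    · simp [tauAFun, cutPos]

theorem cutPos_tauB {m : ℕ} (i : Fin 5) (x : Option (Fin m) → Bool) (hx : x none = false)
    (b : Option (Fin m))
    (v : Pos m) : cutPos i x (tauB i b v) = cutPos i x v := by
  cases b with
  | none => simp [tauB]
  | some b =>
    change cutPos i x (tauBFun i b v) = _
    have hi : i + 1 ≠ i := by revert i; decide
    rcases v with (⟨j, d⟩ | z | ⟨b', s, t⟩)
    · by_cases h1 : j = i
      · subst h1; simp [tauBFun, cutPos, hx]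
      · by_cases h2 : j = i + 1
        · subst h2; simp [tauBFun, hi, cutPos, hx]
        · simp [tauBFun, h1, h2, cutPos]
    · simp [tauBFun, cutPos]
    · by_cases h0 : b' = b
      · subst h0; cases t <;> simp [tauBFun, hi, cutPos, hx]
      · simp [tauBFun, h0, cutPos]

theorem matchFun_tauB {m : ℕ} (i : Fin 5) (y : Option (Fin m) → Bool) (b : Fin m) (v : Pos m) :
    matchFun i y (tauBFun i b v) = tauBFun i b (matchFun i (y ∘ Equiv.swap none (some b)) v) := by
  have hi : i + 1 ≠ i := by revert i; decide
  rcases v with (⟨j, d⟩ | z | ⟨b', s, t⟩)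
  · by_cases h1 : j = i
    · subst h1; by_cases hy : y (some b) = true <;> simp [tauBFun, matchFun, hy, hi]
    · by_cases h2 : j = i + 1
      · subst h2; by_cases hy : y (some b) = true <;> simp [tauBFun, matchFun, hy, hi]
      · by_cases hy : y (some b) = true <;> simp [tauBFun, h1, h2, matchFun, hy]
  · simp [tauBFun, matchFun]
  · by_cases h0 : b' = b
    · subst h0; by_cases hy : y none = true <;> cases t <;> simp [tauBFun, hi, matchFun, hy]
    · have : Equiv.swap none (some b) (some b') = some b' :=
        Equiv.swap_apply_of_ne_of_ne (by simp) (by simpa using h0)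
      by_cases hy : y (some b') = true <;> simp [tauBFun, h0, matchFun, this, hy]

theorem matchFun_tauA {m : ℕ} (i : Fin 5) (y : Option (Fin m) → Bool) (hy : y none = false)
    (a : Fin m) (v : Pos m) :
    matchFun i y (tauAFun i a v) = tauAFun i a (matchFun i y v) := by
  have hi : i + 1 ≠ i := by revert i; decide
  rcases v with (⟨j, d⟩ | ⟨a', t⟩ | ⟨b', s, t⟩)
  · by_cases h0 : d = false
    · subst h0
      by_cases h1 : j = i
      · subst h1; simp [tauAFun, matchFun, hy, hi]
      · by_cases h2 : j = i + 1
        · subst h2; simp [tauAFun, hi, matchFun, hy]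
        · simp [tauAFun, h1, h2, matchFun, hy]
    · by_cases h1 : j = i
      · subst h1; simp [tauAFun, matchFun, hy, hi, h0]
      · by_cases h2 : j = i + 1
        · subst h2; simp [tauAFun, hi, matchFun, hy, h0]
        · simp [tauAFun, h1, h2, matchFun, hy, h0]
  · by_cases h0 : a' = a
    · subst h0; cases t <;> simp [tauAFun, hi, matchFun, hy]
    · simp [tauAFun, h0, matchFun]
  · by_cases h : y (some b') = true <;> simp [tauAFun, matchFun, h]

theorem conj_tauB {m : ℕ} (i : Fin 5) (y : Option (Fin m) → Bool) (b : Option (Fin m)) :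
    tauB i b * matchPerm i y * (tauB i b)⁻¹ = matchPerm i (y ∘ Equiv.swap none b) := by
  cases b with
  | none => simp [tauB]
  | some b =>
    rw [tauB_inv]
    ext1 v
    change tauBFun i b (matchFun i y (tauBFun i b v)) = matchFun i _ v
    rw [matchFun_tauB, tauBFun_inv]

theorem conj_tauA {m : ℕ} (i : Fin 5) (y : Option (Fin m) → Bool) (hy : y none = false)
    (a : Option (Fin m)) :
    tauA i a * matchPerm i y * (tauA i a)⁻¹ = matchPerm i y := by
  cases a with
  | none => simp [tauA]
  | some b =>
    rw [tauA_inv]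
    ext1 v
    change tauAFun i b (matchFun i y (tauAFun i b v)) = matchFun i _ v
    rw [matchFun_tauA _ _ hy, tauAFun_inv]

theorem cutPos_true {m : ℕ} (i : Fin 5) (x : Option (Fin m) → Bool) (hx : x none = true) :
    cutPos i x = cutPos 0 x := by
  funext v
  rcases v with (⟨j, d⟩ | ⟨a', t⟩ | ⟨b', s, t⟩) <;> simp [cutPos, hx]

theorem matchPerm_true {m : ℕ} (i : Fin 5) (x : Option (Fin m) → Bool) (hx : x none = true) :
    matchPerm i x = matchPerm 0 x := by
  ext1 v
  simp only [matchPerm_apply]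
  rcases v with (⟨j, d⟩ | ⟨a', t⟩ | ⟨b', s, t⟩) <;> simp [matchFun, hx]

/-- action on cuts -/
def actU {m : ℕ} (σ : Equiv.Perm (Pos m)) (U : Pos m → Bool) : Pos m → Bool := fun v => U (σ⁻¹ v)

noncomputable def pS {m : ℕ} (f : (Pos m → Bool) → ℝ) (b : Bool) (i : Fin 5)
    (σ : Equiv.Perm (Pos m)) : ℝ :=
  ∑ x : Option (Fin m) → Bool, f (actU σ (cutPos i (Function.update x none b)))

noncomputable def qS {m : ℕ} (g : Equiv.Perm (Pos m) → ℝ) (b : Bool) (i : Fin 5)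
    (σ : Equiv.Perm (Pos m)) : ℝ :=
  ∑ x : Option (Fin m) → Bool, g (σ * matchPerm i (Function.update x none b) * σ⁻¹)

theorem core_ineq {m : ℕ} (f : (Pos m → Bool) → ℝ) (g : Equiv.Perm (Pos m) → ℝ) (α β : ℝ)
    (hf0 : ∀ U, 0 ≤ f U) (hf1 : ∀ U, f U ≤ α) (hg0 : ∀ M, 0 ≤ g M) (hg1 : ∀ M, g M ≤ β) :
    (19 / 20) * ∑ σ, ∑ i, pS f false i σ * qS g false i σ ≤
      (17 / 8) * ∑ σ, pS f true 0 σ * qS g true 0 σ +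
      60 * ∑ σ, ∑ i, (pS f false i σ * qS g false (i + 2) σ + pS f false (i + 2) σ * qS g false i σ)
      + 10 * (Fintype.card (Equiv.Perm (Pos m)) *
        ((2 ^ (m + 1) * β) * (α * 320 * (2 * (1 - 1 / 25600)) ^ (m + 1)))) := by
  have hp0 : ∀ b i σ, 0 ≤ pS f b i σ := fun b i σ => Finset.sum_nonneg fun _ _ => hf0 _
  have hq0 : ∀ b i σ, 0 ≤ qS g b i σ := fun b i σ => Finset.sum_nonneg fun _ _ => hg0 _
  have hp1 : ∀ b i σ, pS f b i σ ≤ 2 ^ (m + 1) * α := by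
    intro b i σ
    refine (Finset.sum_le_sum fun _ _ => hf1 _).trans ?_
    simp
  have hq1 : ∀ b i σ, qS g b i σ ≤ 2 ^ (m + 1) * β := by
    intro b i σ
    refine (Finset.sum_le_sum fun _ _ => hg1 _).trans ?_
    simp
  have hpt : ∀ i σ, pS f true i σ = pS f true 0 σ := by
    intro i σ
    refine Finset.sum_congr rfl fun x _ => ?_
    rw [cutPos_true i _ (by simp)]
  have hqt : ∀ i σ, qS g true i σ = qS g true 0 σ := by
    intro i σ
    refine Finset.sum_congr rfl fun x _ => ?_
    rw [matchPerm_true i _ (by simp)]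
  have stepP : ∀ i, ∑ σ, qS g false i σ * max (pS f false i σ - pS f true i σ) 0 ≤
      (1 / 40) * ∑ σ, qS g false i σ * pS f false i σ + Fintype.card (Equiv.Perm (Pos m)) *
        ((2 ^ (m + 1) * β) * (α * 320 * (2 * (1 - 1 / 25600)) ^ (m + 1))) := by
    intro i
    have := sym_step (none : Option (Fin m)) (fun σ x => f (actU σ (cutPos i x))) α (2 ^ (m + 1) * β)
      (fun _ _ => hf0 _) (fun _ _ => hf1 _) (tauA i) ?_ (qS g false i) (hq0 false i) (hq1 false i) ?_
    · simp only [Fintype.card_option, Fintype.card_fin] at this; exact this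
    · intro σ a x
      congr 1
      funext v
      simp only [actU, mul_inv_rev, tauA_inv, Equiv.Perm.mul_apply]
      exact cutPos_tauA i x a _
    · intro σ a
      refine Finset.sum_congr rfl fun x _ => ?_
      have := conj_tauA i (Function.update x none false) (by simp) a
      congr 1
      rw [← this]
      simp only [mul_inv_rev, mul_assoc]
      rw [← mul_assoc (tauA i a), ← mul_assoc, ← mul_assoc] 
      conv_rhs => rw [← this]
      simp only [mul_assoc]
  have stepQ : ∀ i, ∑ σ, pS f false i σ * max (qS g false i σ - qS g true i σ) 0 ≤
      (1 / 40) * ∑ σ, pS f false i σ * qS g false i σ + Fintype.card (Equiv.Perm (Pos m)) *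
        ((2 ^ (m + 1) * α) * (β * 320 * (2 * (1 - 1 / 25600)) ^ (m + 1))) := by
    intro i
    have := sym_step (none : Option (Fin m)) (fun σ x => g (σ * matchPerm i x * σ⁻¹)) β (2 ^ (m + 1) * α)
      (fun _ _ => hg0 _) (fun _ _ => hg1 _) (tauB i) ?_ (pS f false i) (hp0 false i) (hp1 false i) ?_
    · simp only [Fintype.card_option, Fintype.card_fin] at this; exact this
    · intro σ a x
      congr 1
      rw [← conj_tauB]
      simp only [mul_inv_rev, mul_assoc]
    · intro σ a
      refine Finset.sum_congr rfl fun x _ => ?_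
      congr 1
      funext v
      simp only [actU, mul_inv_rev, tauB_inv, Equiv.Perm.mul_apply]
      exact cutPos_tauB i _ (by simp) a _
  have h5 : ∀ σ, _ := fun σ => five_cycle (fun i => pS f false i σ) (fun i => qS g false i σ)
    (pS f true 0 σ) (qS g true 0 σ) (fun i => hp0 _ i σ) (fun i => hq0 _ i σ) (hp0 _ _ _) (hq0 _ _ _)
  have h6 := Finset.sum_le_sum fun (σ : Equiv.Perm (Pos m)) (_ : σ ∈ Finset.univ) => h5 σ
  simp only [Finset.sum_add_distrib, ← Finset.mul_sum] at h6
  simp only [Finset.sum_add_distrib]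
  have h7 := Finset.sum_le_sum fun (i : Fin 5) (_ : i ∈ Finset.univ) => stepP i
  have h8 := Finset.sum_le_sum fun (i : Fin 5) (_ : i ∈ Finset.univ) => stepQ i
  simp only [Finset.sum_add_distrib, ← Finset.mul_sum, hpt, hqt] at h7 h8
  rw [Finset.sum_comm] at h7 h8
  simp only [Finset.sum_const, Finset.card_univ, Fintype.card_fin, nsmul_eq_mul] at h7 h8
  have e1 : ∑ i : Fin 5, ∑ σ, qS g false i σ * pS f false i σ =
     ∑ σ, ∑ i, pS f false i σ * qS g false i σ := by
    rw [Finset.sum_comm]; simp only [mul_comm]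
  have e2 : ∑ i : Fin 5, ∑ σ, pS f false i σ * qS g false i σ =
     ∑ σ, ∑ i, pS f false i σ * qS g false i σ := Finset.sum_comm
  rw [e1] at h7
  rw [e2] at h8
  push_cast at h7 h8
  linarith

end

section
open Finset

/-- twice the number of edges of `M` crossing `U` -/
def ell2 {P : Type*} [Fintype P] (U : P → Bool) (M : P → P) : ℕ :=
  ∑ v, if U v = U (M v) then 0 else 1

def cntT {P : Type*} [Fintype P] (U : P → Bool) : ℕ := ∑ v, if U v = true then 1 else 0

theorem ell2_act {m : ℕ} (σ M : Equiv.Perm (Pos m)) (U : Pos m → Bool) :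
    ell2 (actU σ U) (σ * M * σ⁻¹ : Equiv.Perm (Pos m)) = ell2 U M := by
  unfold ell2
  rw [← Equiv.sum_comp σ]
  simp [actU]

theorem cntT_act {m : ℕ} (σ : Equiv.Perm (Pos m)) (U : Pos m → Bool) :
    cntT (actU σ U) = cntT U := by
  unfold cntT
  rw [← Equiv.sum_comp σ]
  simp [actU]

theorem cntT_cutPos {m : ℕ} (i : Fin 5) (x : Option (Fin m) → Bool) :
    Odd (cntT (cutPos i x)) := by
  unfold cntT
  rw [Fintype.sum_sum_type, Fintype.sum_sum_type]
  have h1 : ∑ z : Fin m × Bool × Bool, (if cutPos i x (.inr (.inr z)) = true then 1 else 0) = 0 := by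
    simp [cutPos]
  have h2 : ∑ z : Fin m × Bool, (if cutPos i x (.inr (.inl z)) = true then 1 else 0) =
      2 * ∑ a : Fin m, (if x (some a) = true then 1 else 0) := by
    rw [Fintype.sum_prod_type, Finset.mul_sum]
    refine Finset.sum_congr rfl fun a _ => ?_
    by_cases hx : x (some a) = true <;> simp [cutPos, hx]
  have h3 : Odd (∑ z : Fin 5 × Bool, (if cutPos i x (.inl z) = true then 1 else 0)) := by
    have : ∀ (c : Bool) (i : Fin 5), Odd (∑ z : Fin 5 × Bool,
        (if (!z.2 && (if z.1 = i ∨ z.1 = i + 1 then c else true)) = true then 1 else 0)) := by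
      decide
    exact this (x none) i
  rw [h1, h2, add_zero]
  exact h3.add_even (even_two_mul _)

/-- local count on the ten special vertices -/
def loc (i j : Fin 5) (c d : Bool) : ℕ :=
  ∑ z : Fin 5 × Bool,
    if (!z.2 && (if z.1 = i ∨ z.1 = i + 1 then c else true)) =
      (fun w : Fin 5 × Bool => !w.2 && (if w.1 = i ∨ w.1 = i + 1 then c else true))
      (if d = true then (z.1, !z.2) else if z.1 = j then (j + 1, z.2)
      else if z.1 = j + 1 then (j, z.2) else (z.1, !z.2)) then 0 else 1

theorem ell2_cut_match {m : ℕ} (i j : Fin 5) (x y : Option (Fin m) → Bool) :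
    ell2 (cutPos i x) (matchPerm j y) = loc i j (x none) (y none) := by
  unfold ell2
  rw [Fintype.sum_sum_type, Fintype.sum_sum_type]
  have h1 : ∑ z : Fin m × Bool × Bool, (if cutPos i x (.inr (.inr z)) =
      cutPos i x (matchPerm j y (.inr (.inr z))) then 0 else 1) = 0 := by
    refine Finset.sum_eq_zero fun z _ => ?_
    obtain ⟨b, s, t⟩ := z
    by_cases h : y (some b) = true <;> simp [matchPerm_apply, matchFun, h, cutPos]
  have h2 : ∑ z : Fin m × Bool, (if cutPos i x (.inr (.inl z)) =
      cutPos i x (matchPerm j y (.inr (.inl z))) then 0 else 1) = 0 := by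
    refine Finset.sum_eq_zero fun z _ => ?_
    simp [matchPerm_apply, matchFun, cutPos]
  rw [h1, h2, add_zero, add_zero]
  unfold loc
  refine Finset.sum_congr rfl fun z _ => ?_
  obtain ⟨a, d⟩ := z
  rw [matchPerm_apply]
  simp only [matchFun]
  have e : ∀ w : Fin 5 × Bool, (cutPos i x (.inl w : Pos m)) =
      (fun w : Fin 5 × Bool => !w.2 && (if w.1 = i ∨ w.1 = i + 1 then x none else true)) w := fun w => rfl
  simp only [← e]
  by_cases h1 : y none = true
  · simp only [h1, if_true]; rfl
  · simp only [h1]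
    by_cases h2 : a = j
    · simp only [h2]; rfl
    · by_cases h3 : a = j + 1
      · simp only [if_neg h2, if_pos h3]; rfl
      · simp only [h2, h3]; rfl

theorem loc_ff (i : Fin 5) : loc i i false false = 6 := by revert i; decide
theorem loc_tt : loc 0 0 true true = 10 := by decide
theorem loc_f2 (i : Fin 5) : loc i (i + 2) false false = 2 := by revert i; decide
theorem loc_2f (i : Fin 5) : loc (i + 2) i false false = 2 := by revert i; decide

def IsPM {P : Type*} (M : Equiv.Perm P) : Prop := M * M = 1 ∧ ∀ v, M v ≠ v

theorem isPM_conj {m : ℕ} (σ : Equiv.Perm (Pos m)) (j : Fin 5) (y : Option (Fin m) → Bool) :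
    IsPM (σ * matchPerm j y * σ⁻¹) := by
  constructor
  · have := matchPerm_sq j y
    calc _ = σ * (matchPerm j y * matchPerm j y) * σ⁻¹ := by group
      _ = 1 := by rw [this]; simp
  · intro v h
    apply matchPerm_ne j y (σ⁻¹ v)
    simp only [Equiv.Perm.mul_apply] at h
    apply σ.injective
    rw [h]; simp

theorem rothvoss {m R : ℕ} (u : Fin R → (Pos m → Bool) → ℝ) (v : Fin R → Equiv.Perm (Pos m) → ℝ)
    (hu : ∀ r U, 0 ≤ u r U) (hv : ∀ r M, 0 ≤ v r M)
    (hu0 : ∀ r U, ¬ Odd (cntT U) → u r U = 0) (hv0 : ∀ r M, ¬ IsPM M → v r M = 0)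
    (h : ∀ U M, Odd (cntT U) → IsPM M →
      |∑ r, u r U * v r M - ((ell2 U M : ℝ) / 2 - 1)| ≤ 1 / 1000) :
    (1 / 4 : ℝ) ≤ 3200 * (1 - 1 / 25600) ^ (m + 1) * (R * (10 + 6 * m)) := by
  classical
  have hα : ∀ r, ∃ U0, ∀ U, u r U ≤ u r U0 := fun r => Finite.exists_max (u r)
  have hβ : ∀ r, ∃ M0, ∀ M, v r M ≤ v r M0 := fun r => Finite.exists_max (v r)
  choose U0 hU0 using hα
  choose M0 hM0 using hβ
  have hprod : ∀ r, u r (U0 r) * v r (M0 r) ≤ 10 + 6 * m := by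
    intro r
    by_cases h1 : Odd (cntT (U0 r))
    · by_cases h2 : IsPM (M0 r)
      · have h3 := (abs_le.1 (h _ _ h1 h2)).2
        have h4 : u r (U0 r) * v r (M0 r) ≤ ∑ r', u r' (U0 r) * v r' (M0 r) :=
          Finset.single_le_sum (f := fun r' => u r' (U0 r) * v r' (M0 r))
            (fun r' _ => mul_nonneg (hu _ _) (hv _ _)) (Finset.mem_univ r)
        have h5 : (ell2 (U0 r) (M0 r) : ℝ) ≤ 10 + 6 * m := by
          have : ell2 (U0 r) (M0 r) ≤ ∑ v : Pos m, 1 := by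
            refine Finset.sum_le_sum fun _ _ => ?_
            split_ifs <;> simp
          have h6 : ∑ v : Pos m, 1 = 10 + 6 * m := by
            simp; ring
          rw [h6] at this
          exact_mod_cast this
        have h7 : (0:ℝ) ≤ ell2 (U0 r) (M0 r) := by positivity
        linarith
      · rw [hv0 _ _ h2]; simp; positivity
    · rw [hu0 _ _ h1]; simp; positivity
  have core := fun r => core_ineq (u r) (v r) (u r (U0 r)) (v r (M0 r)) (hu r) (hU0 r) (hv r) (hM0 r)
  have key : ∀ (i j : Fin 5) (b c : Bool) (σ : Equiv.Perm (Pos m)),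
      |∑ r, pS (u r) b i σ * qS (v r) c j σ - (2 ^ (m + 1) * 2 ^ (m + 1)) * ((loc i j b c : ℝ) / 2 - 1)|
        ≤ (2 ^ (m + 1) * 2 ^ (m + 1)) * (1 / 1000) := by
    intro i j b c σ
    have e : ∑ r, pS (u r) b i σ * qS (v r) c j σ =
        ∑ x : Option (Fin m) → Bool, ∑ y : Option (Fin m) → Bool,
          ∑ r, u r (actU σ (cutPos i (Function.update x none b))) *
            v r (σ * matchPerm j (Function.update y none c) * σ⁻¹) := by
      simp only [pS, qS, Finset.sum_mul_sum]
      rw [Finset.sum_comm]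
      refine Finset.sum_congr rfl fun x _ => ?_
      rw [Finset.sum_comm]
    have e2 : (2 ^ (m + 1) * 2 ^ (m + 1)) * ((loc i j b c : ℝ) / 2 - 1) =
        ∑ x : Option (Fin m) → Bool, ∑ y : Option (Fin m) → Bool, ((loc i j b c : ℝ) / 2 - 1) := by
      simp; ring
    have e3 : (2 ^ (m + 1) * 2 ^ (m + 1)) * (1 / 1000 : ℝ) =
        ∑ x : Option (Fin m) → Bool, ∑ y : Option (Fin m) → Bool, (1 / 1000 : ℝ) := by
      simp; ring
    rw [e, e2, e3, ← Finset.sum_sub_distrib]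
    refine (Finset.abs_sum_le_sum_abs _ _).trans (Finset.sum_le_sum fun x _ => ?_)
    rw [← Finset.sum_sub_distrib]
    refine (Finset.abs_sum_le_sum_abs _ _).trans (Finset.sum_le_sum fun y _ => ?_)
    have := h (actU σ (cutPos i (Function.update x none b)))
      (σ * matchPerm j (Function.update y none c) * σ⁻¹)
      (by rw [cntT_act]; exact cntT_cutPos _ _) (isPM_conj _ _ _)
    rw [ell2_act, ell2_cut_match] at this
    simpa using this
  set K : ℝ := 2 ^ (m + 1) * 2 ^ (m + 1) with hK
  have hKpos : 0 < K := by positivity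
  set G : ℝ := (Fintype.card (Equiv.Perm (Pos m)) : ℝ) with hG
  have hGpos : 0 < G := by rw [hG]; exact_mod_cast Fintype.card_pos
  have hcore := Finset.sum_le_sum fun (r : Fin R) (_ : r ∈ Finset.univ) => core r
  simp only [Finset.sum_add_distrib, ← Finset.mul_sum] at hcore
  have A1 : G * (5 * (K * (2 - 1 / 1000))) ≤
      ∑ r, ∑ σ, ∑ i, pS (u r) false i σ * qS (v r) false i σ := by
    have : ∑ σ : Equiv.Perm (Pos m), ∑ i : Fin 5, K * (2 - 1 / 1000) = G * (5 * (K * (2 - 1 / 1000))) := by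
      simp [hG]
    rw [← this, Finset.sum_comm (s := (univ : Finset (Fin R)))]
    refine Finset.sum_le_sum fun σ _ => ?_
    rw [Finset.sum_comm (s := (univ : Finset (Fin R)))]
    refine Finset.sum_le_sum fun i _ => ?_
    have := (abs_le.1 (key i i false false σ)).1
    rw [loc_ff] at this
    push_cast at this
    linarith
  have A2 : ∑ r, ∑ σ, pS (u r) true 0 σ * qS (v r) true 0 σ ≤ G * (K * (4 + 1 / 1000)) := by
    have : ∑ σ : Equiv.Perm (Pos m), K * (4 + 1 / 1000) = G * (K * (4 + 1 / 1000)) := by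
      simp [hG]
    rw [← this, Finset.sum_comm (s := (univ : Finset (Fin R)))]
    refine Finset.sum_le_sum fun σ _ => ?_
    have := (abs_le.1 (key 0 0 true true σ)).2
    rw [loc_tt] at this
    push_cast at this
    linarith
  have A3 : ∑ r, ∑ σ, ∑ i, pS (u r) false i σ * qS (v r) false (i + 2) σ ≤
      G * (5 * (K * (1 / 1000))) := by
    have : ∑ σ : Equiv.Perm (Pos m), ∑ i : Fin 5, K * (1 / 1000) = G * (5 * (K * (1 / 1000))) := by
      simp [hG]
    rw [← this, Finset.sum_comm (s := (univ : Finset (Fin R)))]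
    refine Finset.sum_le_sum fun σ _ => ?_
    rw [Finset.sum_comm (s := (univ : Finset (Fin R)))]
    refine Finset.sum_le_sum fun i _ => ?_
    have := (abs_le.1 (key i (i + 2) false false σ)).2
    rw [loc_f2] at this
    push_cast at this
    linarith
  have A4 : ∑ r, ∑ σ, ∑ i, pS (u r) false (i + 2) σ * qS (v r) false i σ ≤
      G * (5 * (K * (1 / 1000))) := by
    have : ∑ σ : Equiv.Perm (Pos m), ∑ i : Fin 5, K * (1 / 1000) = G * (5 * (K * (1 / 1000))) := by
      simp [hG]
    rw [← this, Finset.sum_comm (s := (univ : Finset (Fin R)))]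
    refine Finset.sum_le_sum fun σ _ => ?_
    rw [Finset.sum_comm (s := (univ : Finset (Fin R)))]
    refine Finset.sum_le_sum fun i _ => ?_
    have := (abs_le.1 (key (i + 2) i false false σ)).2
    rw [loc_2f] at this
    push_cast at this
    linarith
  have A5 : ∑ r, (2 ^ (m + 1) * v r (M0 r)) * (u r (U0 r) * 320 * (2 * (1 - 1 / 25600)) ^ (m + 1)) ≤
      K * (320 * (1 - 1 / 25600) ^ (m + 1) * (R * (10 + 6 * m))) := by
    have : ∑ r : Fin R, K * (320 * (1 - 1 / 25600) ^ (m + 1) * (10 + 6 * m)) =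
        K * (320 * (1 - 1 / 25600) ^ (m + 1) * (R * (10 + 6 * m))) := by
      simp; ring
    rw [← this]
    refine Finset.sum_le_sum fun r _ => ?_
    have e : (2 ^ (m + 1) * v r (M0 r)) * (u r (U0 r) * 320 * (2 * (1 - 1 / 25600)) ^ (m + 1)) =
        K * (320 * (1 - 1 / 25600) ^ (m + 1) * (u r (U0 r) * v r (M0 r))) := by
      rw [mul_pow, hK]; ring
    rw [e]
    have := hprod r
    have hp : (0:ℝ) ≤ 320 * (1 - 1 / 25600) ^ (m + 1) := by
      have : (0:ℝ) ≤ 1 - 1 / 25600 := by norm_num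
      positivity
    gcongr
  have hfin : G * K * (1 / 4) ≤ G * K * (3200 * (1 - 1 / 25600) ^ (m + 1) * (R * (10 + 6 * m))) := by
    have A5' := mul_le_mul_of_nonneg_left A5 hGpos.le
    have hGK := mul_pos hGpos hKpos
    nlinarith [hcore, A1, A2, A3, A4, A5', hGK]
  exact le_of_mul_le_mul_left hfin (mul_pos hGpos hKpos)

end

section
open Finset

/-- an approximate conic separation statement -/
theorem approx_cone {C I : Type*} [Fintype C] [Fintype I] (t : I → C → ℝ) (s : C → ℝ)
    (h : ∀ w : C → ℝ, (∀ i, 0 ≤ ∑ c, w c * t i c) → 0 ≤ ∑ c, w c * s c) (ε : ℝ) (hε : 0 < ε) :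
    ∃ l : I → ℝ, (∀ i, 0 ≤ l i) ∧ ∀ c, |s c - ∑ i, l i * t i c| ≤ ε := by
  classical
  set K : Set (C → ℝ) := {z | ∃ l : I → ℝ, (∀ i, 0 ≤ l i) ∧ z = fun c => ∑ i, l i * t i c} with hK
  have hconv : Convex ℝ K := by
    rintro x ⟨l, hl, rfl⟩ y ⟨l', hl', rfl⟩ a b ha hb -
    refine ⟨fun i => a * l i + b * l' i, fun i => add_nonneg (mul_nonneg ha (hl i))
      (mul_nonneg hb (hl' i)), ?_⟩
    funext c
    simp only [Pi.add_apply, Pi.smul_apply, smul_eq_mul, Finset.mul_sum, ← Finset.sum_add_distrib]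
    exact Finset.sum_congr rfl fun i _ => by ring
  by_cases hs : s ∈ closure K
  · obtain ⟨z, ⟨l, hl, rfl⟩, hz⟩ := Metric.mem_closure_iff.1 hs ε hε
    refine ⟨l, hl, fun c => ?_⟩
    have := dist_le_pi_dist s (fun c => ∑ i, l i * t i c) c
    rw [Real.dist_eq] at this
    exact this.trans hz.le
  · exfalso
    obtain ⟨f, u, hfu, hf⟩ := geometric_hahn_banach_point_closed hconv.closure isClosed_closure hs
    have hf0 : ∀ z ∈ K, 0 ≤ f z := by
      rintro z ⟨l, hl, rfl⟩
      by_contra hneg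
      push Not at hneg
      have hu : u < 0 := by
        have h0 : (0 : C → ℝ) ∈ K := ⟨0, fun _ => le_rfl, by funext c; simp⟩
        simpa using hf 0 (subset_closure h0)
      set z : C → ℝ := fun c => ∑ i, l i * t i c
      have hT : (0:ℝ) ≤ u / f z := div_nonneg_of_nonpos hu.le hneg.le
      have hz : (u / f z) • z ∈ K := by
        refine ⟨fun i => (u / f z) * l i, fun i => mul_nonneg hT (hl i), ?_⟩
        funext c
        simp only [z, Pi.smul_apply, smul_eq_mul, Finset.mul_sum]
        exact Finset.sum_congr rfl fun i _ => by ring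
      have h2 := hf _ (subset_closure hz)
      rw [map_smul, smul_eq_mul, div_mul_cancel₀ _ hneg.ne] at h2
      exact lt_irrefl _ h2
    have hrep : ∀ z : C → ℝ, f z = ∑ c, f (Pi.single c 1) * z c := by
      intro z
      conv_lhs => rw [← Finset.univ_sum_single z]
      rw [map_sum]
      refine Finset.sum_congr rfl fun c _ => ?_
      have : (Pi.single c (z c) : C → ℝ) = z c • Pi.single c 1 := by
        rw [← Pi.single_smul]; simp
      rw [this, map_smul, smul_eq_mul, mul_comm]
    have h3 := h (fun c => f (Pi.single c 1)) ?_
    · rw [← hrep] at h3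
      have h0 : (0 : C → ℝ) ∈ K := ⟨0, fun _ => le_rfl, by funext c; simp⟩
      have : u < 0 := by simpa using hf 0 (subset_closure h0)
      linarith
    · intro i
      rw [← hrep]
      refine hf0 _ ⟨Pi.single i 1, fun j => ?_, ?_⟩
      · by_cases hj : j = i
        · subst hj; simp
        · simp [hj]
      · funext c
        simp [Pi.single_apply]

theorem approx_farkas {k d : ℕ} {C : Type*} [Fintype C] (A : Matrix (Fin k) (Fin d) ℝ)
    (b : Fin k → ℝ) (s : (Fin d → ℝ) →ₗ[ℝ] ℝ) (s0 : ℝ)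
    (hvalid : ∀ y, A.mulVec y ≤ b → s0 ≤ s y) (Y : C → Fin d → ℝ)
    (hY : ∀ c, A.mulVec (Y c) ≤ b) (ε : ℝ) (hε : 0 < ε) :
    ∃ l : Option (Fin k) → ℝ, (∀ i, 0 ≤ l i) ∧
      ∀ c, |(s (Y c) - s0) - (l none + ∑ i, l (some i) * (b i - A.mulVec (Y c) i))| ≤ ε := by
  have := approx_cone (I := Option (Fin k))
    (fun i c => match i with
      | none => 1
      | some i => b i - A.mulVec (Y c) i) (fun c => s (Y c) - s0) ?_ ε hε
  · obtain ⟨l, hl, h⟩ := this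
    refine ⟨l, hl, fun c => ?_⟩
    have := h c
    rw [Fintype.sum_option, mul_one] at this
    exact this
  · intro w hw
    by_contra hneg
    push Not at hneg
    have hW : 0 ≤ ∑ c, w c := by simpa using hw none
    have ht : ∀ i, 0 ≤ ∑ c, w c * (b i - A.mulVec (Y c) i) := fun i => hw (some i)
    rcases isEmpty_or_nonempty C with hC | ⟨⟨c0⟩⟩
    · simp at hneg
    · set D := ∑ c, w c * (s (Y c) - s0) with hD
      set W := ∑ c, w c with hWdef
      have hs0 : 0 ≤ s (Y c0) - s0 := sub_nonneg.2 (hvalid _ (hY c0))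
      set T : ℝ := (s (Y c0) - s0 + 1) / (-D) with hTdef
      have hT : 0 ≤ T := by
        apply div_nonneg <;> linarith
      have hTD : T * D = -(s (Y c0) - s0 + 1) := by
        rw [hTdef]; field_simp [hneg.ne]
      have hpos : 0 < 1 + T * W := by positivity
      have hv := hvalid ((1 + T * W)⁻¹ • (Y c0 + T • ∑ c, w c • Y c)) ?_
      · rw [map_smul, map_add, map_smul, map_sum, smul_eq_mul, inv_mul_eq_div, le_div_iff₀ hpos] at hv
        simp only [map_smul, smul_eq_mul] at hv
        have hD2 : D = ∑ c, w c * s (Y c) - W * s0 := by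
          rw [hD, hWdef, Finset.sum_mul, ← Finset.sum_sub_distrib]
          exact Finset.sum_congr rfl fun c _ => by ring
        rw [hD2] at hTD
        nlinarith
      · intro i
        rw [Matrix.mulVec_smul, Matrix.mulVec_add, Matrix.mulVec_smul, Matrix.mulVec_sum]
        simp only [Matrix.mulVec_smul, Pi.smul_apply, Pi.add_apply, Finset.sum_apply, smul_eq_mul]
        rw [inv_mul_eq_div, div_le_iff₀ hpos]
        have h1 := hY c0 i
        have h2 := ht i
        have h3 : ∑ c, w c * (b i - A.mulVec (Y c) i) = W * b i - ∑ c, w c * A.mulVec (Y c) i := by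
          rw [hWdef, Finset.sum_mul, ← Finset.sum_sub_distrib]
          exact Finset.sum_congr rfl fun c _ => by ring
        rw [h3] at h2
        have h4 := mul_nonneg hT h2
        nlinarith

end

section
def pathW {V : Type*} (ω : V → V → ℝ) : List V → ℝ
  | [] => 0
  | [_] => 0
  | a :: b :: l => ω a b + pathW ω (b :: l)

section
open Classical
open scoped Classical

noncomputable def iv (p : Prop) : ℝ := if p then 1 else 0
noncomputable def xi (p q : Prop) : ℝ := if (p ↔ q) then 0 else 1

theorem tsp_point {n : ℕ} (a : Fin n) (l : List (Fin n)) (hnd : (a :: l).Nodup)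
    (hall : ∀ v, v ∈ a :: l) (hn : 3 ≤ n) :
    ∃ x ∈ tspPolytope n, ∀ S : Finset (Fin n),
      cutSum S x = pathW (fun u v => xi (u ∈ S) (v ∈ S)) (a :: l ++ [a]) := by
  have hlen : (a :: l).length = n := by
    have h1 : (a :: l).toFinset = Finset.univ := by
      ext v; simpa using hall v
    have := List.toFinset_card_of_nodup hnd
    rw [h1] at this
    simpa using this.symm
  have hchain : (a :: l ++ [a]).IsChain (⊤ : SimpleGraph (Fin n)).Adj := by
    have h1 : (a :: l).IsChain (· ≠ ·) := List.Pairwise.isChain hnd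
    rw [List.isChain_append]
    refine ⟨h1, by simp, ?_⟩
    intro x hx y hy
    simp only [List.head?_cons, Option.mem_def, Option.some.injEq] at hy
    subst hy
    intro hxa
    subst hxa
    rw [List.nodup_cons] at hnd
    rcases List.eq_nil_or_concat l with h | ⟨l', z, h⟩
    · subst h; simp at hlen; omega
    · subst h
      rw [List.concat_eq_append, ← List.cons_append, List.getLast?_append] at hx
      simp at hx
      apply hnd.1
      simp [hx]
  set C0 := SimpleGraph.Walk.ofSupport (G := (⊤ : SimpleGraph (Fin n))) (a :: l ++ [a]) (by simp) hchain with hC0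
  have hsupp0 : C0.support = a :: l ++ [a] := SimpleGraph.Walk.support_ofSupport _ _
  have hlen0 : C0.length = n := by
    rw [hC0, SimpleGraph.Walk.length_ofSupport]
    simp only [List.length_append, List.length_cons, List.length_nil] at hlen ⊢
    omega
  obtain ⟨C, hsupp, hlenC⟩ : ∃ C : (⊤ : SimpleGraph (Fin n)).Walk a a, C.support = a :: l ++ [a] ∧ C.length = n := by
    have gen : ∀ {u v : Fin n} (D : (⊤ : SimpleGraph (Fin n)).Walk u v), u = a → v = a →
        ∃ C : (⊤ : SimpleGraph (Fin n)).Walk a a, C.support = D.support ∧ C.length = D.length := by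
      rintro u v D rfl rfl
      exact ⟨D, rfl, rfl⟩
    obtain ⟨C, h1, h2⟩ := gen C0 (by simp) (by simp)
    exact ⟨C, h1.trans hsupp0, h2.trans hlen0⟩
  have hcyc : C.IsCycle := by
    rw [SimpleGraph.Walk.isCycle_iff_isPath_tail_and_le_length]
    refine ⟨?_, by omega⟩
    rw [SimpleGraph.Walk.isPath_def, SimpleGraph.Walk.support_tail_of_not_nil, hsupp]
    · simp only [List.cons_append, List.tail_cons]
      exact (List.perm_append_singleton a l).nodup_iff.2 hnd
    · intro h
      rw [← SimpleGraph.Walk.length_eq_zero_iff] at h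
      omega
  have hham : C.IsHamiltonianCycle := by
    rw [SimpleGraph.Walk.isHamiltonianCycle_iff_isCycle_and_length_eq]
    exact ⟨hcyc, by simpa using hlenC⟩
  refine ⟨fun e => if e.1 ∈ C.edges then (1 : ℝ) else 0, subset_convexHull ℝ _ ⟨a, C, ?_, ?_⟩, ?_⟩
  · convert hham
  · funext e; congr
  · intro S
    have key : ∀ {u v : Fin n} (w : (⊤ : SimpleGraph (Fin n)).Walk u v),
        (w.edges.map fun e => if crossing S e then (1:ℝ) else 0).sum =
          pathW (fun u v => xi (u ∈ S) (v ∈ S)) w.support := by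
      intro u v w
      induction w with
      | nil => simp [pathW]
      | @cons u' v' w' h p ih =>
        rw [SimpleGraph.Walk.edges_cons, List.map_cons, List.sum_cons, ih, SimpleGraph.Walk.support_cons]
        have e1 : p.support = v' :: p.support.tail := by
          cases p <;> simp
        rw [e1, pathW]
        congr 1
        by_cases h1 : u' ∈ S <;> by_cases h2 : v' ∈ S <;> simp [crossing, xi, h1, h2]
    rw [← hsupp, ← key]
    unfold cutSum
    have hnd2 : C.edges.Nodup := hcyc.isCircuit.isTrail.edges_nodup
    rw [← List.sum_toFinset _ hnd2, Finset.sum_ite, Finset.sum_ite]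
    simp only [Finset.sum_const_zero, add_zero, Finset.sum_const, nsmul_eq_mul, mul_one]
    norm_cast
    refine Finset.card_bij (fun e _ => e.1) ?_ ?_ ?_
    · intro e he
      simp only [Finset.mem_filter, Finset.mem_univ, true_and, List.mem_toFinset] at he ⊢
      exact ⟨he.2, he.1⟩
    · intro e _ e' _ h
      exact Subtype.ext h
    · intro e he
      simp only [Finset.mem_filter, Finset.mem_univ, true_and, List.mem_toFinset] at he ⊢
      refine ⟨⟨e, ?_⟩, ⟨he.2, he.1⟩, rfl⟩
      exact SimpleGraph.not_isDiag_of_mem_edgeSet _ (C.edges_subset_edgeSet he.1)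
end

end

section
theorem pathW_add_sum {V I : Type*} [Fintype I] (f : V → V → ℝ) (g : I → V → V → ℝ) (l : List V) :
    pathW f l + ∑ i, pathW (g i) l = pathW (fun u v => f u v + ∑ i, g i u v) l := by
  induction l with
  | nil => simp [pathW]
  | cons a l ih =>
    cases l with
    | nil => simp [pathW]
    | cons b l =>
      simp only [pathW, Finset.sum_add_distrib]
      rw [← ih]; ring

theorem pathW_map {V W : Type*} (e : V → W) (f : W → W → ℝ) (l : List V) :
    pathW f (l.map e) = pathW (fun u v => f (e u) (e v)) l := by
  induction l with
  | nil => simp [pathW]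
  | cons a l ih =>
    cases l with
    | nil => simp [pathW]
    | cons b l =>
      simp only [List.map_cons, pathW] at ih ⊢
      rw [ih]

abbrev Vtx (B : Type*) (L : ℕ) := Fin L ⊕ (B × Fin 4)

def blk8 {B : Type*} {L : ℕ} (p : B × B) : List (Vtx B L) :=
  [.inr (p.1, 3), .inr (p.1, 2), .inr (p.1, 1), .inr (p.1, 0),
   .inr (p.2, 0), .inr (p.2, 1), .inr (p.2, 2), .inr (p.2, 3)]

/-- real indicator of a Boolean -/
def tb (c : Bool) : ℝ := if c = true then 1 else 0
def neb (c d : Bool) : ℝ := if c = d then 0 else 1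

structure GoodW {B : Type*} {L : ℕ} (t : B → Bool) (ω : Vtx B L → Vtx B L → ℝ) : Prop where
  zz : ∀ z z', ω (.inl z) (.inl z') = 0
  zw : ∀ z w, t w = true → ω (.inl z) (.inr (w, 0)) = 1
  wz : ∀ z w, t w = true → ω (.inr (w, 0)) (.inl z) = 1
  i01 : ∀ u, ω (.inr (u, 0)) (.inr (u, 1)) = 0
  i10 : ∀ u, ω (.inr (u, 1)) (.inr (u, 0)) = 0
  i12 : ∀ u, ω (.inr (u, 1)) (.inr (u, 2)) = tb (t u)
  i21 : ∀ u, ω (.inr (u, 2)) (.inr (u, 1)) = tb (t u)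
  i23 : ∀ u, ω (.inr (u, 2)) (.inr (u, 3)) = 0
  i32 : ∀ u, ω (.inr (u, 3)) (.inr (u, 2)) = 0
  top : ∀ a b, a ≠ b → ω (.inr (a, 0)) (.inr (b, 0)) = tb (t a) + tb (t b) + neb (t a) (t b)
  bot : ∀ a b, a ≠ b → ω (.inr (a, 3)) (.inr (b, 3)) = tb (t a) + tb (t b)

theorem pathW_pairs {B : Type*} {L : ℕ} {t : B → Bool} {ω : Vtx B L → Vtx B L → ℝ}
    (h : GoodW t ω) (w : B) (hw : t w = true) (z : Fin L) (pr : List (B × B)) :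
    ∀ c, (c :: (pr.flatMap (fun p => [p.1, p.2]) ++ [w])).Nodup →
    pathW ω (.inr (c, 3) :: (pr.flatMap blk8 ++ [.inr (w, 3), .inr (w, 2), .inr (w, 1),
      .inr (w, 0), .inl z])) =
      tb (t c) + (pr.map fun p => 3 * (tb (t p.1) + tb (t p.2)) + neb (t p.1) (t p.2)).sum + 3 := by
  induction pr with
  | nil =>
    intro c hc
    have hcw : c ≠ w := by
      intro h; subst h; simp at hc
    simp only [List.flatMap_nil, List.nil_append, pathW, h.bot c w hcw, h.i32, h.i21, h.i10,
      h.wz z w hw, hw, List.map_nil, List.sum_nil]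
    simp [tb]; ring
  | cons p pr ih =>
    intro c hc
    obtain ⟨a, b⟩ := p
    simp only [List.flatMap_cons, List.cons_append, List.nil_append] at hc
    have hc2 := (List.nodup_cons.1 hc).2
    have hc3 := (List.nodup_cons.1 hc2).2
    have hca : c ≠ a := by
      intro h; subst h; simp at hc
    have hab : a ≠ b := by
      intro h; subst h; simp at hc2
    have := ih b hc3
    simp only [List.flatMap_cons, blk8, List.cons_append, List.nil_append, pathW, h.bot c a hca,
      h.i32, h.i21, h.i10, h.i01, h.i12, h.i23, h.top a b hab, List.map_cons, List.sum_cons]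
    rw [this]
    ring

theorem pathW_z {B : Type*} {L : ℕ} {t : B → Bool} {ω : Vtx B L → Vtx B L → ℝ}
    (h : GoodW t ω) (w : B) (hw : t w = true) (rest : List (Vtx B L)) (zs : List (Fin L)) :
    ∀ z, pathW ω (.inl z :: (zs.map .inl ++ .inr (w, 0) :: rest)) =
      1 + pathW ω (.inr (w, 0) :: rest) := by
  induction zs with
  | nil => intro z; simp [pathW, h.zw z w hw]
  | cons z' zs ih =>
    intro z
    simp only [List.map_cons, List.cons_append, pathW, h.zz, ih z']
    ring

/-- the closed tour, minus its first vertex `inl z` -/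
def tourTail {B : Type*} {L : ℕ} (zs : List (Fin L)) (w' w : B) (pr : List (B × B)) :
    List (Vtx B L) :=
  zs.map .inl ++ .inr (w', 0) :: .inr (w', 1) :: .inr (w', 2) :: .inr (w', 3) ::
    (pr.flatMap blk8 ++ [.inr (w, 3), .inr (w, 2), .inr (w, 1), .inr (w, 0)])

theorem pathW_tour {B : Type*} {L : ℕ} {t : B → Bool} {ω : Vtx B L → Vtx B L → ℝ}
    (h : GoodW t ω) (w' w : B) (hw' : t w' = true) (hw : t w = true) (z : Fin L) (zs : List (Fin L))
    (pr : List (B × B)) (hnd : (w' :: (pr.flatMap (fun p => [p.1, p.2]) ++ [w])).Nodup) :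
    pathW ω (.inl z :: tourTail zs w' w pr ++ [.inl z]) =
      6 + (pr.map fun p => 3 * (tb (t p.1) + tb (t p.2)) + neb (t p.1) (t p.2)).sum := by
  have h1 := pathW_pairs h w hw z pr w' hnd
  unfold tourTail
  simp only [List.cons_append, List.append_assoc, List.nil_append]
  rw [pathW_z h w' hw']
  simp only [pathW, h.i01, h.i12, h.i23]
  rw [h1, hw']
  simp [tb]; ring

theorem tour_nodup {B : Type*} {L : ℕ} (w' w : B) (z : Fin L) (zs : List (Fin L))
    (hz : (z :: zs).Nodup)
    (pr : List (B × B)) (hnd : (w' :: (pr.flatMap (fun p => [p.1, p.2]) ++ [w])).Nodup) :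
    (Sum.inl z :: tourTail zs w' w pr : List (Vtx B L)).Nodup := by
  -- permute into `flatMap` normal form
  have hperm : List.Perm (Sum.inl z :: tourTail zs w' w pr : List (Vtx B L))
      ((z :: zs).map .inl ++ ((w' :: (pr.flatMap (fun p => [p.1, p.2]) ++ [w])).flatMap
        (fun b => [(b, (0 : Fin 4)), (b, 1), (b, 2), (b, 3)])).map .inr) := by
    unfold tourTail
    simp only [List.map_cons, List.cons_append, List.flatMap_cons, List.nil_append]
    refine List.Perm.cons _ (List.Perm.append_left _ ?_)
    refine List.Perm.cons _ (List.Perm.cons _ (List.Perm.cons _ (List.Perm.cons _ ?_)))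
    rw [List.flatMap_append, List.map_append]
    refine List.Perm.append ?_ ?_
    · clear hnd
      induction pr with
      | nil => simp
      | cons p pr ih =>
        simp only [List.flatMap_cons, List.flatMap_append, List.map_append, blk8]
        refine List.Perm.append ?_ ih
        simp only [List.flatMap_cons, List.flatMap_nil, List.map_cons, List.map_nil, List.cons_append,
          List.nil_append]
        exact List.Perm.append_right [Sum.inr (p.2, (0 : Fin 4)), Sum.inr (p.2, 1), Sum.inr (p.2, 2), Sum.inr (p.2, 3)]
          (List.reverse_perm [Sum.inr (p.1, (0 : Fin 4)), Sum.inr (p.1, 1), Sum.inr (p.1, 2), Sum.inr (p.1, 3)])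
    · exact (List.reverse_perm [Sum.inr (w, (0 : Fin 4)), Sum.inr (w, 1), Sum.inr (w, 2), Sum.inr (w, 3)])
  rw [hperm.nodup_iff, List.nodup_append]
  refine ⟨hz.map Sum.inl_injective, List.Nodup.map Sum.inr_injective ?_, ?_⟩
  · rw [List.nodup_flatMap]
    refine ⟨fun b _ => by simp, ?_⟩
    refine List.Pairwise.imp ?_ hnd
    intro a b hab
    simp only [Function.onFun]
    intro x hx hy
    simp at hx hy
    apply hab
    rcases hx with rfl | rfl | rfl | rfl <;> simp at hy <;> exact hy
  · intro a ha b hb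
    simp only [List.mem_map] at ha hb
    obtain ⟨_, _, rfl⟩ := ha
    obtain ⟨_, _, rfl⟩ := hb
    simp

theorem tour_mem {B : Type*} {L : ℕ} (w' w : B) (z : Fin L) (zs : List (Fin L))
    (hz : ∀ y, y ∈ z :: zs) (pr : List (B × B))
    (hall : ∀ b, b ∈ w' :: (pr.flatMap (fun p => [p.1, p.2]) ++ [w])) (v : Vtx B L) :
    v ∈ (Sum.inl z :: tourTail zs w' w pr : List (Vtx B L)) := by
  rcases v with y | ⟨b, j⟩
  · have := hz y
    simp only [List.mem_cons] at this
    rcases this with rfl | h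
    · simp
    · simp [tourTail, h]
  · have hj : j = 0 ∨ j = 1 ∨ j = 2 ∨ j = 3 := by omega
    have := hall b
    simp only [List.mem_cons, List.mem_append, List.mem_flatMap, List.not_mem_nil, or_false] at this
    rcases this with rfl | ⟨p, hp, rfl | rfl⟩ | rfl
    · rcases hj with rfl | rfl | rfl | rfl <;> simp [tourTail]
    · have : (Sum.inr (p.1, j) : Vtx B L) ∈ pr.flatMap blk8 := by
        refine List.mem_flatMap.2 ⟨p, hp, ?_⟩
        rcases hj with rfl | rfl | rfl | rfl <;> simp [blk8]
      simp only [tourTail, List.mem_cons, List.mem_append, this]; tauto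
    · have : (Sum.inr (p.2, j) : Vtx B L) ∈ pr.flatMap blk8 := by
        refine List.mem_flatMap.2 ⟨p, hp, ?_⟩
        rcases hj with rfl | rfl | rfl | rfl <;> simp [blk8]
      simp only [tourTail, List.mem_cons, List.mem_append, this]; tauto
    · rcases hj with rfl | rfl | rfl | rfl <;> simp [tourTail]

end

section
theorem pm_pairs {P : Type*} [Fintype P] [DecidableEq P] (M : Equiv.Perm P) (hM : IsPM M) :
    ∃ pr : List P, (pr.flatMap fun a => [a, M a]).Nodup ∧ (∀ v, v ∈ pr.flatMap fun a => [a, M a]) := by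
  classical
  have hinv : ∀ v, M (M v) = v := fun v => by
    have := congrArg (fun f : Equiv.Perm P => f v) hM.1
    simpa using this
  let e := Fintype.equivFin P
  refine ⟨(Finset.univ.filter fun v => e v < e (M v)).toList, ?_, ?_⟩
  · rw [List.nodup_flatMap]
    refine ⟨fun a _ => by simpa using (hM.2 a).symm, ?_⟩
    refine List.Pairwise.imp_of_mem ?_ (Finset.nodup_toList _)
    intro a b ha hb hab
    simp only [Finset.mem_toList, Finset.mem_filter, Finset.mem_univ, true_and] at ha hb
    intro x hx hy
    simp only [List.mem_cons, List.not_mem_nil, or_false] at hx hy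
    rcases hx with rfl | rfl <;> rcases hy with hy | hy
    · exact hab hy
    · subst hy
      rw [hinv] at ha
      exact absurd ha (not_lt.2 hb.le)
    · subst hy
      rw [hinv] at hb
      exact absurd hb (not_lt.2 ha.le)
    · exact hab (M.injective hy)
  · intro v
    simp only [List.mem_flatMap, Finset.mem_toList, Finset.mem_filter, Finset.mem_univ, true_and,
      List.mem_cons, List.not_mem_nil, or_false]
    rcases lt_trichotomy (e v) (e (M v)) with h | h | h
    · exact ⟨v, h, Or.inl rfl⟩
    · exact absurd (e.injective h).symm (hM.2 v)
    · exact ⟨M v, by rw [hinv]; exact h, Or.inr (hinv v).symm⟩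

theorem pm_sum {P : Type*} [Fintype P] [DecidableEq P] (M : P → P) (pr : List P)
    (hnd : (pr.flatMap fun a => [a, M a]).Nodup) (hall : ∀ v, v ∈ pr.flatMap fun a => [a, M a])
    (f : P → ℝ) : (pr.map fun a => f a + f (M a)).sum = ∑ v, f v := by
  have h1 : (pr.flatMap fun a => [a, M a]).toFinset = Finset.univ := by
    ext v; simpa using hall v
  rw [← h1, List.sum_toFinset _ hnd, List.map_flatMap]
  clear hnd hall h1
  induction pr with
  | nil => simp
  | cons a pr ih => simp [ih, add_assoc]

/-- extension of a cut by the two special blocks -/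
def extT {P : Type*} (U : P → Bool) : P ⊕ Bool → Bool
  | .inl v => U v
  | .inr _ => true

def blkOf {B : Type*} {L : ℕ} : Vtx B L → Option B
  | .inl _ => none
  | .inr (b, _) => some b

def hdl {B : Type*} {L : ℕ} (t : B → Bool) : Vtx B L → Prop
  | .inl _ => True
  | .inr (b, j) => t b = true ∧ j.val < 2

section
open scoped Classical

noncomputable def combW {B : Type*} [Fintype B] {L k : ℕ} (t : B → Bool)
    (en : Fin k ≃ {b : B // t b = true}) (x y : Vtx B L) : ℝ :=
  xi (hdl t x) (hdl t y) +
    ∑ i, xi (blkOf x = some (en i).1) (blkOf y = some (en i).1)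

theorem tooth_eq {B : Type*} [Fintype B] {k : ℕ} (t : B → Bool)
    (en : Fin k ≃ {b : B // t b = true}) (x : Option B) :
    ∑ i, xi (x = some (en i).1) (x = some (en i).1) = 0 := by simp [xi]

theorem tooth_one {B : Type*} [Fintype B] {k : ℕ} (t : B → Bool)
    (en : Fin k ≃ {b : B // t b = true}) (a : B) :
    ∑ i, iv (some a = some (en i).1) = tb (t a) := by
  by_cases h : t a = true
  · rw [Finset.sum_eq_single (en.symm ⟨a, h⟩)]
    · simp [tb, h, iv]
    · intro i _ hi
      rw [iv, if_neg]
      intro h'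
      apply hi
      rw [Equiv.eq_symm_apply]
      exact Subtype.ext (by simpa using h'.symm)
    · simp
  · rw [Finset.sum_eq_zero]
    · simp [tb, h]
    · intro i _
      rw [iv, if_neg]
      intro h'
      apply h
      have := (en i).2
      rw [← (Option.some.inj h')] at this
      exact this

theorem tooth_none {B : Type*} [Fintype B] {k : ℕ} (t : B → Bool)
    (en : Fin k ≃ {b : B // t b = true}) (a : B) :
    ∑ i, xi ((none : Option B) = some (en i).1) (some a = some (en i).1) =
      tb (t a) := by
  rw [← tooth_one t en a]
  refine Finset.sum_congr rfl fun i _ => ?_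
  by_cases h : some a = some (en i).1 <;> simp [iv, xi, h]

theorem tooth_none' {B : Type*} [Fintype B] {k : ℕ} (t : B → Bool)
    (en : Fin k ≃ {b : B // t b = true}) (a : B) :
    ∑ i, xi (some a = some (en i).1) ((none : Option B) = some (en i).1) =
      tb (t a) := by
  rw [← tooth_one t en a]
  refine Finset.sum_congr rfl fun i _ => ?_
  by_cases h : some a = some (en i).1 <;> simp [iv, xi, h]

theorem tooth_two {B : Type*} [Fintype B] {k : ℕ} (t : B → Bool)
    (en : Fin k ≃ {b : B // t b = true}) (a b : B) (hab : a ≠ b) :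
    ∑ i, xi (some a = some (en i).1) (some b = some (en i).1) =
      tb (t a) + tb (t b) := by
  rw [← tooth_one t en a, ← tooth_one t en b, ← Finset.sum_add_distrib]
  refine Finset.sum_congr rfl fun i _ => ?_
  by_cases h : a = (en i).1
  · have : b ≠ (en i).1 := fun h' => hab (h.trans h'.symm)
    simp [iv, xi, h, this]
  · by_cases h' : b = (en i).1 <;> simp [iv, xi, h, h']

theorem combW_good {B : Type*} [Fintype B] {L k : ℕ} (t : B → Bool)
    (en : Fin k ≃ {b : B // t b = true}) : GoodW t (combW (L := L) t en) where
  zz := by intro z z'; simp [combW, hdl, blkOf, xi]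
  zw := by intro z w hw; simp only [combW, blkOf, tooth_none]; simp [hdl, hw, tb, xi]
  wz := by intro z w hw; simp only [combW, blkOf, tooth_none']; simp [hdl, hw, tb, xi]
  i01 := by intro u; simp [combW, hdl, blkOf, xi]
  i10 := by intro u; simp [combW, hdl, blkOf, xi]
  i12 := by intro u; cases h : t u <;> simp [combW, hdl, blkOf, tb, xi, h]
  i21 := by intro u; cases h : t u <;> simp [combW, hdl, blkOf, tb, xi, h]
  i23 := by intro u; simp [combW, hdl, blkOf, xi]
  i32 := by intro u; simp [combW, hdl, blkOf, xi]
  top := by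
    intro a b hab
    simp only [combW, blkOf, tooth_two t en a b hab]
    rw [add_comm]
    congr 1
    cases ha : t a <;> cases hb : t b <;> simp [hdl, neb, xi, ha, hb]
  bot := by
    intro a b hab
    simp only [combW, blkOf, tooth_two t en a b hab]
    simp [hdl, xi]

variable {P : Type*} [Fintype P] [DecidableEq P] {L n : ℕ}

noncomputable def Hof (e : Vtx (P ⊕ Bool) L ≃ Fin n) (U : P → Bool) : Finset (Fin n) :=
  Finset.univ.filter fun x => hdl (extT U) (e.symm x)

noncomputable def enOf (U : P → Bool) : Fin (Fintype.card {b : P ⊕ Bool // extT U b = true}) ≃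
    {b : P ⊕ Bool // extT U b = true} := (Fintype.equivFin _).symm

noncomputable def Tof (e : Vtx (P ⊕ Bool) L ≃ Fin n) (U : P → Bool)
    (i : Fin (Fintype.card {b : P ⊕ Bool // extT U b = true})) : Finset (Fin n) :=
  Finset.univ.filter fun x => blkOf (e.symm x) = some (enOf U i).1

theorem card_ext (U : P → Bool) : Fintype.card {b : P ⊕ Bool // extT U b = true} = cntT U + 2 := by
  rw [Fintype.card_subtype, Finset.card_filter, Fintype.sum_sum_type]
  have h1 : ∑ x : Bool, (if extT U (.inr x) = true then 1 else 0) = 2 := by simp [extT]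
  rw [h1]
  congr 1

theorem comb_ok (hL : 0 < L) (e : Vtx (P ⊕ Bool) L ≃ Fin n) (U : P → Bool) (hU : Odd (cntT U)) :
    IsUniformComb 2 4 (Hof e U) (Tof e U) := by
  have hT : ∀ i, Tof e U i = (Finset.univ : Finset (Fin 4)).image
      (fun j => e (.inr ((enOf U i).1, j))) := by
    intro i
    ext x
    simp only [Tof, Finset.mem_filter, Finset.mem_univ, true_and, Finset.mem_image]
    constructor
    · intro h
      rcases hx : e.symm x with z | ⟨b, j⟩
      · rw [hx] at h; simp [blkOf] at h
      · rw [hx] at h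
        simp only [blkOf, Option.some.injEq] at h
        refine ⟨j, ?_⟩
        rw [← h, ← hx]; simp
    · rintro ⟨j, rfl⟩
      simp [blkOf]
  have hHT : ∀ i, Hof e U ∩ Tof e U i = ({0, 1} : Finset (Fin 4)).image
      (fun j => e (.inr ((enOf U i).1, j))) := by
    intro i
    rw [hT]
    ext x
    simp only [Hof, Finset.mem_inter, Finset.mem_filter, Finset.mem_univ, true_and, Finset.mem_image]
    constructor
    · rintro ⟨h, j, rfl⟩
      refine ⟨j, ?_, rfl⟩
      simp [hdl] at h
      have := h.2
      simp only [Finset.mem_insert, Finset.mem_singleton]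
      omega
    · rintro ⟨j, hj, rfl⟩
      refine ⟨?_, j, rfl⟩
      simp only [Equiv.symm_apply_apply, hdl]
      refine ⟨(enOf U i).2, ?_⟩
      simp only [Finset.mem_insert, Finset.mem_singleton] at hj
      rcases hj with rfl | rfl <;> simp
  have hinj : ∀ i, Function.Injective (fun j : Fin 4 => e (.inr ((enOf U i).1, j))) := by
    intro i j j' h
    simpa using h
  have hc2 : ∀ i, (Hof e U ∩ Tof e U i).card = 2 := by
    intro i
    rw [hHT, Finset.card_image_of_injective _ (hinj i)]; simp
  refine ⟨⟨?_, ?_, ?_, ?_, ?_⟩, ?_⟩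
  · rw [card_ext]
    have := hU.pos
    omega
  · rw [card_ext]
    exact hU.add_even (by decide)
  · intro i j hij
    rw [Finset.disjoint_left]
    intro x hx hy
    simp only [Tof, Finset.mem_filter, Finset.mem_univ, true_and] at hx hy
    rw [hx] at hy
    exact hij ((enOf U).injective (Subtype.ext (Option.some.inj hy)))
  · intro i
    rw [← Finset.card_pos]
    convert (by rw [hc2 i]; norm_num : 0 < (Hof e U ∩ Tof e U i).card)
  · refine ⟨e (.inl ⟨0, hL⟩), ?_⟩
    rw [Finset.mem_sdiff]
    refine ⟨by simp [Hof, hdl], ?_⟩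
    rw [Finset.mem_biUnion]
    rintro ⟨i, -, hi⟩
    simp only [Tof, Finset.mem_filter, Finset.mem_univ, true_and, Equiv.symm_apply_apply] at hi
    simp [blkOf] at hi
  · intro i
    refine ⟨?_, ?_⟩
    · rw [hT, Finset.card_image_of_injective _ (hinj i)]; simp
    · convert hc2 i

theorem tour_ok (hL : 0 < L) (hn : 3 ≤ n) (e : Vtx (P ⊕ Bool) L ≃ Fin n) (M : Equiv.Perm P) (hM : IsPM M) :
    ∃ x ∈ tspPolytope n, ∀ U : P → Bool,
      cutSum (Hof e U) x + ∑ i, cutSum (Tof e U i) x =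
        3 * (Fintype.card {b : P ⊕ Bool // extT U b = true} : ℝ) + (ell2 U M : ℝ) / 2 := by
  obtain ⟨L, rfl⟩ : ∃ L', L = L' + 1 := ⟨L - 1, by omega⟩
  obtain ⟨pr, hnd, hall⟩ := pm_pairs M hM
  have hinv : ∀ v, M (M v) = v := fun v => by
    have := congrArg (fun f : Equiv.Perm P => f v) hM.1
    simpa using this
  set prB : List ((P ⊕ Bool) × (P ⊕ Bool)) := pr.map fun a => (.inl a, .inl (M a)) with hprB
  have hfl : prB.flatMap (fun p => [p.1, p.2]) = (pr.flatMap fun a => [a, M a]).map Sum.inl := by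
    rw [hprB, List.flatMap_map, List.map_flatMap]; rfl
  have hndB : ((Sum.inr false : P ⊕ Bool) ::
      (prB.flatMap (fun p => [p.1, p.2]) ++ [Sum.inr true])).Nodup := by
    rw [hfl, List.nodup_cons, List.nodup_append]
    refine ⟨by simp, hnd.map Sum.inl_injective, by simp, ?_⟩
    intro a ha b hb
    simp only [List.mem_map, List.mem_singleton] at ha hb
    obtain ⟨_, _, rfl⟩ := ha
    subst hb
    simp
  have hallB : ∀ b, b ∈ ((Sum.inr false : P ⊕ Bool) ::
      (prB.flatMap (fun p => [p.1, p.2]) ++ [Sum.inr true])) := by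
    rw [hfl]
    rintro (v | _ | _)
    · simp only [List.mem_cons, List.mem_append, List.mem_map]
      exact Or.inr (Or.inl ⟨v, hall v, rfl⟩)
    · simp
    · simp
  set zs : List (Fin (L + 1)) := (List.finRange L).map Fin.succ
  have hzs : (0 : Fin (L + 1)) :: zs = List.finRange (L + 1) := (List.finRange_succ).symm
  have hz1 : ((0 : Fin (L + 1)) :: zs).Nodup := by rw [hzs]; exact List.nodup_finRange _
  have hz2 : ∀ y, y ∈ (0 : Fin (L + 1)) :: zs := by rw [hzs]; exact List.mem_finRange
  set tl := tourTail zs (Sum.inr false : P ⊕ Bool) (Sum.inr true) prB with htl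
  have hN := tour_nodup _ _ _ _ hz1 _ hndB
  have hA := tour_mem _ _ _ _ hz2 _ hallB
  rw [← htl] at hN
  simp only [← htl] at hA
  obtain ⟨x, hx, hS⟩ := tsp_point (e (.inl 0)) (tl.map e)
    (by rw [← List.map_cons (f := e)]; exact hN.map e.injective)
    (by
      intro v
      rw [← List.map_cons (f := e)]
      exact List.mem_map.2 ⟨e.symm v, hA _, by simp⟩) hn
  refine ⟨x, hx, fun U => ?_⟩
  have hgood := combW_good (L := L + 1) (extT U) (enOf U)
  have h1 := pathW_tour hgood (Sum.inr false) (Sum.inr true) rfl rfl 0 zs prB hndB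
  have h2 : cutSum (Hof e U) x + ∑ i, cutSum (Tof e U i) x =
      pathW (combW (extT U) (enOf U)) (.inl 0 :: tl ++ [.inl 0]) := by
    simp only [hS]
    have h3 : e (.inl 0) :: tl.map e ++ [e (.inl 0)] = (Sum.inl 0 :: tl ++ [Sum.inl 0]).map e := by simp
    rw [h3]
    simp only [pathW_map]
    rw [pathW_add_sum]
    congr 1
    funext u v
    simp only [combW, Hof, Tof, Finset.mem_filter, Finset.mem_univ, true_and, Equiv.symm_apply_apply]
  rw [h2, htl, h1, card_ext]
  have h4 := pm_sum M pr hnd hall (fun v => 3 * tb (U v) + neb (U v) (U (M v)) / 2)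
  have h5 : (prB.map fun p => 3 * (tb (extT U p.1) + tb (extT U p.2)) +
      neb (extT U p.1) (extT U p.2)) =
      (pr.map fun a => (3 * tb (U a) + neb (U a) (U (M a)) / 2) +
        (3 * tb (U (M a)) + neb (U (M a)) (U (M (M a))) / 2)) := by
    rw [hprB, List.map_map]
    refine List.map_congr_left fun a _ => ?_
    simp only [Function.comp, extT, hinv]
    have : neb (U (M a)) (U a) = neb (U a) (U (M a)) := by simp [neb, eq_comm]
    rw [this]; ring
  rw [h5, h4, Finset.sum_add_distrib, ← Finset.mul_sum, ← Finset.sum_div]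
  have h6 : ∑ v, tb (U v) = (cntT U : ℝ) := by
    unfold cntT tb; push_cast; rfl
  have h7 : ∑ v, neb (U v) (U (M v)) = (ell2 U M : ℝ) := by
    unfold ell2 neb; push_cast; refine Finset.sum_congr rfl fun v _ => ?_
    congr
  rw [h6, h7]
  push_cast
  ring
end

end

section
section
open scoped Classical

theorem xc_spec {ι : Type*} [Fintype ι] (Q : Set (ι → ℝ)) (hQ : IsPolyhedron Q) :
    ∃ (d : ℕ) (A : Matrix (Fin (xc Q)) (Fin d) ℝ) (b : Fin (xc Q) → ℝ)
      (π : (Fin d → ℝ) →ₗ[ℝ] (ι → ℝ)), π '' {x | A.mulVec x ≤ b} = Q := by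
  have hne : {k | ∃ (m : ℕ) (A : Matrix (Fin k) (Fin m) ℝ) (b : Fin k → ℝ)
      (π : (Fin m → ℝ) →ₗ[ℝ] (ι → ℝ)),
      π '' {x | A.mulVec x ≤ b} = Q}.Nonempty := by
    obtain ⟨k, A, b, rfl⟩ := hQ
    let eq := Fintype.equivFin ι
    refine ⟨k, Fintype.card ι, fun i j => A i (eq.symm j), b,
      (LinearEquiv.funCongrLeft ℝ ℝ eq).toLinearMap, ?_⟩
    ext x
    simp only [Set.mem_image, Set.mem_ofPred_eq]
    constructor
    · rintro ⟨y, hy, rfl⟩ i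
      have := hy i
      rw [← Equiv.sum_comp eq.symm]
      simpa [Matrix.mulVec, dotProduct, LinearEquiv.funCongrLeft_apply, LinearMap.funLeft_apply] using this
    · intro hx
      refine ⟨x ∘ eq.symm, fun i => ?_, ?_⟩
      · have := hx i
        rw [← Equiv.sum_comp eq.symm] at this
        simpa [Matrix.mulVec, dotProduct] using this
      · funext j
        simp [LinearEquiv.funCongrLeft_apply, LinearMap.funLeft_apply]
  exact Nat.sInf_mem hne

noncomputable def cutSumL {n : ℕ} (S : Finset (Fin n)) : (KEdge n → ℝ) →ₗ[ℝ] ℝ where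
  toFun := cutSum S
  map_add' x y := by simp [cutSum, Finset.sum_add_distrib]
  map_smul' c x := by simp [cutSum, Finset.mul_sum]

theorem cutSumL_apply {n : ℕ} (S : Finset (Fin n)) (x : KEdge n → ℝ) :
    cutSumL S x = cutSum S x := rfl

theorem lower_bound {n m L : ℕ} (hn : n = L + 48 + 24 * m) (hL : 0 < L)
    (Q : Set (KEdge n → ℝ)) (hQ : IsPolyhedron Q) (hsub : tspPolytope n ⊆ Q)
    (hcomb : ∀ x ∈ Q, ∀ (H : Finset (Fin n)) (k : ℕ) (T : Fin k → Finset (Fin n)),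
          IsUniformComb 2 4 H T →
            (3 * k + 1 : ℝ) ≤ cutSum H x + ∑ i, cutSum (T i) x) :
    (1 / 4 : ℝ) ≤ 3200 * (1 - 1 / 25600) ^ (m + 1) * ((xc Q + 1 : ℕ) * (10 + 6 * m)) := by
  obtain ⟨d, A, b, π, hπ⟩ := xc_spec Q hQ
  have hcard : Fintype.card (Vtx (Pos m ⊕ Bool) L) = n := by
    simp; omega
  let e : Vtx (Pos m ⊕ Bool) L ≃ Fin n := Fintype.equivFinOfCardEq hcard
  have hY : ∀ M : {M : Equiv.Perm (Pos m) // IsPM M}, ∃ y, A.mulVec y ≤ b ∧ ∀ U : Pos m → Bool,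
      cutSum (Hof e U) (π y) + ∑ i, cutSum (Tof e U i) (π y) =
        3 * (Fintype.card {b : Pos m ⊕ Bool // extT U b = true} : ℝ) + (ell2 U M.1 : ℝ) / 2 := by
    rintro ⟨M, hM⟩
    obtain ⟨x, hx, hx2⟩ := tour_ok hL (by omega) e M hM
    have : x ∈ π '' {x | A.mulVec x ≤ b} := by rw [hπ]; exact hsub hx
    obtain ⟨y, hy, rfl⟩ := this
    exact ⟨y, hy, hx2⟩
  choose Y hY1 hY2 using hY
  have hl : ∀ U : {U : Pos m → Bool // Odd (cntT U)}, ∃ l : Option (Fin (xc Q)) → ℝ, (∀ i, 0 ≤ l i) ∧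
      ∀ c, |((ell2 U.1 c.1 : ℝ) / 2 - 1) - (l none + ∑ i, l (some i) * (b i - A.mulVec (Y c) i))| ≤ 1 / 1000 := by
    rintro ⟨U, hU⟩
    obtain ⟨l, hl0, hl1⟩ := approx_farkas A b
      ((cutSumL (Hof e U) + ∑ i, cutSumL (Tof e U i)).comp π)
      (3 * (Fintype.card {b : Pos m ⊕ Bool // extT U b = true} : ℝ) + 1) (by
        intro y hy
        have hyQ : π y ∈ Q := by rw [← hπ]; exact ⟨y, hy, rfl⟩
        have := hcomb (π y) hyQ (Hof e U) _ (Tof e U) (by convert comb_ok hL e U hU)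
        simpa [cutSumL_apply] using this) Y hY1 (1 / 1000) (by norm_num)
    refine ⟨l, hl0, fun c => ?_⟩
    have h1 := hl1 c
    have h2 : ((cutSumL (Hof e U) + ∑ i, cutSumL (Tof e U i)).comp π) (Y c) =
        3 * (Fintype.card {b : Pos m ⊕ Bool // extT U b = true} : ℝ) + (ell2 U c.1 : ℝ) / 2 := by
      rw [← hY2 c U]
      simp [cutSumL_apply]
    rw [h2] at h1
    convert h1 using 2
    ring
  choose l hl0 hl1 using hl
  refine rothvoss (m := m) (R := xc Q + 1)
    (fun r U => if h : Odd (cntT U) then l ⟨U, h⟩ (finSuccEquiv _ r) else 0)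
    (fun r M => if h : IsPM M then
      (finSuccEquiv _ r).elim 1 (fun i => b i - A.mulVec (Y ⟨M, h⟩) i) else 0) ?_ ?_ ?_ ?_ ?_
  · intro r U
    split_ifs with h
    · exact hl0 _ _
    · exact le_rfl
  · intro r M
    split_ifs with h
    · cases finSuccEquiv (xc Q) r with
      | none => simp
      | some i => exact sub_nonneg.2 (hY1 ⟨M, h⟩ i)
    · exact le_rfl
  · intro r U h; simp [h]
  · intro r M h; simp [h]
  · intro U M hU hM
    simp only [hU, hM, dif_pos]
    rw [Equiv.sum_comp (finSuccEquiv (xc Q)) (fun o => l ⟨U, hU⟩ o *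
      o.elim 1 (fun i => b i - A.mulVec (Y ⟨M, hM⟩) i)), Fintype.sum_option, abs_sub_comm]
    simpa using hl1 ⟨U, hU⟩ ⟨M, hM⟩
end

theorem final_arith (n m : ℕ) (k : ℕ) (hn : n ≤ 24 * (m + 1) + 48) (hm : 100000000000 ≤ m + 1)
    (h : (1 / 4 : ℝ) ≤ 3200 * (1 - 1 / 25600) ^ (m + 1) * ((k + 1 : ℕ) * (10 + 6 * m))) :
    (2 : ℝ) ^ ((1 / 7372800 : ℝ) * n) ≤ k := by
  set x : ℝ := (m : ℝ) + 1 with hx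
  have hx1 : (100000000000 : ℝ) ≤ x := by rw [hx]; exact_mod_cast hm
  have hnx : (n : ℝ) ≤ 72 * x := by
    have : (n : ℝ) ≤ 24 * (m + 1) + 48 := by exact_mod_cast hn
    rw [← hx] at this
    linarith
  set E : ℝ := Real.exp (x / 102400) with hE
  have hE1 : x / 102400 ≤ E := by
    have := Real.add_one_le_exp (x / 102400); linarith
  have hEpos : 0 < E := Real.exp_pos _
  have hp : (1 - 1 / 25600 : ℝ) ^ (m + 1) ≤ (E ^ 4)⁻¹ := by
    have h1 : (1 - 1 / 25600 : ℝ) ≤ Real.exp (-(1 / 25600)) := by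
      have := Real.add_one_le_exp (-(1 / 25600 : ℝ)); linarith
    calc (1 - 1 / 25600 : ℝ) ^ (m + 1) ≤ (Real.exp (-(1 / 25600))) ^ (m + 1) :=
          pow_le_pow_left₀ (by norm_num) h1 _
      _ = (E ^ 4)⁻¹ := by
          rw [hE, ← Real.exp_nat_mul, ← Real.exp_nat_mul, ← Real.exp_neg, hx]
          congr 1
          push_cast
          ring
  have h2 : (2 : ℝ) ^ ((1 / 7372800 : ℝ) * n) ≤ E := by
    rw [Real.rpow_def_of_pos (by norm_num)]
    apply Real.exp_le_exp.2
    have hl : Real.log 2 ≤ 1 := by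
      have := Real.log_le_sub_one_of_pos (show (0:ℝ) < 2 by norm_num); linarith
    have hn0 : (0:ℝ) ≤ n := by positivity
    have : Real.log 2 * (1 / 7372800 * n) ≤ 1 * (1 / 7372800 * n) := by gcongr
    linarith
  have h3 : (1 / 4 : ℝ) ≤ 3200 * (E ^ 4)⁻¹ * ((k + 1) * (16 * x)) := by
    refine h.trans ?_
    push_cast
    have : (10 + 6 * m : ℝ) ≤ 16 * x := by
      have : (0:ℝ) ≤ m := by positivity
      rw [hx]; linarith
    gcongr
  have h4 : E ^ 4 ≤ 204800 * x * (k + 1) := by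
    have : 3200 * (E ^ 4)⁻¹ * ((k + 1) * (16 * x)) = (51200 * x * (k + 1)) / E ^ 4 := by
      field_simp; ring
    rw [this, le_div_iff₀ (by positivity)] at h3
    linarith
  have hE6 : 1 ≤ E := Real.one_le_exp (by positivity)
  have hx0 : 0 < x := by positivity
  have h5 : 409600 * x ≤ E ^ 3 := by
    have h8 : (x / 102400) ^ 3 ≤ E ^ 3 := pow_le_pow_left₀ (by positivity) hE1 3
    have h9 : (100000000000 : ℝ) * 100000000000 ≤ x * x :=
      mul_le_mul hx1 hx1 (by norm_num) hx0.le
    have h10 : (439804651110400000000 : ℝ) ≤ x * x := le_trans (by norm_num) h9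
    have h11 := mul_le_mul_of_nonneg_right h10 hx0.le
    have h12 : (x / 102400) ^ 3 = x * x * x / 1073741824000000 := by ring
    rw [h12] at h8
    refine le_trans ?_ h8
    rw [le_div_iff₀ (by norm_num)]
    linarith
  have h6 : 409600 * x * E ≤ 204800 * x * (k + 1) := by
    refine le_trans ?_ h4
    have h5' := mul_le_mul_of_nonneg_right h5 hEpos.le
    have h13 : E ^ 4 = E ^ 3 * E := by ring
    rw [h13]; exact h5'
  have h7 : 2 * E ≤ k + 1 := by
    have : (204800 * x) * (2 * E) ≤ (204800 * x) * (k + 1) := by linarith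
    exact le_of_mul_le_mul_left this (by positivity)
  linarith

end

open SimpleGraph Finset

attribute [local instance] Classical.propDecidable

theorem hfree_tsp_xc_stmt4 :
    ∃ c : ℝ, 0 < c ∧ ∃ N : ℕ, ∀ n : ℕ, 4 ∣ n → N ≤ n →
      ∀ Q : Set (KEdge n → ℝ), IsPolyhedron Q → tspPolytope n ⊆ Q →
        (∀ x ∈ Q, ∀ (H : Finset (Fin n)) (k : ℕ) (T : Fin k → Finset (Fin n)),
          IsUniformComb 2 4 H T →
            (3 * k + 1 : ℝ) ≤ cutSum H x + ∑ i, cutSum (T i) x) →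
        (2 : ℝ) ^ (c * n) ≤ (xc Q : ℝ) := by
  refine ⟨1 / 7372800, by norm_num, 2400000000100, fun n _ hN Q hQ hsub hcomb => ?_⟩
  have hn : n = (n - 48 - 24 * ((n - 49) / 24)) + 48 + 24 * ((n - 49) / 24) := by omega
  have hL : 0 < n - 48 - 24 * ((n - 49) / 24) := by omega
  have key := lower_bound hn hL Q hQ hsub (fun x hx H k T hT => hcomb x hx H k T (by convert hT))
  exact final_arith n ((n - 49) / 24) (xc Q) (by omega) (by omega) key
end

section
/- There exist a constant c > 0 and N ∈ ℕ such that for every n ≥ N, the polytope 2MP(n) ⊆ ℝ^{E(K_n)}, defined as the convex hull of the characteristic vectors of the edge sets of all 2-matchings of K_n, has extension complexity xc(2MP(n)) ≥ 2^{c·n}. -/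
open SimpleGraph Finset

attribute [local instance] Classical.propDecidable

/-- A 2-matching of `K_n`, given as a set of edges: every vertex is incident
to exactly two edges of the set. -/
def IsTwoMatchingKn {n : ℕ} (F : Finset (KEdge n)) : Prop :=
  ∀ v : Fin n, (F.filter (fun e => v ∈ e.1)).card = 2

/-- The 2-matching polytope of `K_n`: the convex hull of the characteristic
vectors of the edge sets of the 2-matchings of `K_n`. -/
noncomputable def twoMatchingPolytope (n : ℕ) : Set (KEdge n → ℝ) :=
  convexHull ℝ {x | ∃ F : Finset (KEdge n), IsTwoMatchingKn F ∧
    x = fun e => if e ∈ F then (1 : ℝ) else 0}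


/-! ### Farkas -/

lemma farkas_lin {E : Type*} [AddCommGroup E] [Module ℝ E] : ∀ (k : ℕ) (A : Fin k → (E →ₗ[ℝ] ℝ))
    (c : E →ₗ[ℝ] ℝ), (∀ x, (∀ i, A i x ≤ 0) → c x ≤ 0) →
    ∃ l : Fin k → ℝ, (∀ i, 0 ≤ l i) ∧ c = ∑ i, l i • A i := by
  intro k
  induction k with
  | zero =>
    intro A c h
    refine ⟨fun _ => 0, by simp, ?_⟩
    ext x
    have h1 := h x (fun i => i.elim0)
    have h2 := h (-x) (fun i => i.elim0)
    simp at h2 ⊢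
    linarith
  | succ k ih =>
    intro A c h
    by_cases hk : ∀ x, (∀ i : Fin k, A i.castSucc x ≤ 0) → c x ≤ 0
    · obtain ⟨l, hl, hc⟩ := ih (fun i => A i.castSucc) c hk
      refine ⟨Fin.snoc l 0, ?_, ?_⟩
      · intro i
        refine Fin.lastCases ?_ (fun j => ?_) i
        · simp
        · simpa using hl j
      · rw [Fin.sum_univ_castSucc]
        simpa using hc
    · push Not at hk
      obtain ⟨x0, hx0, hcx⟩ := hk
      have hA : 0 < A (Fin.last k) x0 := by
        by_contra hcon
        push Not at hcon
        have := h x0 (fun i => Fin.lastCases hcon hx0 i)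
        linarith
      set r := A (Fin.last k) x0 with hr
      obtain ⟨l, hl, hc⟩ := ih (fun i => A i.castSucc - (A i.castSucc x0 / r) • A (Fin.last k))
        (c - (c x0 / r) • A (Fin.last k)) (by
          intro x hx
          have h1 := h (x - (A (Fin.last k) x / r) • x0) (by
            intro i
            refine Fin.lastCases ?_ (fun j => ?_) i
            · simp only [map_sub, map_smul, smul_eq_mul, ← hr]
              field_simp
              simp
            · have := hx j
              simp only [LinearMap.sub_apply, LinearMap.smul_apply, smul_eq_mul] at this
              simp only [map_sub, map_smul, smul_eq_mul]
              have e : A (Fin.last k) x / r * A j.castSucc x0 = A j.castSucc x0 / r * A (Fin.last k) x := by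
                ring
              linarith)
          simp only [LinearMap.sub_apply, LinearMap.smul_apply, smul_eq_mul]
          simp only [map_sub, map_smul, smul_eq_mul] at h1
          have e : A (Fin.last k) x / r * c x0 = c x0 / r * A (Fin.last k) x := by
            ring
          linarith)
      refine ⟨Fin.snoc l ((c x0 - ∑ i, l i * A i.castSucc x0) / r), ?_, ?_⟩
      · intro i
        refine Fin.lastCases ?_ (fun j => ?_) i
        · simp only [Fin.snoc_last]
          refine div_nonneg ?_ hA.le
          have : ∑ i, l i * A i.castSucc x0 ≤ 0 :=
            Finset.sum_nonpos (fun i _ => mul_nonpos_of_nonneg_of_nonpos (hl i) (hx0 i))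
          linarith
        · simpa using hl j
      · rw [Fin.sum_univ_castSucc]
        simp only [Fin.snoc_castSucc, Fin.snoc_last]
        ext x
        have h2 := congrArg (fun φ : E →ₗ[ℝ] ℝ => φ x) hc
        simp only [LinearMap.sub_apply, LinearMap.smul_apply, smul_eq_mul, LinearMap.sum_apply,
          LinearMap.add_apply] at h2 ⊢
        have h3 : ∑ i, l i * (A i.castSucc x - A i.castSucc x0 / r * A (Fin.last k) x) =
            ∑ i, l i * A i.castSucc x - (∑ i, l i * A i.castSucc x0) / r * A (Fin.last k) x := by
          rw [Finset.sum_div, Finset.sum_mul, ← Finset.sum_sub_distrib]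
          refine Finset.sum_congr rfl (fun i _ => ?_)
          ring
        rw [h3] at h2
        rw [sub_div, sub_mul]
        linarith

/-- Affine Farkas lemma for a nonempty polyhedron. -/
lemma farkas_aff {k m : ℕ} (A : Matrix (Fin k) (Fin m) ℝ) (b : Fin k → ℝ)
    (x1 : Fin m → ℝ) (hx1 : A.mulVec x1 ≤ b)
    (c : (Fin m → ℝ) →ₗ[ℝ] ℝ) (d : ℝ) (h : ∀ x, A.mulVec x ≤ b → 0 ≤ c x + d) :
    ∃ l : Option (Fin k) → ℝ, (∀ i, 0 ≤ l i) ∧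
      ∀ x, c x + d = l none + ∑ i, l (some i) * (b i - A.mulVec x i) := by
  let row : Fin k → ((Fin m → ℝ) × ℝ) →ₗ[ℝ] ℝ := fun i =>
    (LinearMap.proj i ∘ₗ A.mulVecLin) ∘ₗ LinearMap.fst ℝ _ _ - b i • LinearMap.snd ℝ _ _
  have hrow : ∀ i z, row i z = A.mulVec z.1 i - b i * z.2 := by
    intro i z; simp [row]
  let A' : Fin (k + 1) → ((Fin m → ℝ) × ℝ) →ₗ[ℝ] ℝ := Fin.snoc row (- LinearMap.snd ℝ _ _)
  let c' : ((Fin m → ℝ) × ℝ) →ₗ[ℝ] ℝ := - (c ∘ₗ LinearMap.fst ℝ _ _) - d • LinearMap.snd ℝ _ _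
  have hc' : ∀ z, c' z = - c z.1 - d * z.2 := by intro z; simp [c']
  obtain ⟨l, hl, hc⟩ := farkas_lin (k + 1) A' c' (by
    intro z hz
    have hz1 : ∀ i, A.mulVec z.1 i ≤ b i * z.2 := by
      intro i
      have := hz i.castSucc
      simp only [A', Fin.snoc_castSucc, hrow] at this
      linarith
    have hz2 : 0 ≤ z.2 := by
      have := hz (Fin.last k)
      simp [A', Fin.snoc_last] at this
      linarith
    rw [hc']
    rcases hz2.eq_or_lt with h0 | hpos
    · -- recession direction
      rw [← h0]
      by_contra hcon
      have hneg : c z.1 < 0 := by linarith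
      have hN : ∀ s : ℝ, 0 ≤ s → 0 ≤ c x1 + s * c z.1 + d := by
        intro s hs
        have := h (x1 + s • z.1) (by
          intro i
          have h1 := hz1 i
          rw [← h0] at h1
          have h2 := hx1 i
          rw [Matrix.mulVec_add, Matrix.mulVec_smul]
          simp only [Pi.add_apply, Pi.smul_apply, smul_eq_mul]
          have : s * A.mulVec z.1 i ≤ 0 := mul_nonpos_of_nonneg_of_nonpos hs (by linarith)
          linarith)
        simpa using this
      have h3 := hN 0 le_rfl
      have h4 := hN ((c x1 + d + 1) / (- c z.1)) (by
        refine div_nonneg ?_ ?_ <;> linarith)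
      have h5 : (c x1 + d + 1) / (- c z.1) * c z.1 = - (c x1 + d + 1) := by
        have := hneg.ne
        field_simp
      rw [h5] at h4
      linarith
    · have := h (z.2⁻¹ • z.1) (by
        intro i
        rw [Matrix.mulVec_smul]
        simp only [Pi.smul_apply, smul_eq_mul]
        rw [inv_mul_le_iff₀ hpos]
        linarith [hz1 i])
      rw [map_smul, smul_eq_mul] at this
      have h6 := mul_le_mul_of_nonneg_left this hpos.le
      rw [mul_add, ← mul_assoc, mul_inv_cancel₀ hpos.ne'] at h6
      linarith)
  refine ⟨fun o => o.elim (l (Fin.last k)) (fun i => l i.castSucc), ?_, ?_⟩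
  · rintro (_ | i)
    · exact hl _
    · exact hl _
  · intro x
    have h2 := congrArg (fun φ : ((Fin m → ℝ) × ℝ) →ₗ[ℝ] ℝ => φ (x, 1)) hc
    simp only [hc'] at h2
    rw [Fin.sum_univ_castSucc] at h2
    simp only [A', Fin.snoc_castSucc, Fin.snoc_last, LinearMap.add_apply, LinearMap.sum_apply,
      LinearMap.smul_apply, hrow, smul_eq_mul, LinearMap.neg_apply, LinearMap.snd_apply] at h2
    simp only [Option.elim]
    have h3 : ∑ i : Fin k, l i.castSucc * (b i - A.mulVec x i) =
        - ∑ i : Fin k, l i.castSucc * (A.mulVec x i - b i * 1) := by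
      rw [← Finset.sum_neg_distrib]
      refine Finset.sum_congr rfl (fun i _ => ?_)
      ring
    rw [h3]
    linarith

/-- convex hulls of finite sets have an extended formulation -/
lemma exists_ext {ι : Type*} [Fintype ι] (s : Set (ι → ℝ)) (hs : s.Finite) :
    {k | ∃ (m : ℕ) (A : Matrix (Fin k) (Fin m) ℝ) (b : Fin k → ℝ)
      (π : (Fin m → ℝ) →ₗ[ℝ] (ι → ℝ)),
      π '' {x | A.mulVec x ≤ b} = convexHull ℝ s}.Nonempty := by
  have := hs.fintype
  obtain ⟨e⟩ : Nonempty (Fin (Fintype.card s) ≃ s) := ⟨(Fintype.equivFin s).symm⟩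
  set m := Fintype.card s
  let A0 : Matrix (Fin m ⊕ (Unit ⊕ Unit)) (Fin m) ℝ := fun i j =>
    Sum.elim (fun i => if i = j then -1 else 0) (Sum.elim (fun _ => 1) (fun _ => -1)) i
  let b0 : Fin m ⊕ (Unit ⊕ Unit) → ℝ := Sum.elim (fun _ => 0) (Sum.elim (fun _ => 1) (fun _ => -1))
  let r := Fintype.equivFin (Fin m ⊕ (Unit ⊕ Unit))
  refine ⟨_, m, A0.submatrix r.symm id, b0 ∘ r.symm,
    ∑ i : Fin m, (LinearMap.proj i).smulRight (e i).1, ?_⟩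
  have hset : {x | (A0.submatrix r.symm id).mulVec x ≤ b0 ∘ r.symm} = stdSimplex ℝ (Fin m) := by
    ext x
    have h1 : (A0.submatrix r.symm id).mulVec x ≤ b0 ∘ r.symm ↔ A0.mulVec x ≤ b0 := by
      constructor
      · intro h i
        have := h (r i)
        simpa [Matrix.mulVec, dotProduct] using this
      · intro h i
        exact h (r.symm i)
    simp only [Set.mem_ofPred_eq, h1, stdSimplex]
    constructor
    · intro h
      refine ⟨fun i => ?_, ?_⟩
      · have := h (Sum.inl i)
        simpa [Matrix.mulVec, dotProduct, A0, b0] using this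
      · have h2 := h (Sum.inr (Sum.inl ()))
        have h3 := h (Sum.inr (Sum.inr ()))
        simp [Matrix.mulVec, dotProduct, A0, b0] at h2 h3
        linarith
    · rintro ⟨h2, h3⟩ (i | i | i)
      · simpa [Matrix.mulVec, dotProduct, A0, b0] using h2 i
      · simp [Matrix.mulVec, dotProduct, A0, b0, h3]
      · simp [Matrix.mulVec, dotProduct, A0, b0, h3]
  rw [hset]
  have h4 : s = Set.range (fun i => (e i).1) := by
    ext y
    constructor
    · intro hy
      exact ⟨e.symm ⟨y, hy⟩, by simp⟩
    · rintro ⟨i, rfl⟩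
      exact (e i).2
  rw [← convexHull_basis_eq_stdSimplex, LinearMap.image_convexHull, ← Set.range_comp]
  refine Eq.trans ?_ (congrArg (convexHull ℝ) h4.symm)
  congr 2
  ext i j
  simp [Finset.sum_apply]
  rw [← Finset.sum_apply, Finset.sum_ite_eq]
  simp


/-! ### Concentration -/

/-- sign of a bit -/
def sgnB (b : Bool) : ℝ := if b = true then -1 else 1

lemma conc_sum {ι : Type*} [Fintype ι] [DecidableEq ι] (I : Finset ι) (l : ℝ) :
    ∑ x : ι → Bool, Real.exp (l * ∑ i ∈ I, sgnB (x i)) ≤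
      2 ^ (Fintype.card ι) * Real.exp (l ^ 2 / 2 * I.card) := by
  have h1 : ∀ x : ι → Bool, Real.exp (l * ∑ i ∈ I, sgnB (x i)) =
      ∏ i, (if i ∈ I then Real.exp (l * sgnB (x i)) else 1) := by
    intro x
    rw [Finset.mul_sum, Real.exp_sum, Finset.prod_ite_mem, Finset.univ_inter]
  simp_rw [h1]
  have h2 := (Finset.prod_univ_sum (fun _ : ι => (Finset.univ : Finset Bool))
    (fun i b => if i ∈ I then Real.exp (l * sgnB b) else 1)).symm
  rw [Fintype.piFinset_univ] at h2
  rw [h2]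
  have h3 : ∀ i ∈ (Finset.univ : Finset ι), (∑ b : Bool, if i ∈ I then Real.exp (l * sgnB b) else 1) ≤
      2 * (if i ∈ I then Real.exp (l ^ 2 / 2) else 1) := by
    intro i _
    by_cases hi : i ∈ I
    · have := Real.cosh_le_exp_half_sq l
      rw [Real.cosh_eq] at this
      simp [hi, sgnB]
      linarith
    · simp [hi]
  refine (Finset.prod_le_prod ?_ h3).trans ?_
  · intro i _
    refine Finset.sum_nonneg ?_
    intro b _
    split_ifs <;> positivity
  · rw [Finset.prod_mul_distrib, Finset.prod_ite_mem, Finset.univ_inter]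
    simp only [Finset.prod_const, Finset.card_univ]
    rw [mul_comm (l ^ 2 / 2), Real.exp_nat_mul]

lemma conc_main {ι : Type*} [Fintype ι] [DecidableEq ι] (f : (ι → Bool) → ℝ)
    (h0 : ∀ x, 0 ≤ f x) (h1 : ∀ x, f x ≤ 1) (ε : ℝ) (hε : 0 < ε) (I : Finset ι)
    (hI : ∀ i ∈ I, ε * ∑ x, f x ≤ ∑ x, f x * sgnB (x i)) :
    (∑ x, f x) ≤ 2 ^ (Fintype.card ι) * Real.exp (- (ε ^ 2 / 2 * I.card)) := by
  set a : ℝ := ε ^ 2 * I.card with ha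
  have e1 : Real.exp a * ∑ x, f x ≤ ∑ x : ι → Bool, Real.exp (ε * ∑ i ∈ I, sgnB (x i)) := by
    have e2 : ∀ x : ι → Bool, Real.exp a * (f x * (1 + ε * (∑ i ∈ I, sgnB (x i)) - a)) ≤
        Real.exp (ε * ∑ i ∈ I, sgnB (x i)) := by
      intro x
      set z := ε * ∑ i ∈ I, sgnB (x i)
      have h3 : Real.exp z = Real.exp a * Real.exp (z - a) := by
        rw [← Real.exp_add]; ring_nf
      have h4 := Real.add_one_le_exp (z - a)
      have h5 : f x * (1 + z - a) ≤ Real.exp (z - a) := by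
        have h6 : f x * (1 + z - a) ≤ f x * Real.exp (z - a) :=
          mul_le_mul_of_nonneg_left (by linarith) (h0 x)
        have h7 : f x * Real.exp (z - a) ≤ 1 * Real.exp (z - a) :=
          mul_le_mul_of_nonneg_right (h1 x) (Real.exp_pos _).le
        linarith
      rw [h3]
      exact mul_le_mul_of_nonneg_left h5 (Real.exp_pos _).le
    refine le_trans ?_ (Finset.sum_le_sum (fun x _ => e2 x))
    rw [← Finset.mul_sum]
    refine mul_le_mul_of_nonneg_left ?_ (Real.exp_pos _).le
    have h8 : ∑ x, f x * (1 + ε * (∑ i ∈ I, sgnB (x i)) - a) =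
        (∑ x, f x) * (1 - a) + ε * ∑ i ∈ I, ∑ x, f x * sgnB (x i) := by
      rw [Finset.sum_comm, Finset.mul_sum, Finset.sum_mul, ← Finset.sum_add_distrib]
      refine Finset.sum_congr rfl (fun x _ => ?_)
      rw [← Finset.mul_sum]; ring
    have h9 : (I.card : ℝ) * (ε * ∑ x, f x) ≤ ∑ i ∈ I, ∑ x, f x * sgnB (x i) := by
      have := Finset.card_nsmul_le_sum I (fun i => ∑ x, f x * sgnB (x i)) _ hI
      simpa [nsmul_eq_mul] using this
    rw [h8]
    have h10 := mul_le_mul_of_nonneg_left h9 hε.le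
    rw [ha]; nlinarith
  have e3 := e1.trans (conc_sum I ε)
  have e4 : Real.exp (-(ε ^ 2 / 2 * I.card)) = Real.exp (-a) * Real.exp (ε ^ 2 / 2 * I.card) := by
    rw [← Real.exp_add, ha]; ring_nf
  rw [e4]
  have e5 := mul_le_mul_of_nonneg_left e3 (Real.exp_pos (-a)).le
  rw [← mul_assoc, ← Real.exp_add] at e5
  simp at e5
  linarith

lemma conc_card {ι : Type*} [Fintype ι] [DecidableEq ι] (f : (ι → Bool) → ℝ)
    (h0 : ∀ x, 0 ≤ f x) (h1 : ∀ x, f x ≤ 1) (ε η : ℝ) (hε : 0 < ε) (hη : 0 ≤ η) (I : Finset ι)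
    (hI : ∀ i ∈ I, ε * ∑ x, f x ≤ ∑ x, f x * sgnB (x i)) :
    I.card * (∑ x, f x) ≤ η * Fintype.card ι * (∑ x, f x) +
      Fintype.card ι * (2 ^ (Fintype.card ι) * Real.exp (- (ε ^ 2 / 2 * (η * Fintype.card ι)))) := by
  have hs : 0 ≤ ∑ x, f x := Finset.sum_nonneg (fun x _ => h0 x)
  by_cases h : (I.card : ℝ) ≤ η * Fintype.card ι
  · have := mul_le_mul_of_nonneg_right h hs
    have : 0 ≤ (Fintype.card ι : ℝ) * (2 ^ (Fintype.card ι) * Real.exp (- (ε ^ 2 / 2 * (η * Fintype.card ι)))) := by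
      positivity
    linarith
  · push Not at h
    have h2 := conc_main f h0 h1 ε hε I hI
    have h3 : Real.exp (- (ε ^ 2 / 2 * I.card)) ≤ Real.exp (- (ε ^ 2 / 2 * (η * Fintype.card ι))) := by
      apply Real.exp_le_exp.2
      have : 0 < ε ^ 2 / 2 := by positivity
      nlinarith
    have h4 : (I.card : ℝ) ≤ Fintype.card ι := by exact_mod_cast Finset.card_le_univ I
    have h5 : ∑ x, f x ≤ 2 ^ (Fintype.card ι) * Real.exp (- (ε ^ 2 / 2 * (η * Fintype.card ι))) :=
      h2.trans (mul_le_mul_of_nonneg_left h3 (by positivity))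
    have h6 := mul_le_mul h4 h5 hs (by positivity)
    have : 0 ≤ η * Fintype.card ι * (∑ x, f x) := by positivity
    linarith

/-- averaging over a hidden index -/
lemma bad_abstract {Ω κ : Type*} [Fintype Ω] [Fintype κ] [DecidableEq κ]
    (o : κ) (τ : κ → Equiv.Perm Ω) (h : Ω → (κ → Bool) → ℝ) (G : Ω → ℝ) (K : ℝ)
    (h0 : ∀ w x, 0 ≤ h w x) (h1 : ∀ w x, h w x ≤ 1)
    (hτ : ∀ i w x, h (τ i w) x = h w (x ∘ Equiv.swap o i))
    (hG : ∀ i w, G (τ i w) = G w) (G0 : ∀ w, 0 ≤ G w) (GK : ∀ w, G w ≤ K)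
    (ε η : ℝ) (hε : 0 < ε) (hη : 0 ≤ η) :
    ∑ w, (if ε * ∑ x, h w x < ∑ x, h w x * sgnB (x o) then (∑ x, h w x) * G w else 0) ≤
      η * ∑ w, (∑ x, h w x) * G w + Fintype.card Ω * (K *
        (2 ^ (Fintype.card κ) * Real.exp (- (ε ^ 2 / 2 * (η * Fintype.card κ))))) := by
  have hn : (0 : ℝ) < Fintype.card κ := by
    have : Nonempty κ := ⟨o⟩
    exact_mod_cast Fintype.card_pos
  set E : ℝ := 2 ^ (Fintype.card κ) * Real.exp (- (ε ^ 2 / 2 * (η * Fintype.card κ))) with hE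
  have hE0 : 0 ≤ E := by positivity
  have hH : ∀ i w (φ : Bool → ℝ), ∑ x, h (τ i w) x * φ (x o) = ∑ x, h w x * φ (x i) := by
    intro i w φ
    refine Fintype.sum_equiv (Equiv.arrowCongr (Equiv.swap o i) (Equiv.refl Bool)) _ _ ?_
    intro x
    rw [hτ]
    have e1 : (Equiv.arrowCongr (Equiv.swap o i) (Equiv.refl Bool)) x = x ∘ Equiv.swap o i := by
      ext y; simp
    rw [e1]
    simp
  have hH1 : ∀ i w, ∑ x, h (τ i w) x = ∑ x, h w x := by
    intro i w
    have := hH i w (fun _ => 1)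
    simpa using this
  set Φ : Ω → ℝ := fun w =>
    (if ε * ∑ x, h w x < ∑ x, h w x * sgnB (x o) then (∑ x, h w x) * G w else 0) with hΦ
  have key : ∀ w, ∑ i, Φ (τ i w) ≤ η * Fintype.card κ * ((∑ x, h w x) * G w) +
      Fintype.card κ * (K * E) := by
    intro w
    set I : Finset κ := Finset.univ.filter
      (fun i => ε * ∑ x, h w x < ∑ x, h w x * sgnB (x i)) with hI
    have e1 : ∑ i, Φ (τ i w) = I.card * (∑ x, h w x) * G w := by
      simp only [hΦ, hH1, hH, hG]
      rw [← Finset.sum_filter, Finset.sum_const, nsmul_eq_mul, mul_assoc]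
    have e2 := conc_card (h w) (h0 w) (h1 w) ε η hε hη I (by
      intro i hi
      rw [hI, Finset.mem_filter] at hi
      exact hi.2.le)
    rw [← hE] at e2
    have e3 := mul_le_mul_of_nonneg_right e2 (G0 w)
    have e4 := mul_le_mul_of_nonneg_left (GK w) (mul_nonneg hn.le hE0)
    rw [e1]
    nlinarith
  have tot : (Fintype.card κ : ℝ) * ∑ w, Φ w = ∑ w, ∑ i, Φ (τ i w) := by
    rw [Finset.sum_comm]
    have : ∀ i ∈ (Finset.univ : Finset κ), ∑ w, Φ (τ i w) = ∑ w, Φ w := by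
      intro i _
      exact Equiv.sum_comp (τ i) Φ
    rw [Finset.sum_congr rfl this]
    simp
  have fin := Finset.sum_le_sum (fun w (_ : w ∈ (Finset.univ : Finset Ω)) => key w)
  rw [← tot, Finset.sum_add_distrib, ← Finset.mul_sum, Finset.sum_const, nsmul_eq_mul,
    Finset.card_univ] at fin
  refine le_of_mul_le_mul_left (fin.trans (le_of_eq ?_)) hn
  ring


/-! ### The combinatorial structure -/

/-- ground set of the matching problem -/
abbrev VV (m : ℕ) := (Fin 5 × Bool) ⊕ ((Fin m × Bool) ⊕ (Fin m × Bool × Bool))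

/-- position of `i` in the `j`-th pair -/
def posP (j i : Fin 5) : Option Bool :=
  match (i - 2 * j : Fin 5) with
  | 0 => some false
  | 1 => some true
  | _ => none

/-- elements of the `j`-th pair -/
def elP (j : Fin 5) (p : Bool) : Fin 5 := 2 * j + (match p with | false => 0 | true => 1)

lemma posP_elP (j : Fin 5) (p : Bool) : posP j (elP j p) = some p := by
  fin_cases j <;> cases p <;> rfl

lemma elP_of_posP (j i : Fin 5) (p : Bool) (h : posP j i = some p) : elP j p = i := by
  revert h
  fin_cases j <;> fin_cases i <;> cases p <;> intro h <;>
    first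
    | rfl
    | (change none = some _ at h; cases h)
    | (change some true = some false at h; cases h)
    | (change some false = some true at h; cases h)

/-- the cuts -/
def cutU {m : ℕ} (j : Fin 5) (x : Option (Fin m) → Bool) : VV m → Bool
  | Sum.inl (i, false) => match posP j i with
    | none => true
    | some _ => x none
  | Sum.inl (_, true) => false
  | Sum.inr (Sum.inl (i, _)) => x (some i)
  | Sum.inr (Sum.inr _) => false

/-- the matchings, as involutions -/
def matM {m : ℕ} (j : Fin 5) (y : Option (Fin m) → Bool) : VV m → VV m
  | Sum.inl (i, s) => match posP j i with
    | none => Sum.inl (i, !s)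
    | some p => match y none with
      | true => Sum.inl (i, !s)
      | false => Sum.inl (elP j (!p), s)
  | Sum.inr (Sum.inl (i, b)) => Sum.inr (Sum.inl (i, !b))
  | Sum.inr (Sum.inr (i, p, s)) => match y (some i) with
    | true => Sum.inr (Sum.inr (i, p, !s))
    | false => Sum.inr (Sum.inr (i, !p, s))

/-- swap for cuts -/
noncomputable def tauU {m : ℕ} (j : Fin 5) (k : Fin m) : VV m → VV m
  | Sum.inl (i, false) => match posP j i with
    | none => Sum.inl (i, false)
    | some p => Sum.inr (Sum.inl (k, p))
  | Sum.inl (i, true) => Sum.inl (i, true)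
  | Sum.inr (Sum.inl (i, p)) => if i = k then Sum.inl (elP j p, false) else Sum.inr (Sum.inl (i, p))
  | Sum.inr (Sum.inr z) => Sum.inr (Sum.inr z)

/-- swap for matchings -/
noncomputable def tauM {m : ℕ} (j : Fin 5) (k : Fin m) : VV m → VV m
  | Sum.inl (i, s) => match posP j i with
    | none => Sum.inl (i, s)
    | some p => Sum.inr (Sum.inr (k, p, s))
  | Sum.inr (Sum.inl z) => Sum.inr (Sum.inl z)
  | Sum.inr (Sum.inr (i, p, s)) => if i = k then Sum.inl (elP j p, s) else Sum.inr (Sum.inr (i, p, s))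

lemma tauU_inv {m : ℕ} (j : Fin 5) (k : Fin m) : Function.Involutive (tauU j k) := by
  rintro (⟨i, _ | _⟩ | ⟨i, p⟩ | ⟨i, p, s⟩)
  · rcases h : posP j i with _ | p
    · simp [tauU, h]
    · simp [tauU, h, elP_of_posP j i p h]
  · simp [tauU]
  · by_cases h : i = k
    · simp [tauU, h, posP_elP]
    · simp [tauU, h]
  · simp [tauU]

lemma tauM_inv {m : ℕ} (j : Fin 5) (k : Fin m) : Function.Involutive (tauM j k) := by
  rintro (⟨i, s⟩ | ⟨i, p⟩ | ⟨i, p, s⟩)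
  · rcases h : posP j i with _ | p
    · simp [tauM, h]
    · simp [tauM, h, elP_of_posP j i p h]
  · simp [tauM]
  · by_cases h : i = k
    · simp [tauM, h, posP_elP]
    · simp [tauM, h]

lemma matM_inv {m : ℕ} (j : Fin 5) (y : Option (Fin m) → Bool) : Function.Involutive (matM j y) := by
  rintro (⟨i, s⟩ | ⟨i, p⟩ | ⟨i, p, s⟩)
  · rcases h : posP j i with _ | p
    · simp [matM, h]
    · rcases hy : y none with _ | _
      · simp [matM, h, hy, posP_elP, elP_of_posP j i p h]
      · simp [matM, h, hy]
  · simp [matM]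
  · rcases hy : y (some i) with _ | _ <;> simp [matM, hy]

lemma matM_ne {m : ℕ} (j : Fin 5) (y : Option (Fin m) → Bool) (v : VV m) : matM j y v ≠ v := by
  rcases v with ⟨i, s⟩ | ⟨i, p⟩ | ⟨i, p, s⟩
  · rcases h : posP j i with _ | p
    · simp [matM, h]
    · rcases hy : y none with _ | _
      · simp only [matM, h, hy]
        intro hc
        have hc : elP j (!p) = i := by simpa using hc
        rw [← hc, posP_elP] at h
        simp at h
      · simp [matM, h, hy]
  · simp [matM]
  · rcases hy : y (some i) with _ | _ <;> simp [matM, hy]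

lemma cutU_tauU {m : ℕ} (j : Fin 5) (k : Fin m) (x : Option (Fin m) → Bool) (v : VV m) :
    cutU j x (tauU j k v) = cutU j (x ∘ Equiv.swap none (some k)) v := by
  rcases v with ⟨i, _ | _⟩ | ⟨i, p⟩ | ⟨i, p, s⟩
  · rcases h : posP j i with _ | p
    · simp [tauU, cutU, h]
    · simp [tauU, cutU, h]
  · simp [tauU, cutU]
  · by_cases h : i = k
    · simp [tauU, cutU, h, posP_elP]
    · have : Equiv.swap none (some k) (some i) = some i :=
        Equiv.swap_apply_of_ne_of_ne (by simp) (by simpa using h)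
      simp [tauU, cutU, h, this]
  · simp [tauU, cutU]

lemma cutU_tauM {m : ℕ} (j : Fin 5) (k : Fin m) (x : Option (Fin m) → Bool) (hx : x none = false)
    (v : VV m) : cutU j x (tauM j k v) = cutU j x v := by
  rcases v with ⟨i, _ | _⟩ | ⟨i, p⟩ | ⟨i, p, s⟩
  · rcases h : posP j i with _ | p
    · simp [tauM, cutU, h]
    · simp [tauM, cutU, h, hx]
  · rcases h : posP j i with _ | p
    · simp [tauM, cutU, h]
    · simp [tauM, cutU, h]
  · simp [tauM, cutU]
  · by_cases h : i = k
    · rcases s with _ | _ <;> simp [tauM, cutU, h, posP_elP, hx]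
    · simp [tauM, cutU, h]

lemma matM_tauU {m : ℕ} (j : Fin 5) (k : Fin m) (y : Option (Fin m) → Bool) (hy : y none = false)
    (v : VV m) : tauU j k (matM j y (tauU j k v)) = matM j y v := by
  rcases v with ⟨i, _ | _⟩ | ⟨i, p⟩ | ⟨i, p, s⟩
  · rcases h : posP j i with _ | p
    · simp [tauU, matM, h]
    · simp [tauU, matM, h, hy]
  · rcases h : posP j i with _ | p
    · simp [tauU, matM, h]
    · simp [tauU, matM, h, hy]
  · by_cases h : i = k
    · simp [tauU, matM, h, posP_elP, hy]
    · simp [tauU, matM, h]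
  · rcases hy : y (some i) with _ | _ <;> simp [tauU, matM, hy]

lemma matM_tauM {m : ℕ} (j : Fin 5) (k : Fin m) (y : Option (Fin m) → Bool)
    (v : VV m) : tauM j k (matM j y (tauM j k v)) = matM j (y ∘ Equiv.swap none (some k)) v := by
  rcases v with ⟨i, s⟩ | ⟨i, p⟩ | ⟨i, p, s⟩
  · rcases h : posP j i with _ | p
    · simp [tauM, matM, h]
    · rcases hy : y (some k) with _ | _ <;> simp [tauM, matM, h, hy, elP_of_posP j i p h]
  · simp [tauM, matM]
  · by_cases h : i = k
    · rcases hy : y none with _ | _ <;> simp [tauM, matM, h, posP_elP, hy]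
    · have : Equiv.swap none (some k) (some i) = some i :=
        Equiv.swap_apply_of_ne_of_ne (by simp) (by simpa using h)
      rcases hy : y (some i) with _ | _ <;> simp [tauM, matM, h, hy, this]

/-- number of crossing edges -/
def crossN {V : Type*} [Fintype V] (U : V → Bool) (M : V → V) : ℕ :=
  ∑ v, (U v && !U (M v)).toNat

lemma crossN_conj {V : Type*} [Fintype V] (U : V → Bool) (M : V → V) (σ : Equiv.Perm V) :
    crossN (U ∘ σ) (σ.symm ∘ M ∘ σ) = crossN U M := by
  unfold crossN
  simp only [Function.comp, Equiv.apply_symm_apply]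
  exact Equiv.sum_comp σ (fun v => (U v && !U (M v)).toNat)

lemma crossN_five {m : ℕ} (j j' : Fin 5) (x y : Option (Fin m) → Bool) :
    crossN (cutU j x) (matM j' y) = ∑ i : Fin 5,
      (cutU j x (Sum.inl (i, false)) && !cutU j x (matM j' y (Sum.inl (i, false)))).toNat := by
  unfold crossN
  rw [Fintype.sum_sum_type, Fintype.sum_sum_type, Fintype.sum_prod_type]
  simp [cutU, matM]

lemma crossN_five' {m : ℕ} (j j' : Fin 5) (x y : Option (Fin m) → Bool) :
    crossN (cutU j x) (matM j' y) = ∑ i : Fin 5,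
      (cutU (m := 0) j (fun _ => x none) (Sum.inl (i, false)) &&
        !cutU (m := 0) j (fun _ => x none) (matM j' (fun _ => y none) (Sum.inl (i, false)))).toNat := by
  rw [crossN_five]
  refine Finset.sum_congr rfl (fun i _ => ?_)
  rcases h : posP j' i with _ | p <;> rcases hy : y none with _ | _ <;> simp [cutU, matM, h, hy]

lemma crossN_same {m : ℕ} (j : Fin 5) (x y : Option (Fin m) → Bool) :
    crossN (cutU j x) (matM j y) = 3 + 2 * (x none && y none).toNat := by
  rw [crossN_five']
  rcases hx : x none with _ | _ <;> rcases hy : y none with _ | _ <;>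
  fin_cases j <;> rfl

lemma crossN_next {m : ℕ} (j : Fin 5) (x y : Option (Fin m) → Bool) (hx : x none = false)
    (hy : y none = false) :
    crossN (cutU j x) (matM (j + 1) y) = 1 := by
  rw [crossN_five', hx, hy]
  fin_cases j <;> rfl

lemma cutU_true {m : ℕ} (j j' : Fin 5) (x : Option (Fin m) → Bool) (hx : x none = true) :
    cutU j x = cutU j' x := by
  funext v
  rcases v with ⟨i, _ | _⟩ | ⟨i, p⟩ | ⟨i, p, s⟩
  · rcases h : posP j i with _ | p <;> rcases h' : posP j' i with _ | p' <;> simp [cutU, h, h', hx]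
  all_goals simp [cutU]

lemma matM_true {m : ℕ} (j j' : Fin 5) (x : Option (Fin m) → Bool) (hx : x none = true) :
    matM j x = matM j' x := by
  funext v
  rcases v with ⟨i, s⟩ | ⟨i, p⟩ | ⟨i, p, s⟩
  · rcases h : posP j i with _ | p <;> rcases h' : posP j' i with _ | p' <;> simp [matM, h, h', hx]
  all_goals simp [matM]


/-! ### The main rectangle estimate -/

lemma five_sum (t : Fin 5 → ℝ) (T : ℝ) (h0 : ∀ j, 0 ≤ t j) (hT : ∀ j, t j ≤ T)
    (h : ∀ j, t j = 0 ∨ t (j + 1) = 0) : ∑ j, t j ≤ 2 * T := by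
  have h1 := h 0
  have h2 := h 1
  have h3 := h 2
  have h4 := h 3
  have h5 := h 4
  rw [show (0 : Fin 5) + 1 = 1 from rfl] at h1
  rw [show (1 : Fin 5) + 1 = 2 from rfl] at h2
  rw [show (2 : Fin 5) + 1 = 3 from rfl] at h3
  rw [show (3 : Fin 5) + 1 = 4 from rfl] at h4
  rw [show (4 : Fin 5) + 1 = 0 from rfl] at h5
  have a0 := hT 0
  have a1 := hT 1
  have a2 := hT 2
  have a3 := hT 3
  have a4 := hT 4
  have b0 := h0 0
  rw [Fin.sum_univ_five]
  rcases h1 with h1 | h1 <;> rcases h2 with h2 | h2 <;> rcases h3 with h3 | h3 <;>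
    rcases h4 with h4 | h4 <;> rcases h5 with h5 | h5 <;> linarith

/-- partial sum with prescribed hidden bit -/
noncomputable def part {κ : Type*} [Fintype κ] [DecidableEq κ] (h : (Option κ → Bool) → ℝ) (b : Bool) : ℝ :=
  ∑ x, if x none = b then h x else 0

lemma part_nonneg {κ : Type*} [Fintype κ] [DecidableEq κ] (h : (Option κ → Bool) → ℝ) (h0 : ∀ x, 0 ≤ h x)
    (b : Bool) : 0 ≤ part h b := by
  refine Finset.sum_nonneg (fun x _ => ?_)
  split_ifs
  · exact h0 x
  · exact le_rfl

lemma sum_eq_part {κ : Type*} [Fintype κ] [DecidableEq κ] (h : (Option κ → Bool) → ℝ) :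
    ∑ x, h x = part h false + part h true := by
  unfold part
  rw [← Finset.sum_add_distrib]
  refine Finset.sum_congr rfl (fun x _ => ?_)
  rcases hx : x none with _ | _ <;> simp

lemma sum_sgn_eq_part {κ : Type*} [Fintype κ] [DecidableEq κ] (h : (Option κ → Bool) → ℝ) :
    ∑ x, h x * sgnB (x none) = part h false - part h true := by
  unfold part
  rw [← Finset.sum_sub_distrib]
  refine Finset.sum_congr rfl (fun x _ => ?_)
  rcases hx : x none with _ | _ <;> simp [sgnB]

lemma part_one {κ : Type*} [Fintype κ] [DecidableEq κ] (b : Bool) :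
    part (fun _ : Option κ → Bool => (1 : ℝ)) b = 2 ^ (Fintype.card κ) := by
  unfold part
  have := Fintype.sum_equiv (Equiv.piOptionEquivProd (β := fun _ : Option κ => Bool))
    (fun x => if x none = b then (1 : ℝ) else 0)
    (fun z => if z.1 = b then (1 : ℝ) else 0) (fun x => rfl)
  rw [this, Fintype.sum_prod_type]
  cases b <;> simp

lemma sum_sum_part {κ : Type*} [Fintype κ] [DecidableEq κ] (p q : (Option κ → Bool) → ℝ) (w : Bool → Bool → ℝ) :
    ∑ x, ∑ y, w (x none) (y none) * (p x * q y) =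
      w false false * (part p false * part q false) + w true false * (part p true * part q false) +
      w false true * (part p false * part q true) + w true true * (part p true * part q true) := by
  have h1 : ∀ b b' : Bool, part p b * part q b' =
      ∑ x : Option κ → Bool, ∑ y : Option κ → Bool, (if x none = b then p x else 0) * (if y none = b' then q y else 0) := by
    intro b b'
    exact Finset.sum_mul_sum (Finset.univ : Finset (Option κ → Bool)) Finset.univ
      (fun x => if x none = b then p x else 0) (fun y => if y none = b' then q y else 0)
  simp only [h1, Finset.mul_sum, ← Finset.sum_add_distrib]
  refine Finset.sum_congr rfl (fun x _ => Finset.sum_congr rfl (fun y _ => ?_))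
  rcases hx : x none with _ | _ <;> rcases hy : y none with _ | _ <;> simp

lemma part_le {κ : Type*} [Fintype κ] [DecidableEq κ] (h : (Option κ → Bool) → ℝ) (h0 : ∀ x, 0 ≤ h x)
    (h1 : ∀ x, h x ≤ 1) (b : Bool) : part h b ≤ 2 ^ (Fintype.card (Option κ)) := by
  have : part h b ≤ ∑ x : Option κ → Bool, (1 : ℝ) := by
    refine Finset.sum_le_sum (fun x _ => ?_)
    split_ifs
    · exact h1 x
    · norm_num
  simpa using this

noncomputable instance permVVFintype (m : ℕ) : Fintype (Equiv.Perm (VV m)) := Fintype.ofFinite _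

/-- lifted function of cuts -/
def hU {m : ℕ} (f : (VV m → Bool) → ℝ) (j : Fin 5) (σ : Equiv.Perm (VV m))
    (x : Option (Fin m) → Bool) : ℝ := f (cutU j x ∘ σ)

/-- lifted function of matchings -/
def hM {m : ℕ} (g : (VV m → VV m) → ℝ) (j : Fin 5) (σ : Equiv.Perm (VV m))
    (y : Option (Fin m) → Bool) : ℝ := g (σ.symm ∘ matM j y ∘ σ)

/-- permutations used in the cut averaging -/
noncomputable def tU {m : ℕ} (j : Fin 5) : Option (Fin m) → Equiv.Perm (Equiv.Perm (VV m))
  | none => Equiv.refl _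
  | some k => Equiv.mulLeft ((tauU_inv j k).toPerm)

/-- permutations used in the matching averaging -/
noncomputable def tM {m : ℕ} (j : Fin 5) : Option (Fin m) → Equiv.Perm (Equiv.Perm (VV m))
  | none => Equiv.refl _
  | some k => Equiv.mulLeft ((tauM_inv j k).toPerm)

lemma hU_tU {m : ℕ} (f : (VV m → Bool) → ℝ) (j : Fin 5) (i : Option (Fin m))
    (σ : Equiv.Perm (VV m)) (x : Option (Fin m) → Bool) :
    hU f j (tU j i σ) x = hU f j σ (x ∘ Equiv.swap none i) := by
  rcases i with _ | k
  · simp [tU]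
  · unfold hU
    congr 1
    funext v
    simp only [tU, Function.comp, Equiv.coe_mulLeft, Equiv.Perm.coe_mul,
      Function.Involutive.coe_toPerm]
    exact cutU_tauU j k x (σ v)

lemma hM_tM {m : ℕ} (g : (VV m → VV m) → ℝ) (j : Fin 5) (i : Option (Fin m))
    (σ : Equiv.Perm (VV m)) (x : Option (Fin m) → Bool) :
    hM g j (tM j i σ) x = hM g j σ (x ∘ Equiv.swap none i) := by
  rcases i with _ | k
  · simp [tM]
  · unfold hM
    congr 1
    funext v
    exact congrArg σ.symm (matM_tauM j k x (σ v))

lemma hU_tM {m : ℕ} (f : (VV m → Bool) → ℝ) (j : Fin 5) (i : Option (Fin m))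
    (σ : Equiv.Perm (VV m)) :
    part (hU f j (tM j i σ)) false = part (hU f j σ) false := by
  rcases i with _ | k
  · simp [tM]
  · unfold part
    refine Finset.sum_congr rfl (fun x _ => ?_)
    split_ifs with hx
    · unfold hU
      congr 1
      funext v
      exact cutU_tauM j k x hx (σ v)
    · rfl

lemma hM_tU {m : ℕ} (g : (VV m → VV m) → ℝ) (j : Fin 5) (i : Option (Fin m))
    (σ : Equiv.Perm (VV m)) :
    part (hM g j (tU j i σ)) false = part (hM g j σ) false := by
  rcases i with _ | k
  · simp [tU]
  · unfold part
    refine Finset.sum_congr rfl (fun x _ => ?_)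
    split_ifs with hx
    · unfold hM
      congr 1
      funext v
      exact congrArg σ.symm (matM_tauU j k x hx (σ v))
    · rfl

lemma part_ne_zero {κ : Type*} [Fintype κ] [DecidableEq κ] (h : (Option κ → Bool) → ℝ) (b : Bool)
    (hp : part h b ≠ 0) : ∃ x, x none = b ∧ h x ≠ 0 := by
  by_contra hcon
  push Not at hcon
  apply hp
  refine Finset.sum_eq_zero (fun x _ => ?_)
  split_ifs with hx
  · exact hcon x hx
  · rfl

/-- error term -/
noncomputable def errT (m : ℕ) : ℝ :=
  (2 : ℝ) ^ (m + 1) * (2 ^ (m + 1) * Real.exp (- ((1 / 21) ^ 2 / 2 * ((1 / 250) * ((m : ℝ) + 1)))))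

lemma main_rect {m : ℕ} (f : (VV m → Bool) → ℝ) (g : (VV m → VV m) → ℝ)
    (f0 : ∀ U, 0 ≤ f U) (f1 : ∀ U, f U ≤ 1) (g0 : ∀ M, 0 ≤ g M) (g1 : ∀ M, g M ≤ 1)
    (hz : ∀ U M, crossN U M = 1 → f U * g M = 0) :
    ∑ σ : Equiv.Perm (VV m), ∑ j : Fin 5, part (hU f j σ) false * part (hM g j σ) false ≤
      ∑ σ : Equiv.Perm (VV m), ∑ j : Fin 5,
        ((1 / 250) * ((part (hU f j σ) false + part (hU f j σ) true) * part (hM g j σ) false) +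
         (1 / 250) * ((part (hM g j σ) false + part (hM g j σ) true) * part (hU f j σ) false) +
         (121 / 250) * (part (hU f j σ) true * part (hM g j σ) true)) +
      10 * (Fintype.card (Equiv.Perm (VV m)) * errT m) := by
  set ε : ℝ := 1 / 21 with hε
  set F : Bool → Fin 5 → Equiv.Perm (VV m) → ℝ := fun b j σ => part (hU f j σ) b with hF
  set G : Bool → Fin 5 → Equiv.Perm (VV m) → ℝ := fun b j σ => part (hM g j σ) b with hG
  have F0 : ∀ b j σ, 0 ≤ F b j σ := fun b j σ => part_nonneg _ (fun x => f0 _) b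
  have G0 : ∀ b j σ, 0 ≤ G b j σ := fun b j σ => part_nonneg _ (fun x => g0 _) b
  have hcard : (Fintype.card (Option (Fin m)) : ℝ) = (m : ℝ) + 1 := by simp
  -- bad cuts
  have badU : ∀ j, ∑ σ, (if ε * (F false j σ + F true j σ) < F false j σ - F true j σ then
      (F false j σ + F true j σ) * G false j σ else 0) ≤
      (1 / 250) * ∑ σ, (F false j σ + F true j σ) * G false j σ +
        Fintype.card (Equiv.Perm (VV m)) * errT m := by
    intro j
    have := bad_abstract (none : Option (Fin m)) (tU j) (hU f j) (G false j)
      (2 ^ (Fintype.card (Option (Fin m)))) (fun _ _ => f0 _) (fun _ _ => f1 _)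
      (fun i w x => hU_tU f j i w x) (fun i w => hM_tU g j i w) (G0 false j)
      (fun w => part_le _ (fun _ => g0 _) (fun _ => g1 _) _) ε (1 / 250) (by norm_num [hε])
      (by norm_num)
    simp only [sum_sgn_eq_part] at this
    simp only [sum_eq_part, hcard] at this
    simpa [errT, hF, hε] using this
  have badM : ∀ j, ∑ σ, (if ε * (G false j σ + G true j σ) < G false j σ - G true j σ then
      (G false j σ + G true j σ) * F false j σ else 0) ≤
      (1 / 250) * ∑ σ, (G false j σ + G true j σ) * F false j σ +
        Fintype.card (Equiv.Perm (VV m)) * errT m := by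
    intro j
    have := bad_abstract (none : Option (Fin m)) (tM j) (hM g j) (F false j)
      (2 ^ (Fintype.card (Option (Fin m)))) (fun _ _ => g0 _) (fun _ _ => g1 _)
      (fun i w x => hM_tM g j i w x) (fun i w => hU_tM f j i w) (F0 false j)
      (fun w => part_le _ (fun _ => f0 _) (fun _ => f1 _) _) ε (1 / 250) (by norm_num [hε])
      (by norm_num)
    simp only [sum_sgn_eq_part] at this
    simp only [sum_eq_part, hcard] at this
    simpa [errT, hG, hε] using this
  -- good part
  set t : Equiv.Perm (VV m) → Fin 5 → ℝ := fun σ j =>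
    if ε * (F false j σ + F true j σ) < F false j σ - F true j σ then 0 else
    if ε * (G false j σ + G true j σ) < G false j σ - G true j σ then 0 else
      F false j σ * G false j σ with ht
  have good : ∀ σ, ∑ j, t σ j ≤ ∑ j, (121 / 250) * (F true j σ * G true j σ) := by
    intro σ
    have hFj : ∀ j, F true j σ = F true 0 σ := by
      intro j
      refine Finset.sum_congr rfl (fun x _ => ?_)
      split_ifs with hx
      · simp only [hU, cutU_true j 0 x hx]
      · rfl
    have hGj : ∀ j, G true j σ = G true 0 σ := by
      intro j
      refine Finset.sum_congr rfl (fun x _ => ?_)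
      split_ifs with hx
      · simp only [hM, matM_true j 0 x hx]
      · rfl
    have e1 : ∑ j : Fin 5, (121 / 250) * (F true j σ * G true j σ) =
        2 * ((121 / 100) * (F true 0 σ * G true 0 σ)) := by
      simp only [hFj, hGj]
      simp
      ring
    rw [e1]
    apply five_sum
    · intro j
      simp only [ht]
      split_ifs
      · exact le_rfl
      · exact le_rfl
      · exact mul_nonneg (F0 _ _ _) (G0 _ _ _)
    · intro j
      have hp := mul_nonneg (F0 true 0 σ) (G0 true 0 σ)
      simp only [ht]
      split_ifs with h1 h2
      · linarith
      · linarith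
      · push Not at h1 h2
        rw [hFj, hε] at h1
        rw [hGj, hε] at h2
        have h3 : F false j σ ≤ 11 / 10 * F true 0 σ := by linarith
        have h4 : G false j σ ≤ 11 / 10 * G true 0 σ := by linarith
        have := mul_le_mul h3 h4 (G0 _ _ _) (by have := F0 true 0 σ; positivity)
        linarith
    · intro j
      by_contra hcon
      push Not at hcon
      have c1 : F false j σ ≠ 0 := by
        intro h0; apply hcon.1; simp [ht, h0]
      have c2 : G false (j + 1) σ ≠ 0 := by
        intro h0; apply hcon.2; simp [ht, h0]
      obtain ⟨x, hx, hx'⟩ := part_ne_zero _ _ c1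
      obtain ⟨y, hy, hy'⟩ := part_ne_zero _ _ c2
      have := hz (cutU j x ∘ σ) (σ.symm ∘ matM (j + 1) y ∘ σ)
        (by rw [crossN_conj, crossN_next j x y hx hy])
      rcases mul_eq_zero.1 this with h | h
      · exact hx' h
      · exact hy' h
  -- pointwise
  have pw : ∀ σ j, F false j σ * G false j σ ≤
      (if ε * (F false j σ + F true j σ) < F false j σ - F true j σ then
        (F false j σ + F true j σ) * G false j σ else 0) +
      (if ε * (G false j σ + G true j σ) < G false j σ - G true j σ then
        (G false j σ + G true j σ) * F false j σ else 0) + t σ j := by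
    intro σ j
    have p1 := mul_nonneg (F0 true j σ) (G0 false j σ)
    have p2 := mul_nonneg (F0 false j σ) (G0 true j σ)
    have p3 := mul_nonneg (F0 false j σ) (G0 false j σ)
    simp only [ht]
    split_ifs <;> nlinarith
  have tot := Finset.sum_le_sum (fun σ (_ : σ ∈ (Finset.univ : Finset (Equiv.Perm (VV m)))) =>
    Finset.sum_le_sum (fun j (_ : j ∈ (Finset.univ : Finset (Fin 5))) => pw σ j))
  refine tot.trans ?_
  simp only [Finset.sum_add_distrib]
  have good' := Finset.sum_le_sum (fun σ (_ : σ ∈ (Finset.univ : Finset (Equiv.Perm (VV m)))) => good σ)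
  have bU := Finset.sum_le_sum (fun j (_ : j ∈ (Finset.univ : Finset (Fin 5))) => badU j)
  have bM := Finset.sum_le_sum (fun j (_ : j ∈ (Finset.univ : Finset (Fin 5))) => badM j)
  rw [Finset.sum_comm, Finset.sum_add_distrib, ← Finset.mul_sum, Finset.sum_comm (γ := Fin 5)] at bU bM
  simp only [Finset.sum_const, Finset.card_univ, Fintype.card_fin, nsmul_eq_mul] at bU bM
  simp only [← Finset.mul_sum] at good' ⊢
  push_cast at bU bM
  linarith


/-! ### Rank lower bound -/

/-- weights -/
noncomputable def wt : Bool → Bool → ℝ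
  | false, false => 248 / 250
  | true, false => -1 / 250
  | false, true => -1 / 250
  | true, true => -121 / 250

lemma errT_pos (m : ℕ) : 0 < errT m := by
  unfold errT; positivity

lemma rect_one {m : ℕ} (f : (VV m → Bool) → ℝ) (g : (VV m → VV m) → ℝ)
    (f0 : ∀ U, 0 ≤ f U) (f1 : ∀ U, f U ≤ 1) (g0 : ∀ M, 0 ≤ g M) (g1 : ∀ M, g M ≤ 1)
    (hz : ∀ U M, crossN U M = 1 → f U * g M = 0) :
    ∑ σ : Equiv.Perm (VV m), ∑ j : Fin 5, ∑ x : Option (Fin m) → Bool, ∑ y : Option (Fin m) → Bool,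
      wt (x none) (y none) * (hU f j σ x * hM g j σ y) ≤
      10 * (Fintype.card (Equiv.Perm (VV m)) * errT m) := by
  have h := main_rect f g f0 f1 g0 g1 hz
  rw [← sub_le_iff_le_add', ← Finset.sum_sub_distrib] at h
  refine le_trans (le_of_eq ?_) h
  refine Finset.sum_congr rfl (fun σ _ => ?_)
  rw [← Finset.sum_sub_distrib]
  refine Finset.sum_congr rfl (fun j _ => ?_)
  rw [sum_sum_part]
  simp only [wt]
  ring

lemma rect_scaled {m : ℕ} (f : (VV m → Bool) → ℝ) (g : (VV m → VV m) → ℝ) (L : ℝ)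
    (f0 : ∀ U, 0 ≤ f U) (g0 : ∀ M, 0 ≤ g M) (hL : ∀ U M, f U * g M ≤ L)
    (hz : ∀ U M, crossN U M = 1 → f U * g M = 0) :
    ∑ σ : Equiv.Perm (VV m), ∑ j : Fin 5, ∑ x : Option (Fin m) → Bool, ∑ y : Option (Fin m) → Bool,
      wt (x none) (y none) * (hU f j σ x * hM g j σ y) ≤
      L * (10 * (Fintype.card (Equiv.Perm (VV m)) * errT m)) := by
  have hE : 0 ≤ 10 * (Fintype.card (Equiv.Perm (VV m)) * errT m) := by
    have := (errT_pos m).le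
    positivity
  obtain ⟨U0, hU0⟩ := Finite.exists_max f
  obtain ⟨M0, hM0⟩ := Finite.exists_max g
  by_cases ha : f U0 * g M0 = 0
  · have hall : ∀ U M, f U * g M = 0 := by
      intro U M
      refine le_antisymm ?_ (mul_nonneg (f0 _) (g0 _))
      rw [← ha]
      exact mul_le_mul (hU0 U) (hM0 M) (g0 _) (f0 _)
    have hL0 : 0 ≤ L := ha ▸ hL U0 M0
    simp only [hU, hM, hall]
    simp only [mul_zero, Finset.sum_const_zero]
    positivity
  · have hfa : 0 < f U0 := lt_of_le_of_ne (f0 _) (fun h => ha (by rw [← h, zero_mul]))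
    have hgb : 0 < g M0 := lt_of_le_of_ne (g0 _) (fun h => ha (by rw [← h, mul_zero]))
    have h := rect_one (fun U => f U / f U0) (fun M => g M / g M0)
      (fun U => div_nonneg (f0 _) hfa.le) (fun U => (div_le_one hfa).2 (hU0 U))
      (fun M => div_nonneg (g0 _) hgb.le) (fun M => (div_le_one hgb).2 (hM0 M))
      (fun U M hc => by
        have := hz U M hc
        rw [div_mul_div_comm, this, zero_div])
    have h2 := mul_le_mul_of_nonneg_left h (mul_pos hfa hgb).le
    have h3 := h2.trans (mul_le_mul_of_nonneg_right (hL U0 M0) hE)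
    refine le_trans (le_of_eq ?_) h3
    simp only [Finset.mul_sum]
    refine Finset.sum_congr rfl (fun σ _ => Finset.sum_congr rfl (fun j _ =>
      Finset.sum_congr rfl (fun x _ => Finset.sum_congr rfl (fun y _ => ?_))))
    simp only [hU, hM]
    field_simp

/-- odd cuts -/
def OddCut {V : Type*} [Fintype V] (U : V → Bool) : Prop := Odd (∑ v, (U v).toNat)

/-- perfect matchings -/
def PerfM {V : Type*} (M : V → V) : Prop := Function.Involutive M ∧ ∀ v, M v ≠ v

lemma oddCut_cutU {m : ℕ} (j : Fin 5) (x : Option (Fin m) → Bool) (σ : Equiv.Perm (VV m)) :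
    OddCut (cutU j x ∘ σ) := by
  unfold OddCut
  have h := Equiv.sum_comp σ (fun v => (cutU j x v).toNat)
  simp only [Function.comp]
  rw [h, Fintype.sum_sum_type, Fintype.sum_sum_type, Fintype.sum_prod_type, Fintype.sum_prod_type]
  have h1 : ∀ i : Fin 5, ∑ b : Bool, (cutU j x (Sum.inl (i, b))).toNat =
      (cutU (m := 0) j (fun _ => x none) (Sum.inl (i, false))).toNat := by
    intro i
    rcases h : posP j i with _ | p <;> simp [cutU, h]
  have h2 : ∑ i : Fin 5, (cutU (m := 0) j (fun _ => x none) (Sum.inl (i, false))).toNat =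
      3 + 2 * (x none).toNat := by
    rcases hx : x none with _ | _ <;> fin_cases j <;> rfl
  simp only [h1]
  rw [h2]
  have h3 : ∀ i : Fin m, ∑ b : Bool, (cutU j x (Sum.inr (Sum.inl (i, b)))).toNat =
      2 * (x (some i)).toNat := by
    intro i
    simp [cutU]
  have h4 : ∀ z, cutU j x (Sum.inr (Sum.inr z)) = false := fun z => by simp [cutU]
  simp only [h3, h4, ← Finset.mul_sum]
  simp
  rw [add_assoc, ← mul_add]
  exact Odd.add_even ⟨1, by norm_num⟩ (even_two_mul _)

lemma perfM_matM {m : ℕ} (j : Fin 5) (y : Option (Fin m) → Bool) (σ : Equiv.Perm (VV m)) :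
    PerfM (σ.symm ∘ matM j y ∘ σ) := by
  constructor
  · intro v
    simp [Function.comp, matM_inv j y (σ v)]
  · intro v h
    have h' : matM j y (σ v) = σ v := by
      simpa [Equiv.symm_apply_eq] using h
    exact matM_ne j y (σ v) h'

lemma crossN_le {m : ℕ} (U : VV m → Bool) (M : VV m → VV m) : crossN U M ≤ 6 * m + 10 := by
  have : crossN U M ≤ ∑ v : VV m, 1 := by
    refine Finset.sum_le_sum (fun v _ => ?_)
    exact Bool.toNat_le _
  refine this.trans (le_of_eq ?_)
  simp
  ring

lemma rank_bound {m : ℕ} {R : Type*} [Fintype R] (f : R → (VV m → Bool) → ℝ)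
    (g : R → (VV m → VV m) → ℝ) (f0 : ∀ r U, OddCut U → 0 ≤ f r U) (g0 : ∀ r M, PerfM M → 0 ≤ g r M)
    (hS : ∀ U M, OddCut U → PerfM M → ∑ r, f r U * g r M = (crossN U M : ℝ) - 1) :
    Real.exp (1 / 220500 * ((m : ℝ) + 1)) ≤ 250 * (6 * m + 10) * Fintype.card R := by
  set f' : R → (VV m → Bool) → ℝ := fun r U => if OddCut U then f r U else 0 with hf'
  set g' : R → (VV m → VV m) → ℝ := fun r M => if PerfM M then g r M else 0 with hg'
  have f0' : ∀ r U, 0 ≤ f' r U := by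
    intro r U
    simp only [hf']
    split_ifs with h
    · exact f0 r U h
    · exact le_rfl
  have g0' : ∀ r M, 0 ≤ g' r M := by
    intro r M
    simp only [hg']
    split_ifs with h
    · exact g0 r M h
    · exact le_rfl
  have hS' : ∀ U M, OddCut U → PerfM M → ∑ r, f' r U * g' r M = (crossN U M : ℝ) - 1 := by
    intro U M h1 h2
    rw [← hS U M h1 h2]
    simp [hf', hg', h1, h2]
  have hle : ∀ r U M, OddCut U → PerfM M → f' r U * g' r M ≤ (crossN U M : ℝ) - 1 := by
    intro r U M h1 h2
    rw [← hS' U M h1 h2]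
    exact Finset.single_le_sum (f := fun r => f' r U * g' r M)
      (fun r _ => mul_nonneg (f0' r U) (g0' r M)) (Finset.mem_univ r)
  have hinv : ∀ r U M, ¬ (OddCut U ∧ PerfM M) → f' r U * g' r M = 0 := by
    intro r U M h
    simp only [hf', hg']
    by_cases h1 : OddCut U
    · have h2 : ¬ PerfM M := fun h2 => h ⟨h1, h2⟩
      simp [h2]
    · simp [h1]
  have each : ∀ r, _ := fun r => rect_scaled (f' r) (g' r) (6 * m + 10) (f0' r) (g0' r)
    (by
      intro U M
      by_cases h : OddCut U ∧ PerfM M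
      · have h1 := hle r U M h.1 h.2
        have h2 : (crossN U M : ℝ) ≤ 6 * m + 10 := by exact_mod_cast crossN_le U M
        linarith
      · rw [hinv r U M h]; positivity)
    (by
      intro U M hc
      by_cases h : OddCut U ∧ PerfM M
      · have h1 := hle r U M h.1 h.2
        rw [hc] at h1
        have := mul_nonneg (f0' r U) (g0' r M)
        push_cast at h1
        linarith
      · exact hinv r U M h)
  have tot := Finset.sum_le_sum (fun r (_ : r ∈ (Finset.univ : Finset R)) => each r)
  have val : ∑ r, ∑ σ : Equiv.Perm (VV m), ∑ j : Fin 5, ∑ x : Option (Fin m) → Bool,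
      ∑ y : Option (Fin m) → Bool, wt (x none) (y none) * (hU (f' r) j σ x * hM (g' r) j σ y) =
      Fintype.card (Equiv.Perm (VV m)) * (5 * (8 / 250 * (2 ^ m * 2 ^ m))) := by
    rw [Finset.sum_comm]
    have : ∀ σ ∈ (Finset.univ : Finset (Equiv.Perm (VV m))), ∑ r, ∑ j : Fin 5,
        ∑ x : Option (Fin m) → Bool, ∑ y : Option (Fin m) → Bool,
        wt (x none) (y none) * (hU (f' r) j σ x * hM (g' r) j σ y) =
        (5 * (8 / 250 * (2 ^ m * 2 ^ m))) := by
      intro σ _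
      rw [Finset.sum_comm]
      have : ∀ j ∈ (Finset.univ : Finset (Fin 5)), ∑ r,
          ∑ x : Option (Fin m) → Bool, ∑ y : Option (Fin m) → Bool,
          wt (x none) (y none) * (hU (f' r) j σ x * hM (g' r) j σ y) =
          ((8 / 250 * (2 ^ m * 2 ^ m))) := by
        intro j _
        have e1 : ∑ r, ∑ x : Option (Fin m) → Bool, ∑ y : Option (Fin m) → Bool,
          wt (x none) (y none) * (hU (f' r) j σ x * hM (g' r) j σ y) =
          ∑ x : Option (Fin m) → Bool, ∑ y : Option (Fin m) → Bool,
          (fun b b' : Bool => wt b b' * (2 + 2 * ((b && b').toNat : ℝ))) (x none) (y none) *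
            ((fun _ => (1 : ℝ)) x * (fun _ => (1 : ℝ)) y) := by
          rw [Finset.sum_comm]
          refine Finset.sum_congr rfl (fun x _ => ?_)
          rw [Finset.sum_comm]
          refine Finset.sum_congr rfl (fun y _ => ?_)
          rw [← Finset.mul_sum]
          have := hS' (cutU j x ∘ σ) (σ.symm ∘ matM j y ∘ σ) (oddCut_cutU j x σ) (perfM_matM j y σ)
          simp only [hU, hM]
          rw [this, crossN_conj, crossN_same]
          push_cast
          ring
        rw [e1]
        refine (sum_sum_part (fun _ : Option (Fin m) → Bool => (1 : ℝ)) (fun _ => (1 : ℝ))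
          (fun b b' : Bool => wt b b' * (2 + 2 * ((b && b').toNat : ℝ)))).trans ?_
        simp only [part_one, Fintype.card_fin, wt]
        simp
        ring
      rw [Finset.sum_congr rfl this]
      simp
    rw [Finset.sum_congr rfl this]
    simp
  rw [val] at tot
  simp only [Finset.sum_const, Finset.card_univ, nsmul_eq_mul] at tot
  have hP : (0 : ℝ) < Fintype.card (Equiv.Perm (VV m)) := by exact_mod_cast Fintype.card_pos
  have tot2 : (5 * (8 / 250 * (2 ^ m * 2 ^ m)) : ℝ) ≤
      Fintype.card R * ((6 * m + 10) * (10 * errT m)) := by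
    refine le_of_mul_le_mul_left (tot.trans (le_of_eq ?_)) hP
    ring
  unfold errT at tot2
  rw [show ((1 / 21 : ℝ) ^ 2 / 2 * ((1 / 250) * ((m : ℝ) + 1))) = 1 / 220500 * ((m : ℝ) + 1) by ring,
    Real.exp_neg] at tot2
  set X := Real.exp (1 / 220500 * ((m : ℝ) + 1)) with hX
  have hXp : 0 < X := Real.exp_pos _
  have h4 : (0 : ℝ) < 2 ^ m * 2 ^ m * (4 / 25) := by positivity
  refine le_of_mul_le_mul_left ?_ h4
  have := mul_le_mul_of_nonneg_right tot2 hXp.le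
  calc _ = 5 * (8 / 250 * (2 ^ m * 2 ^ m)) * X := by ring
    _ ≤ _ := this
    _ = _ := by
      field_simp
      ring


/-! ### Two-matchings -/

/-- coordinate of the edge `vw` as a linear functional -/
noncomputable def XL {n : ℕ} (v w : Fin n) : (KEdge n → ℝ) →ₗ[ℝ] ℝ :=
  if h : (s(v, w) : Sym2 (Fin n)).IsDiag then 0 else LinearMap.proj ⟨s(v, w), h⟩

/-- adjacency number -/
noncomputable def aN {n : ℕ} (F : Finset (KEdge n)) (v w : Fin n) : ℕ :=
  if ∃ h : ¬ (s(v, w) : Sym2 (Fin n)).IsDiag, (⟨s(v, w), h⟩ : KEdge n) ∈ F then 1 else 0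

lemma XL_char {n : ℕ} (F : Finset (KEdge n)) (v w : Fin n) :
    XL v w (fun e => if e ∈ F then (1 : ℝ) else 0) = aN F v w := by
  unfold XL aN
  by_cases h : (s(v, w) : Sym2 (Fin n)).IsDiag
  · rw [dif_pos h, if_neg (by rintro ⟨h', _⟩; exact h' h)]
    simp
  · rw [dif_neg h]
    by_cases h2 : (⟨s(v, w), h⟩ : KEdge n) ∈ F
    · rw [if_pos ⟨h, h2⟩]
      simp [h2]
    · rw [if_neg (by rintro ⟨_, h'⟩; exact h2 h')]
      simp [h2]

lemma aN_sum {n : ℕ} (F : Finset (KEdge n)) (v : Fin n) :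
    ∑ w, aN F v w = (F.filter (fun e => v ∈ e.1)).card := by
  unfold aN
  rw [Finset.sum_boole]
  simp only [Nat.cast_id]
  refine Finset.card_bij (fun w hw => ⟨s(v, w), (Finset.mem_filter.1 hw).2.1⟩) ?_ ?_ ?_
  · intro w hw
    have := (Finset.mem_filter.1 hw).2.2
    simp [this]
  · intro w hw w' hw' h
    have h := congrArg Subtype.val h
    simp at h
    rcases h with h | ⟨h, h'⟩
    · exact h
    · exact h'.trans h
  · rintro ⟨e, he⟩ hb
    rw [Finset.mem_filter] at hb
    obtain ⟨w, hw⟩ := hb.2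
    simp only at hw
    subst hw
    exact ⟨w, Finset.mem_filter.2 ⟨Finset.mem_univ _, he, hb.1⟩, rfl⟩

lemma aN_symm {n : ℕ} (F : Finset (KEdge n)) (v w : Fin n) : aN F v w = aN F w v := by
  unfold aN
  rw [Sym2.eq_swap]

lemma aN_self {n : ℕ} (F : Finset (KEdge n)) (v : Fin n) : aN F v v = 0 := by
  unfold aN
  rw [if_neg]
  rintro ⟨h, _⟩
  exact h (by simp)

lemma aN_le {n : ℕ} (F : Finset (KEdge n)) (v w : Fin n) : aN F v w ≤ 1 := by
  unfold aN
  split_ifs <;> norm_num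

lemma parity_core {V : Type*} [Fintype V] [DecidableEq V] (a : V → V → ℕ) (S : V → Bool) (p : V → V)
    (hs : ∀ v w, a v w = a w v) (h0 : ∀ v, a v v = 0) (h1 : ∀ v w, a v w ≤ 1)
    (h2 : ∀ v, ∑ w, a v w = 2) (hS : Odd (∑ v, (S v).toNat)) (hp : ∀ v, S v = true → S (p v) = false) :
    1 ≤ ∑ v, ∑ w, if S v = true ∧ S w = false then (if w = p v then 1 - a v w else a v w) else 0 := by
  have key : ((∑ v, ∑ w, if S v = true ∧ S w = false then (if w = p v then 1 - a v w else a v w) else 0 : ℕ)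
      : ZMod 2) = 1 := by
    have e1 : ∀ v, ((∑ w, if S v = true ∧ S w = false then (if w = p v then 1 - a v w else a v w) else 0 : ℕ)
        : ZMod 2) = ((S v).toNat : ZMod 2) +
          ∑ w, (if S v = true ∧ S w = true then (a v w : ZMod 2) else 0) := by
      intro v
      by_cases hv : S v = true
      · have h3 : ∑ w, (a v w : ZMod 2) = 0 := by
          have := congrArg (Nat.cast : ℕ → ZMod 2) (h2 v)
          push_cast at this
          rw [this]; rfl
        have h4 : ∀ w, ((if S v = true ∧ S w = false then (if w = p v then 1 - a v w else a v w) else 0 : ℕ)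
            : ZMod 2) = (if w = p v then 1 else 0) + (a v w : ZMod 2) +
              (if S v = true ∧ S w = true then (a v w : ZMod 2) else 0) := by
          intro w
          by_cases hw : w = p v
          · have hw' : S w = false := by rw [hw]; exact hp v hv
            rw [if_pos ⟨hv, hw'⟩, if_pos hw, if_pos hw, if_neg (by simp [hw'])]
            have := h1 v w
            interval_cases (a v w) <;> rfl
          · rcases hw' : S w with _ | _
            · simp [hv, hw]
            · simp only [hv, hw, if_false]
              simp
              exact (CharTwo.add_self_eq_zero _).symm
        push_cast at h4 ⊢
        rw [Finset.sum_congr rfl (fun w _ => h4 w), Finset.sum_add_distrib, Finset.sum_add_distrib, h3]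
        simp [hv]
      · simp [hv]
    rw [Nat.cast_sum, Finset.sum_congr rfl (fun v _ => e1 v), Finset.sum_add_distrib]
    have e2 : ∑ v, ∑ w, (if S v = true ∧ S w = true then (a v w : ZMod 2) else 0) = 0 := by
      rw [← Fintype.sum_prod_type']
      refine Finset.sum_involution (fun z _ => (z.2, z.1)) ?_ ?_ ?_ ?_
      · rintro ⟨v, w⟩ _
        simp only [hs w v, and_comm (a := S w = true)]
        exact CharTwo.add_self_eq_zero _
      · rintro ⟨v, w⟩ _ h hvw
        apply h
        have : w = v := by simpa using congrArg Prod.fst hvw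
        simp [this, h0]
      · intro _ _; exact Finset.mem_univ _
      · intro _ _; rfl
    rw [e2, add_zero, ← Nat.cast_sum]
    exact (ZMod.natCast_eq_one_iff_odd).2 hS
  by_contra hcon
  have hz : (∑ v, ∑ w, if S v = true ∧ S w = false then (if w = p v then 1 - a v w else a v w) else 0) = 0 := by
    omega
  rw [hz] at key
  simp at key

/-- linear part of the slack -/
noncomputable def slackC {n : ℕ} (S : Fin n → Bool) (p : Fin n → Fin n) : (KEdge n → ℝ) →ₗ[ℝ] ℝ :=
  ∑ v, ∑ w, if S v = true ∧ S w = false then (if w = p v then - XL v w else XL v w) else 0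

/-- constant part of the slack -/
noncomputable def slackD {n : ℕ} (S : Fin n → Bool) (p : Fin n → Fin n) : ℝ :=
  (∑ v, ∑ w, if S v = true ∧ S w = false then (if w = p v then 1 else 0) else 0) - 1

lemma slack_char {n : ℕ} (S : Fin n → Bool) (p : Fin n → Fin n) (F : Finset (KEdge n)) :
    slackC S p (fun e => if e ∈ F then (1 : ℝ) else 0) + slackD S p =
      ((∑ v, ∑ w, if S v = true ∧ S w = false then (if w = p v then 1 - aN F v w else aN F v w) else 0 : ℕ) : ℝ)
        - 1 := by
  unfold slackC slackD
  rw [← add_sub_assoc]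
  congr 1
  rw [LinearMap.sum_apply, ← Finset.sum_add_distrib]
  rw [Nat.cast_sum]
  refine Finset.sum_congr rfl (fun v _ => ?_)
  rw [Nat.cast_sum, LinearMap.sum_apply, ← Finset.sum_add_distrib]
  refine Finset.sum_congr rfl (fun w _ => ?_)
  have := aN_le F v w
  split_ifs
  · rw [LinearMap.neg_apply, XL_char, Nat.cast_sub this]
    push_cast; ring
  · rw [XL_char, add_zero]
  · simp

lemma slack_nonneg {n : ℕ} (S : Fin n → Bool) (p : Fin n → Fin n)
    (hS : Odd (∑ v, (S v).toNat)) (hp : ∀ v, S v = true → S (p v) = false)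
    (x : KEdge n → ℝ) (hx : x ∈ twoMatchingPolytope n) : 0 ≤ slackC S p x + slackD S p := by
  have hconv : Convex ℝ {x | - slackD S p ≤ slackC S p x} :=
    convex_halfSpace_ge (slackC S p).isLinear _
  have hsub := convexHull_min (t := {x | - slackD S p ≤ slackC S p x}) (s := {x | ∃ F : Finset (KEdge n), IsTwoMatchingKn F ∧
    x = fun e => if e ∈ F then (1 : ℝ) else 0}) (by
      rintro x ⟨F, hF, rfl⟩
      have h1 := slack_char S p F
      have h2 := parity_core (aN F) S p (aN_symm F) (aN_self F) (aN_le F)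
        (fun v => by rw [aN_sum]; exact hF v) hS hp
      have h3 : (1 : ℝ) ≤ ((∑ v, ∑ w, if S v = true ∧ S w = false then
        (if w = p v then 1 - aN F v w else aN F v w) else 0 : ℕ) : ℝ) := by exact_mod_cast h2
      change - slackD S p ≤ slackC S p _
      linarith) hconv
  have : - slackD S p ≤ slackC S p x := hsub hx
  linarith

/-- the ground set for two-matchings -/
abbrev WW (m l : ℕ) := (VV m × Bool) ⊕ Fin (l + 3)

/-- adjacency of the two-factor belonging to a matching -/
def hAdj {m : ℕ} (l : ℕ) (M : VV m → VV m) : WW m l → WW m l → Prop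
  | Sum.inl (u, b), Sum.inl (u', b') => (u' = u ∧ b' = !b) ∨ (u' = M u ∧ b' = b)
  | Sum.inr z, Sum.inr z' => (cycleGraph (l + 3)).Adj z z'
  | _, _ => False

lemma hAdj_ll {m : ℕ} (l : ℕ) (M : VV m → VV m) (z z' : VV m × Bool) :
    hAdj l M (Sum.inl z) (Sum.inl z') ↔ (z' = (z.1, !z.2)) ∨ (z' = (M z.1, z.2)) := by
  rcases z with ⟨u, b⟩
  rcases z' with ⟨u', b'⟩
  simp [hAdj]

lemma hAdj_lr {m : ℕ} (l : ℕ) (M : VV m → VV m) (z : VV m × Bool) (z' : Fin (l + 3)) :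
    hAdj l M (Sum.inl z) (Sum.inr z') ↔ False := by
  simp [hAdj]

lemma hAdj_rl {m : ℕ} (l : ℕ) (M : VV m → VV m) (z : VV m × Bool) (z' : Fin (l + 3)) :
    hAdj l M (Sum.inr z') (Sum.inl z) ↔ False := by
  simp [hAdj]

lemma hAdj_rr {m : ℕ} (l : ℕ) (M : VV m → VV m) (z z' : Fin (l + 3)) :
    hAdj l M (Sum.inr z) (Sum.inr z') ↔ (cycleGraph (l + 3)).Adj z z' := by
  simp [hAdj]

lemma hAdj_symm {m : ℕ} (l : ℕ) (M : VV m → VV m) (hM : PerfM M) (a b : WW m l)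
    (h : hAdj l M a b) : hAdj l M b a := by
  rcases a with ⟨u, c⟩ | z <;> rcases b with ⟨u', c'⟩ | z' <;> simp only [hAdj] at h ⊢
  · rcases h with ⟨rfl, rfl⟩ | ⟨rfl, rfl⟩
    · left; simp
    · right; simp [hM.1 u]
  · exact h.symm

lemma hAdj_irrefl {m : ℕ} (l : ℕ) (M : VV m → VV m) (hM : PerfM M) (a : WW m l) : ¬ hAdj l M a a := by
  rcases a with ⟨u, c⟩ | z <;> simp only [hAdj]
  · rintro (⟨_, h⟩ | ⟨h, _⟩)
    · cases c <;> simp at h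
    · exact hM.2 u h.symm
  · exact (cycleGraph (l + 3)).loopless.irrefl z

lemma hAdj_deg {m : ℕ} (l : ℕ) (M : VV m → VV m) (hM : PerfM M) (a : WW m l) :
    ∑ b, (if hAdj l M a b then 1 else 0 : ℕ) = 2 := by
  rw [Fintype.sum_sum_type]
  rcases a with ⟨u, c⟩ | z
  · simp only [hAdj_ll, hAdj_lr, if_false, Finset.sum_const_zero, add_zero]
    have h1 : ∀ z : VV m × Bool, (if z = (u, !c) ∨ z = (M u, c) then 1 else 0 : ℕ) =
        (if z = (u, !c) then 1 else 0) + (if z = (M u, c) then 1 else 0) := by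
      intro z
      by_cases ha : z = (u, !c)
      · have : ¬ (z = (M u, c)) := by
          rw [ha]
          cases c <;> simp
        rw [if_pos (Or.inl ha), if_pos ha, if_neg this]
      · by_cases hb : z = (M u, c)
        · rw [if_pos (Or.inr hb), if_neg ha, if_pos hb]
        · rw [if_neg (by tauto), if_neg ha, if_neg hb]
    simp only [h1]
    rw [Finset.sum_add_distrib]
    simp only [Finset.sum_ite_eq', Finset.mem_univ, if_true]
  · have := cycleGraph_degree_three_le (n := l) (v := z)
    rw [← card_neighborFinset_eq_degree, neighborFinset_eq_filter, Finset.card_filter] at this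
    simp only [hAdj_rl, hAdj_rr, if_false, Finset.sum_const_zero, zero_add]
    convert this

/-- the two-factor -/
noncomputable def FM {m l n : ℕ} (E : WW m l ≃ Fin n) (M : VV m → VV m) : Finset (KEdge n) :=
  Finset.univ.filter (fun e => ∃ a b, e.1 = s(E a, E b) ∧ hAdj l M a b)

lemma aN_FM {m l n : ℕ} (E : WW m l ≃ Fin n) (M : VV m → VV m) (hM : PerfM M) (a b : WW m l) :
    aN (FM E M) (E a) (E b) = if hAdj l M a b then 1 else 0 := by
  unfold aN FM
  congr 1
  apply propext
  constructor
  · rintro ⟨h, hm⟩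
    rw [Finset.mem_filter] at hm
    obtain ⟨_, a', b', h1, h2⟩ := hm
    simp only [Sym2.eq_iff, E.injective.eq_iff] at h1
    rcases h1 with ⟨rfl, rfl⟩ | ⟨rfl, rfl⟩
    · exact h2
    · exact hAdj_symm l M hM _ _ h2
  · intro h
    refine ⟨?_, ?_⟩
    · intro hd
      have : a = b := by simpa using hd
      subst this
      exact hAdj_irrefl l M hM a h
    · rw [Finset.mem_filter]
      exact ⟨Finset.mem_univ _, a, b, rfl, h⟩

lemma FM_two {m l n : ℕ} (E : WW m l ≃ Fin n) (M : VV m → VV m) (hM : PerfM M) :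
    IsTwoMatchingKn (FM E M) := by
  intro v
  rw [← aN_sum, ← Equiv.sum_comp E]
  obtain ⟨a, rfl⟩ := E.surjective v
  simp only [aN_FM E M hM]
  exact hAdj_deg l M hM a

/-- lifted cut -/
def liftS {m l : ℕ} (U : VV m → Bool) : WW m l → Bool
  | Sum.inl (u, true) => U u
  | _ => false

/-- partner -/
def liftP {m l : ℕ} : WW m l → WW m l
  | Sum.inl (u, b) => Sum.inl (u, !b)
  | Sum.inr z => Sum.inr z

lemma slack_FM {m l n : ℕ} (E : WW m l ≃ Fin n) (U : VV m → Bool) (M : VV m → VV m) (hM : PerfM M) :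
    slackC (liftS U ∘ E.symm) (E ∘ liftP ∘ E.symm) (fun e => if e ∈ FM E M then (1 : ℝ) else 0) +
      slackD (liftS U ∘ E.symm) (E ∘ liftP ∘ E.symm) = (crossN U M : ℝ) - 1 := by
  rw [slack_char]
  congr 2
  rw [← Equiv.sum_comp E]
  have h1 : ∀ a, ∑ w, (if (liftS U ∘ E.symm) (E a) = true ∧ (liftS U ∘ E.symm) w = false then
      (if w = (E ∘ liftP ∘ E.symm) (E a) then 1 - aN (FM E M) (E a) w else aN (FM E M) (E a) w) else 0) =
      ∑ b, (if liftS U a = true ∧ liftS U b = false then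
        (if b = liftP a then 1 - (if hAdj l M a b then 1 else 0) else (if hAdj l M a b then 1 else 0)) else 0) := by
    intro a
    rw [← Equiv.sum_comp E]
    simp only [aN_FM E M hM, Function.comp, Equiv.symm_apply_apply, E.injective.eq_iff]
  rw [Finset.sum_congr rfl (fun a _ => h1 a)]
  unfold crossN
  rw [Fintype.sum_sum_type, Fintype.sum_prod_type]
  have h2 : ∀ z : Fin (l + 3), liftS (m := m) U (Sum.inr z) = false := fun _ => rfl
  have h3 : ∀ u, liftS (l := l) U (Sum.inl (u, false)) = false := fun _ => rfl
  have h4 : ∀ u, liftS (l := l) U (Sum.inl (u, true)) = U u := fun _ => rfl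
  simp only [Fintype.sum_bool, h2, h3, h4]
  simp only [Bool.false_eq_true, false_and, if_false, Finset.sum_const_zero, add_zero]
  refine Finset.sum_congr rfl (fun u _ => ?_)
  rcases hu : U u with _ | _
  · simp
  · rw [Fintype.sum_sum_type, Fintype.sum_prod_type]
    refine (congrArg₂ (· + ·) (Finset.sum_congr rfl (fun u' _ =>
      (?_ : _ = if u' = M u then (!U (M u)).toNat else 0)))
      (Finset.sum_congr rfl (fun z _ => (?_ : _ = 0)))).trans ?_
    · rw [Fintype.sum_bool]
      simp only [h3, h4, hAdj_ll, liftP]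
      by_cases h : u' = M u
      · subst h
        rcases U (M u) <;> by_cases h' : M u = u <;> simp [h']
      · have hn : ¬ (u = M u) := fun h => hM.2 u h.symm
        by_cases h' : u' = u <;> simp [h, h', hn]
    · simp only [hAdj_lr]
      simp [liftP]
    · simp


/-! ### Conclusion -/

lemma xc_bound (n m l : ℕ) (hn : n = 12 * m + 23 + l) :
    Real.exp (1 / 220500 * ((m : ℝ) + 1)) ≤
      250 * (6 * m + 10) * ((xc (twoMatchingPolytope n) : ℝ) + 1) := by
  let E : WW m l ≃ Fin n := Fintype.equivFinOfCardEq (by simp; omega)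
  have hfin : {x : KEdge n → ℝ | ∃ F : Finset (KEdge n), IsTwoMatchingKn F ∧
      x = fun e => if e ∈ F then (1 : ℝ) else 0}.Finite := by
    refine (Set.finite_range (fun F : Finset (KEdge n) =>
      (fun e => if e ∈ F then (1 : ℝ) else 0 : KEdge n → ℝ))).subset ?_
    rintro x ⟨F, _, rfl⟩
    exact ⟨F, rfl⟩
  have hmem : ∃ (d : ℕ) (A : Matrix (Fin (xc (twoMatchingPolytope n))) (Fin d) ℝ)
      (b : Fin (xc (twoMatchingPolytope n)) → ℝ)
      (π : (Fin d → ℝ) →ₗ[ℝ] (KEdge n → ℝ)), π '' {x | A.mulVec x ≤ b} = twoMatchingPolytope n :=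
    Nat.sInf_mem (exists_ext _ hfin)
  generalize xc (twoMatchingPolytope n) = k at hmem ⊢
  obtain ⟨d, A, b, π, hπ⟩ := hmem
  have hpre : ∀ M : VV m → VV m, ∃ x : Fin d → ℝ, PerfM M → (A.mulVec x ≤ b ∧
      π x = fun e => if e ∈ FM E M then (1 : ℝ) else 0) := by
    intro M
    by_cases hM : PerfM M
    · have : (fun e => if e ∈ FM E M then (1 : ℝ) else 0) ∈ twoMatchingPolytope n :=
        subset_convexHull ℝ _ ⟨FM E M, FM_two E M hM, rfl⟩
      rw [← hπ] at this
      obtain ⟨x, hx, hx'⟩ := this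
      exact ⟨x, fun _ => ⟨hx, hx'⟩⟩
    · exact ⟨0, fun h => absurd h hM⟩
  choose pre hpre using hpre
  have hM0 : PerfM (matM (m := m) 0 (fun _ => false)) := ⟨matM_inv _ _, matM_ne _ _⟩
  have hlam : ∀ U : VV m → Bool, ∃ lam : Option (Fin k) → ℝ, OddCut U → ((∀ i, 0 ≤ lam i) ∧
      ∀ x, slackC (liftS U ∘ E.symm) (E ∘ liftP ∘ E.symm) (π x) +
        slackD (liftS U ∘ E.symm) (E ∘ liftP ∘ E.symm) =
        lam none + ∑ i, lam (some i) * (b i - A.mulVec x i)) := by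
    intro U
    by_cases hU : OddCut U
    · have hodd : Odd (∑ v, ((liftS U ∘ E.symm) v).toNat) := by
        have h1 : ∑ v, ((liftS U ∘ E.symm) v).toNat = ∑ a : WW m l, (liftS U a).toNat := by
          exact Equiv.sum_comp E.symm (fun a : WW m l => (liftS U a).toNat)
        have h2 : ∑ a : WW m l, (liftS U a).toNat = ∑ u, (U u).toNat := by
          rw [Fintype.sum_sum_type, Fintype.sum_prod_type]
          simp only [Fintype.sum_bool, liftS]
          simp
        rw [h1, h2]
        exact hU
      have hp : ∀ v, (liftS U ∘ E.symm) v = true →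
          (liftS U ∘ E.symm) ((E ∘ liftP ∘ E.symm) v) = false := by
        intro v
        simp only [Function.comp, Equiv.symm_apply_apply]
        rcases E.symm v with ⟨u, _ | _⟩ | z <;> simp [liftS, liftP]
      obtain ⟨lam, hl⟩ := farkas_aff A b (pre _) (hpre _ hM0).1
        (slackC (liftS U ∘ E.symm) (E ∘ liftP ∘ E.symm) ∘ₗ π)
        (slackD (liftS U ∘ E.symm) (E ∘ liftP ∘ E.symm)) (by
          intro x hx
          exact slack_nonneg _ _ hodd hp _ (hπ ▸ Set.mem_image_of_mem π hx))
      exact ⟨lam, fun _ => hl⟩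
    · exact ⟨0, fun h => absurd h hU⟩
  choose lam hlam using hlam
  have := rank_bound (fun r U => lam U r)
    (fun r M => Option.elim r 1 (fun i => b i - A.mulVec (pre M) i))
    (fun r U hU => (hlam U hU).1 r)
    (by
      intro r M hM
      rcases r with _ | i
      · simp
      · have := (hpre M hM).1 i
        simpa using this)
    (by
      intro U M hU hM
      rw [← slack_FM E U M hM, ← (hpre M hM).2, (hlam U hU).2, Fintype.sum_option]
      simp)
  simp only [Fintype.card_option, Fintype.card_fin] at this
  push_cast at this
  exact this

theorem two_matching_polytope_xc_exponential :
    ∃ c : ℝ, 0 < c ∧ ∃ N : ℕ, ∀ n : ℕ, N ≤ n →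
      (2 : ℝ) ^ (c * n) ≤ (xc (twoMatchingPolytope n) : ℝ) := by
  obtain ⟨a, ha⟩ : ∃ a : ℝ, a = 1 / 220500 / 24 := ⟨_, rfl⟩
  have ha0 : 0 < a := by rw [ha]; norm_num
  refine ⟨a, ha0, ⌈3000 / a ^ 2⌉₊ + 23, fun n hn => ?_⟩
  have hn1 : (3000 / a ^ 2 : ℝ) ≤ n := by
    refine (Nat.le_ceil _).trans ?_
    exact_mod_cast (by omega : ⌈3000 / a ^ 2⌉₊ ≤ n)
  have hn2 : 23 ≤ n := by omega
  have hb := xc_bound n ((n - 23) / 12) ((n - 23) % 12) (by omega)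
  set m := (n - 23) / 12 with hm
  set k : ℝ := (xc (twoMatchingPolytope n) : ℝ) with hk
  have hk0 : 0 ≤ k := Nat.cast_nonneg _
  have hnpos : (0 : ℝ) < n := by exact_mod_cast (by omega : 0 < n)
  have hm1 : (n : ℝ) ≤ 12 * ((m : ℝ) + 1) + 23 := by
    exact_mod_cast (by omega : n ≤ 12 * (m + 1) + 23)
  have hm2 : (6 * (m : ℝ) + 10) ≤ n := by
    exact_mod_cast (by omega : 6 * m + 10 ≤ n)
  have h1 : Real.exp (a * n + a * n - 46 * a) ≤ 250 * n * (k + 1) := by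
    refine le_trans (Real.exp_le_exp.2 ?_) (hb.trans ?_)
    · rw [ha]; linarith
    · gcongr
  have h2 : (2 : ℝ) ^ (a * n) ≤ Real.exp (a * n) := by
    rw [Real.rpow_def_of_pos (by norm_num)]
    apply Real.exp_le_exp.2
    have : Real.log 2 ≤ 1 := by have := Real.log_two_lt_d9; linarith
    have : 0 ≤ a * n := by positivity
    nlinarith
  set X := Real.exp (a * n) with hX
  have hX1 : 1 ≤ X := Real.one_le_exp (by positivity)
  have h3 : a * n + a * n - 46 * a = a * n + (a * n + (- (46 * a))) := by ring
  rw [h3, Real.exp_add, Real.exp_add] at h1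
  have h4 : (1 / 3 : ℝ) ≤ Real.exp (- (46 * a)) := by
    have := Real.add_one_le_exp (- (46 * a))
    have h5 : 46 * a ≤ 1 / 2 := by rw [ha]; norm_num
    linarith
  have h6 : 1500 * n ≤ X := by
    have := Real.quadratic_le_exp_of_nonneg (x := a * n) (by positivity)
    have h7 : 3000 ≤ n * a ^ 2 := by rwa [div_le_iff₀ (by positivity)] at hn1
    have h8 := mul_le_mul_of_nonneg_right h7 hnpos.le
    have h9 : 0 ≤ a * n := by positivity
    nlinarith
  have h10 : 500 * n * X ≤ 250 * n * (k + 1) := by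
    refine le_trans ?_ h1
    have : 500 * n ≤ X * Real.exp (- (46 * a)) := by
      have := mul_le_mul h6 h4 (by norm_num) (by positivity)
      linarith
    nlinarith
  have h11 : 2 * X ≤ k + 1 := by
    refine le_of_mul_le_mul_left (a := 250 * (n : ℝ)) ?_ (by positivity)
    linarith
  linarith
end
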